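/- Let f be an E-function that is transcendental over ℂ(z) (i.e., the entire function f is not algebraic over the field of rational functions ℂ(z)). Then the set {α ∈ ℚ̄ : f(α) ∈ ℚ̄} of algebraic numbers at which f takes an algebraic value is finite. -/

import Mathlib

noncomputable section

/-- `ℚ̄`: the field of algebraic numbers, i.e. the algebraic closure of `ℚ` inside `ℂ`. -/
def Qbar : IntermediateField ℚ ℂ := algebraicClosure ℚ ℂ

/-- `f : ℂ → ℂ` is the E-function with Taylor coefficients `aₙ/n!` (the `aₙ` being
algebraic numbers): `f(z) = ∑ aₙ/n! zⁿ`; the conjugates of the `aₙ` grow at most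
geometrically; the `aₙ` admit denominators growing at most geometrically; and `f`
satisfies a nonzero linear differential equation with coefficients in `ℚ̄(z)`
(equivalently, after clearing denominators, with polynomial coefficients all of
whose coefficients are algebraic). -/
def IsEFunctionWith (a : ℕ → Qbar) (f : ℂ → ℂ) : Prop :=
  (∀ z : ℂ, HasSum (fun n : ℕ => (a n : ℂ) / n.factorial * z ^ n) (f z)) ∧
  (∃ C : ℝ, 0 < C ∧ ∀ σ : Qbar →+* ℂ, ∀ n : ℕ, ‖σ (a n)‖ ≤ C ^ (n + 1)) ∧
  (∃ D : ℝ, 0 < D ∧ ∃ d : ℕ → ℕ, (∀ n : ℕ, d n ≠ 0 ∧ (d n : ℝ) ≤ D ^ (n + 1)) ∧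
    ∀ n : ℕ, ∀ m ≤ n, IsIntegral ℤ ((d n : ℂ) * (a m : ℂ))) ∧
  (∃ r : ℕ, ∃ p : Fin (r + 1) → Polynomial ℂ,
    (∀ j, ∀ i, IsAlgebraic ℚ ((p j).coeff i)) ∧ (∃ j, p j ≠ 0) ∧
    ∀ z : ℂ, ∑ j : Fin (r + 1), (p j).eval z * iteratedDeriv (j : ℕ) f z = 0)

/-- `f : ℂ → ℂ` is an E-function. -/
def IsEFunction (f : ℂ → ℂ) : Prop := ∃ a : ℕ → Qbar, IsEFunctionWith a f

/-- The function `f` is algebraic over `ℂ(z)`: there is a nonzero two-variable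
polynomial `P ∈ ℂ[z][Y]` with `P(z, f(z)) = 0` for all `z`. -/
def IsAlgebraicFunc (f : ℂ → ℂ) : Prop :=
  ∃ P : Polynomial (Polynomial ℂ), P ≠ 0 ∧
    ∀ z : ℂ, ((P.eval (Polynomial.C (f z))).eval z) = 0

section ExceptionalPoints

open Polynomial NumberField

theorem exists_const_mem_of_deriv_stable {K L ι : Type*} [Field K] [Field L] [Algebra K L]
    [Fintype ι] (δ : Derivation K L L) (hδ : ∀ x, δ x = 0 → ∃ c, algebraMap K L c = x)
    (W : Submodule L (ι → L)) (hW : ∀ w ∈ W, (fun i => δ (w i)) ∈ W) (hW0 : W ≠ ⊥) :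
    ∃ c : ι → K, c ≠ 0 ∧ (fun i => algebraMap K L (c i)) ∈ W := by
  classical
  obtain ⟨w0, hw0, hw00⟩ := Submodule.exists_mem_ne_zero_of_ne_bot hW0
  let P : ℕ → Prop := fun n => ∃ w ∈ W, w ≠ 0 ∧ (Finset.univ.filter fun i => w i ≠ 0).card = n
  have hP : ∃ n, P n := ⟨_, w0, hw0, hw00, rfl⟩
  obtain ⟨w, hw, hwne, hcard⟩ := Nat.find_spec hP
  have hmin : ∀ v ∈ W, v ≠ 0 → (Finset.univ.filter fun i => w i ≠ 0).card ≤
      (Finset.univ.filter fun i => v i ≠ 0).card := fun v hv hv0 => by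
    rw [hcard]; exact Nat.find_min' hP ⟨v, hv, hv0, rfl⟩
  obtain ⟨i0, hi0⟩ := Function.ne_iff.mp hwne
  have hi0' : w i0 ≠ 0 := hi0
  set v : ι → L := (w i0)⁻¹ • w with hv
  have hvW : v ∈ W := W.smul_mem _ hw
  have hv1 : v i0 = 1 := by simp [hv, hi0']
  have hvs : ∀ i, v i = 0 ↔ w i = 0 := fun i => by simp [hv, hi0']
  have hd : (fun i => δ (v i)) = 0 := by
    by_contra hne
    have h1 := hmin _ (hW v hvW) hne
    refine absurd h1 (not_le.mpr (Finset.card_lt_card ?_))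
    refine ⟨fun i hi => ?_, fun h => ?_⟩
    · simp only [Finset.mem_filter, Finset.mem_univ, true_and] at hi ⊢
      intro h0
      exact hi (by rw [(hvs i).mpr h0, map_zero])
    · have := @h i0 (by simp [hi0'])
      simp [hv1] at this
  choose c hc using fun i => hδ (v i) (congr_fun hd i)
  refine ⟨c, fun h => ?_, ?_⟩
  · have := hc i0
    simp [h, hv1] at this
  · simpa [hc] using hvW

/-- The ring of additive endomorphisms generated by the scalars of `L` and one operator `D`. -/
def operatorRing (L : Type*) {V : Type*} [Field L] [AddCommGroup V] [Module L V] (D : V →+ V) :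
    Subring (AddMonoid.End V) :=
  Subring.closure (Set.range (fun l : L => (DistribSMul.toAddMonoidHom V l : AddMonoid.End V)) ∪
    {(D : AddMonoid.End V)})

section OperatorRing

variable {L V : Type*} [Field L] [AddCommGroup V] [Module L V] (D : V →+ V)

theorem smul_mem_of_operatorRing (N : Submodule (operatorRing L D) V) (l : L) {v : V}
    (hv : v ∈ N) : l • v ∈ N :=
  N.smul_mem ⟨DistribSMul.toAddMonoidHom V l, Subring.subset_closure (Or.inl ⟨l, rfl⟩)⟩ hv

theorem apply_mem_of_operatorRing (N : Submodule (operatorRing L D) V) {v : V}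
    (hv : v ∈ N) : D v ∈ N :=
  N.smul_mem ⟨D, Subring.subset_closure (Or.inr rfl)⟩ hv

theorem map_smul_of_operatorRing {N : Submodule (operatorRing L D) V}
    (φ : N →ₗ[operatorRing L D] V) (l : L) {v : V} (hv : v ∈ N) :
    φ ⟨l • v, smul_mem_of_operatorRing D N l hv⟩ = l • φ ⟨v, hv⟩ :=
  φ.map_smul ⟨DistribSMul.toAddMonoidHom V l, Subring.subset_closure (Or.inl ⟨l, rfl⟩)⟩ ⟨v, hv⟩

theorem map_apply_of_operatorRing {N : Submodule (operatorRing L D) V}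
    (φ : N →ₗ[operatorRing L D] V) {v : V} (hv : v ∈ N) :
    φ ⟨D v, apply_mem_of_operatorRing D N hv⟩ = D (φ ⟨v, hv⟩) :=
  φ.map_smul ⟨D, Subring.subset_closure (Or.inr rfl)⟩ ⟨v, hv⟩

/-- A submodule over the operator ring, seen as a subspace. -/
def operatorSubspace (N : Submodule (operatorRing L D) V) : Submodule L V where
  carrier := N
  add_mem' := N.add_mem
  zero_mem' := N.zero_mem
  smul_mem' l _ hv := smul_mem_of_operatorRing D N l hv

theorem operatorSubspace_strictMono : StrictMono (operatorSubspace (L := L) D) := by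
  intro N N' h
  exact ⟨fun x hx => h.1 hx, fun h' => h.2 fun x hx => h' hx⟩

/-- A `D`-stable subspace, seen as a submodule over the operator ring. -/
def stableSubmodule (N : Submodule L V) (hN : ∀ v ∈ N, D v ∈ N) :
    Submodule (operatorRing L D) V where
  carrier := N
  add_mem' := N.add_mem
  zero_mem' := N.zero_mem
  smul_mem' := by
    rintro ⟨r, hr⟩
    change ∀ x ∈ N, r x ∈ N
    refine Subring.closure_induction (p := fun r _ => ∀ x ∈ N, r x ∈ N) ?_ ?_ ?_ ?_ ?_ ?_ hr
    · rintro s (⟨l, rfl⟩ | h) x hx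
      · exact N.smul_mem l hx
      · have hs : s = D := h
        rw [hs]
        exact hN x hx
    · intro x _
      exact N.zero_mem
    · intro x hx
      exact hx
    · intro a b _ _ ha hb x hx
      exact N.add_mem (ha x hx) (hb x hx)
    · intro a _ ha x hx
      exact N.neg_mem (ha x hx)
    · intro a b _ _ ha hb x hx
      exact ha _ (hb x hx)

end OperatorRing

theorem finiteDimensional_span_of_dependent {K V : Type*} [Field K] [AddCommGroup V] [Module K V]
    (t : Set V) (n : ℕ)
    (h : ∀ v : Fin n → V, (∀ i, v i ∈ t) → ¬ LinearIndependent K v) :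
    FiniteDimensional K (Submodule.span K t) := by
  obtain ⟨b, hbt, hspan, hli⟩ := exists_linearIndependent K t
  have hfin : b.Finite := by
    by_contra hinf
    have hinf' : b.Infinite := hinf
    obtain ⟨s, hs, hcard⟩ := hinf'.exists_subset_card_eq n
    let e : Fin n ≃ s := (finCongr hcard.symm).trans s.equivFin.symm
    refine h (fun i => (e i : V)) (fun i => hbt (hs (e i).2)) ?_
    have := hli.comp (fun i : Fin n => (⟨e i, hs (e i).2⟩ : b)) (fun i j hij => by
      apply e.injective
      apply Subtype.ext
      simpa using hij)
    exact this
  rw [← hspan]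
  exact FiniteDimensional.span_of_finite K hfin

section StableSubspaces

variable {K L V : Type*} [Field K] [Field L] [Algebra K L] [AddCommGroup V] [Module L V]
  [Module K V] [IsScalarTower K L V] [FiniteDimensional L V] (δ : Derivation K L L)
  (D : V →+ V)

theorem finiteDimensional_span_hom (hδ : ∀ x, δ x = 0 → ∃ c, algebraMap K L c = x)
    (hD : ∀ (g : L) (v : V), D (g • v) = δ g • v + g • D v)
    (S : Submodule (operatorRing L D) V) (x : S) :
    FiniteDimensional K (Submodule.span K
      {v | ∃ φ : S →ₗ[operatorRing L D] V, φ x = v}) := by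
  classical
  let S' := operatorSubspace D S
  let b := Module.finBasis L S'
  refine finiteDimensional_span_of_dependent _
    (Module.finrank L (Fin (Module.finrank L S') → V) + 1) fun v hv hli => ?_
  choose φ hφ using hv
  let W : Submodule L (Fin (Module.finrank L (Fin (Module.finrank L S') → V) + 1) → L) :=
    { carrier := {g | ∀ y : S, ∑ i, g i • φ i y = 0}
      add_mem' := fun {g g'} hg hg' y => by
        simp only [Pi.add_apply, add_smul, Finset.sum_add_distrib, hg y, hg' y, add_zero]
      zero_mem' := fun y => by simp
      smul_mem' := fun l g hg y => by
        simp only [Pi.smul_apply, smul_eq_mul, mul_smul, ← Finset.smul_sum, hg y, smul_zero] }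
  have hWst : ∀ w ∈ W, (fun i => δ (w i)) ∈ W := by
    intro g hg y
    have h1 := congrArg D (hg y)
    rw [map_sum, map_zero] at h1
    have h2 := hg ⟨D y, apply_mem_of_operatorRing D S y.2⟩
    have h3 : ∀ i, φ i ⟨D y, apply_mem_of_operatorRing D S y.2⟩ = D (φ i y) := fun i =>
      map_apply_of_operatorRing D (φ i) y.2
    simp only [h3] at h2
    simp only [hD, Finset.sum_add_distrib] at h1 h2
    rw [h2, add_zero] at h1
    exact h1
  have hW0 : W ≠ ⊥ := by
    let M : (Fin (Module.finrank L (Fin (Module.finrank L S') → V) + 1) → L) →ₗ[L]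
        (Fin (Module.finrank L S') → V) :=
      { toFun := fun g k => ∑ i, g i • φ i ⟨(b k : V), (b k).2⟩
        map_add' := fun g g' => by
          ext k; simp [add_smul, Finset.sum_add_distrib]
        map_smul' := fun l g => by
          ext k; simp [mul_smul, Finset.smul_sum] }
    have hker : LinearMap.ker M ≠ ⊥ := LinearMap.ker_ne_bot_of_finrank_lt (by simp)
    obtain ⟨g, hg, hg0⟩ := Submodule.exists_mem_ne_zero_of_ne_bot hker
    refine (Submodule.ne_bot_iff _).mpr ⟨g, fun y => ?_, hg0⟩
    let ψ : S' →ₗ[L] V :=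
      { toFun := fun y => ∑ i, g i • φ i ⟨y, y.2⟩
        map_add' := fun y y' => by
          rw [← Finset.sum_add_distrib]
          refine Finset.sum_congr rfl fun i _ => ?_
          rw [← smul_add, ← map_add]; rfl
        map_smul' := fun l y => by
          simp only [RingHom.id_apply]
          rw [Finset.smul_sum]
          refine Finset.sum_congr rfl fun i _ => ?_
          rw [smul_comm l, ← map_smul_of_operatorRing D (φ i) l y.2]
          rfl }
    have hψ : ψ = 0 := b.ext fun k => congr_fun hg k
    exact LinearMap.congr_fun hψ ⟨y, y.2⟩
  obtain ⟨c, hc0, hc⟩ := exists_const_mem_of_deriv_stable δ hδ W hWst hW0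
  apply hc0
  have h0 := hc x
  simp only [algebraMap_smul, hφ] at h0
  exact funext (Fintype.linearIndependent_iff.mp hli c h0)

theorem exists_finiteDimensional_meeting_stable
    (hδ : ∀ x, δ x = 0 → ∃ c, algebraMap K L c = x)
    (hD : ∀ (g : L) (v : V), D (g • v) = δ g • v + g • D v) :
    ∃ U : Submodule K V, FiniteDimensional K U ∧ ∀ N : Submodule L V, N ≠ ⊥ →
      (∀ v ∈ N, D v ∈ N) → ∃ u ∈ U, u ≠ 0 ∧ u ∈ N := by
  classical
  have : IsNoetherian (operatorRing L D) V := by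
    rw [isNoetherian_iff']
    exact (operatorSubspace_strictMono D).wellFoundedGT
  have : IsArtinian (operatorRing L D) V :=
    (operatorSubspace_strictMono D).wellFoundedLT
  have hne : ∀ c : isotypicComponents (operatorRing L D) V,
      ∃ S : Submodule (operatorRing L D) V, IsSimpleModule (operatorRing L D) S ∧
        c.1 = isotypicComponent (operatorRing L D) V S := fun c => c.2
  choose S hS hcS using hne
  have hx : ∀ c, ∃ x : S c, x ≠ 0 := fun c =>
    have := IsSimpleModule.nontrivial (operatorRing L D) (S c)
    exists_ne 0
  choose x hx using hx
  have := Fintype.ofFinite (isotypicComponents (operatorRing L D) V)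
  have hfd := fun c => finiteDimensional_span_hom δ D hδ hD (S c) (x c)
  refine ⟨⨆ c, Submodule.span K {v | ∃ φ : S c →ₗ[operatorRing L D] V, φ (x c) = v},
    inferInstance, fun N hN hst => ?_⟩
  have hN' : stableSubmodule D N hst ≠ ⊥ := by
    obtain ⟨v, hv, hv0⟩ := Submodule.exists_mem_ne_zero_of_ne_bot hN
    exact (Submodule.ne_bot_iff _).mpr ⟨v, hv, hv0⟩
  obtain ⟨A, hA, hAN⟩ := (eq_bot_or_exists_atom_le (stableSubmodule D N hst)).resolve_left hN'
  have hAs : IsSimpleModule (operatorRing L D) A := isSimpleModule_iff_isAtom.mpr hA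
  let c : isotypicComponents (operatorRing L D) V := ⟨_, A, hAs, rfl⟩
  have hAc : A ≤ isotypicComponent (operatorRing L D) V (S c) := by
    rw [← hcS c]
    exact A.le_isotypicComponent
  have := hS c
  obtain ⟨e⟩ : Nonempty (A ≃ₗ[operatorRing L D] S c) := by
    exact isIsotypicOfType_submodule_iff.mp
      (IsIsotypicOfType.isotypicComponent (operatorRing L D) V (S c)) A hAc
  refine ⟨e.symm (x c), ?_, ?_, hAN (e.symm (x c)).2⟩
  · refine Submodule.mem_iSup_of_mem c (Submodule.subset_span ?_)
    exact ⟨A.subtype.comp e.symm.toLinearMap, rfl⟩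
  · simpa using hx c

end StableSubspaces

section FractionField

variable (K L : Type*) [Field K] [Field L] [Algebra K[X] L] [Algebra K L]
  [IsScalarTower K K[X] L] [IsFractionRing K[X] L]

/-- The ring homomorphism `p ↦ p + p' ε` into the dual numbers over the fraction field. -/
def dualNumberHom : K[X] →+* TrivSqZeroExt L L where
  toFun p := TrivSqZeroExt.inl (algebraMap K[X] L p) +
    TrivSqZeroExt.inr (algebraMap K[X] L (derivative p))
  map_one' := by simp
  map_zero' := by simp
  map_add' p q := by
    ext <;> simp [-DualNumber.inr_eq_smul_eps]
  map_mul' p q := by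
    ext
    · simp
    · simp [-DualNumber.inr_eq_smul_eps]; ring

theorem exists_derivation_fractionField [CharZero K] :
    ∃ δ : Derivation K L L, (∀ p : K[X], δ (algebraMap K[X] L p) =
      algebraMap K[X] L (derivative p)) ∧ ∀ x, δ x = 0 → ∃ c, algebraMap K L c = x := by
  have hu : ∀ y : nonZeroDivisors K[X], IsUnit (dualNumberHom K L y) := fun y => by
    rw [TrivSqZeroExt.isUnit_iff_isUnit_fst]
    simp only [dualNumberHom, RingHom.coe_mk, MonoidHom.coe_mk, OneHom.coe_mk]
    simp
  let g : L →+* TrivSqZeroExt L L := IsLocalization.lift hu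
  have hg : ∀ p, g (algebraMap K[X] L p) = dualNumberHom K L p := fun p =>
    IsLocalization.lift_eq hu p
  have hfst : ∀ x, (g x).fst = x := by
    have : ((TrivSqZeroExt.fstHom L L L).toRingHom.comp g) = RingHom.id L := by
      refine IsLocalization.ringHom_ext (nonZeroDivisors K[X]) ?_
      ext x <;> simp [hg, dualNumberHom]
    exact fun x => RingHom.congr_fun this x
  have hpoly : ∀ p : K[X], (g (algebraMap K[X] L p)).snd = algebraMap K[X] L (derivative p) :=
    fun p => by simp [hg, dualNumberHom, -DualNumber.inr_eq_smul_eps]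
  have hmul : ∀ x y, (g (x * y)).snd = x * (g y).snd + y * (g x).snd := fun x y => by
    simp [hfst, mul_comm]
  have hK : ∀ c : K, (g (algebraMap K L c)).snd = 0 := fun c => by
    rw [IsScalarTower.algebraMap_apply K K[X] L, hpoly]; simp
  let δ : Derivation K L L := Derivation.mk'
    { toFun := fun x => (g x).snd
      map_add' := fun x y => by simp
      map_smul' := fun c x => by
        simp [Algebra.smul_def, hfst, hK] } (fun x y => hmul x y)
  refine ⟨δ, hpoly, fun x hx => ?_⟩
  obtain ⟨a, b, hab, rfl⟩ := IsFractionRing.exists_reduced_fraction K[X] x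
  have hb0 : (b : K[X]) ≠ 0 := nonZeroDivisors.ne_zero b.2
  have hbL : algebraMap K[X] L b ≠ 0 := by simp
  have hx' : δ (IsLocalization.mk' L a b) = 0 := hx
  have h1 : algebraMap K[X] L b * IsLocalization.mk' L a b = algebraMap K[X] L a :=
    IsLocalization.mk'_spec' L a b
  have h2 := congrArg δ h1
  rw [Derivation.leibniz, hx', smul_zero, zero_add, smul_eq_mul] at h2
  rw [show δ (algebraMap K[X] L b) = _ from hpoly b, show δ (algebraMap K[X] L a) = _ from hpoly a,
    IsFractionRing.mk'_eq_div, div_mul_eq_mul_div, div_eq_iff hbL, ← map_mul, ← map_mul] at h2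
  have h3 : a * derivative (b : K[X]) = derivative a * b := IsFractionRing.injective K[X] L h2
  have h4 : (b : K[X]) ∣ derivative (b : K[X]) :=
    (hab.symm.isCoprime).dvd_of_dvd_mul_left ⟨derivative a, by rw [h3, mul_comm]⟩
  have h5 : derivative (b : K[X]) = 0 := by
    by_contra h
    have h6 : (b : K[X]).natDegree ≠ 0 := fun h0 => h (derivative_of_natDegree_zero h0)
    exact absurd (natDegree_le_of_dvd h4 h) (not_le.mpr (natDegree_derivative_lt h6))
  have h6 : derivative a = 0 := by
    rw [h5, mul_zero] at h3
    exact (mul_eq_zero.mp h3.symm).resolve_right hb0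
  obtain ⟨a0, ha0⟩ := natDegree_eq_zero.mp (derivative_eq_zero.mp h6)
  obtain ⟨b0, hb0'⟩ := natDegree_eq_zero.mp (derivative_eq_zero.mp h5)
  refine ⟨a0 / b0, ?_⟩
  rw [IsFractionRing.mk'_eq_div, ← ha0, ← hb0', map_div₀]
  simp only [← Polynomial.algebraMap_eq, ← IsScalarTower.algebraMap_apply]

end FractionField

/-- The operator `v ↦ T v' + Aᵀ v` on vectors of polynomials. -/
def thetaOp {K ι : Type*} [Field K] [Fintype ι] (T : K[X]) (A : Matrix ι ι K[X])
    (v : ι → K[X]) : ι → K[X] :=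
  fun i => T * derivative (v i) + ∑ j, A j i * v j

section Theta

variable {K ι : Type*} [Field K] [Fintype ι] (T : K[X]) (A : Matrix ι ι K[X])

theorem thetaOp_add (v w : ι → K[X]) :
    thetaOp T A (v + w) = thetaOp T A v + thetaOp T A w := by
  funext i
  simp only [thetaOp, Pi.add_apply, map_add, mul_add, Finset.sum_add_distrib]
  ring

theorem thetaOp_smul (q : K[X]) (v : ι → K[X]) :
    thetaOp T A (q • v) = (T * derivative q) • v + q • thetaOp T A v := by
  funext i
  simp only [thetaOp, Pi.add_apply, Pi.smul_apply, smul_eq_mul, derivative_mul, mul_add,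
    Finset.mul_sum]
  have : ∀ j, A j i * (q * v j) = q * (A j i * v j) := fun j => by ring
  simp only [this]
  ring

theorem thetaOp_zero : thetaOp T A 0 = 0 := by
  funext i
  simp [thetaOp]

theorem exists_finiteDimensional_meeting_thetaOp_stable [CharZero K] (hT : T ≠ 0)
    (L : Type*) [Field L] [Algebra K[X] L] [Algebra K L] [IsScalarTower K K[X] L]
    [IsFractionRing K[X] L] :
    ∃ U : Submodule K (ι → K[X]), FiniteDimensional K U ∧
      ∀ N : Submodule K[X] (ι → K[X]), N ≠ ⊥ →
        (∀ v ∈ N, ∃ q : K[X], q ≠ 0 ∧ q • thetaOp T A v ∈ N) →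
        ∃ u ∈ U, u ≠ 0 ∧ ∃ q : K[X], q ≠ 0 ∧ q • u ∈ N := by
  classical
  have hinj : Function.Injective (algebraMap K[X] L) := IsFractionRing.injective K[X] L
  obtain ⟨d, hd, hdc⟩ := exists_derivation_fractionField K L
  let ι' : (ι → K[X]) →ₗ[K] (ι → L) :=
    LinearMap.compLeft ((IsScalarTower.toAlgHom K K[X] L).toLinearMap) ι
  have hι' : ∀ v i, ι' v i = algebraMap K[X] L (v i) := fun v i => rfl
  have hι'inj : Function.Injective ι' := fun v w h => funext fun i => hinj (congr_fun h i)
  have hι's : ∀ (q : K[X]) v, ι' (q • v) = algebraMap K[X] L q • ι' v := fun q v => by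
    funext i; simp [hι']
  have hTL : algebraMap K[X] L T ≠ 0 := by simpa using hT
  let D : (ι → L) →+ (ι → L) :=
    { toFun := fun v i => algebraMap K[X] L T * d (v i) + ∑ j, algebraMap K[X] L (A j i) * v j
      map_zero' := by funext i; simp
      map_add' := fun v w => by
        funext i
        simp only [Pi.add_apply, map_add, mul_add, Finset.sum_add_distrib]
        ring }
  have hDa : ∀ v i, D v i = algebraMap K[X] L T * d (v i) + ∑ j, algebraMap K[X] L (A j i) * v j :=
    fun _ _ => rfl
  have hDι : ∀ v, D (ι' v) = ι' (thetaOp T A v) := fun v => by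
    funext i
    simp [D, hι', thetaOp, hd]
  have hDs : ∀ (g : L) (v : ι → L), D (g • v) = (algebraMap K[X] L T • d) g • v + g • D v := by
    intro g v
    funext i
    simp only [hDa, Pi.smul_apply, Pi.add_apply, smul_eq_mul,
      Derivation.leibniz, mul_add, Finset.mul_sum, Derivation.smul_apply]
    have : ∀ j, algebraMap K[X] L (A j i) * (g * v j) = g * (algebraMap K[X] L (A j i) * v j) :=
      fun j => by ring
    simp only [this]
    ring
  obtain ⟨U, hU, hUN⟩ := exists_finiteDimensional_meeting_stable (K := K)
    (algebraMap K[X] L T • d) D (fun x hx => hdc x (by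
      have : algebraMap K[X] L T * d x = 0 := hx
      exact (mul_eq_zero.mp this).resolve_left hTL)) hDs
  let b := Module.finBasis K U
  obtain ⟨q, hq⟩ := IsLocalization.exist_integer_multiples_of_finite (nonZeroDivisors K[X])
    (fun x : Fin (Module.finrank K U) × ι => (b x.1 : ι → L) x.2)
  have hq0 : (q : K[X]) ≠ 0 := nonZeroDivisors.ne_zero q.2
  have hqL : algebraMap K[X] L q ≠ 0 := by simp
  choose B hB using hq
  refine ⟨Submodule.span K (Set.range fun k i => B (k, i)),
    FiniteDimensional.span_of_finite K (Set.finite_range _), fun N hN hst => ?_⟩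
  let NL : Submodule L (ι → L) :=
    { carrier := {v | ∃ q : K[X], q ≠ 0 ∧ ∃ n ∈ N, algebraMap K[X] L q • v = ι' n}
      add_mem' := by
        rintro v w ⟨q, hq, n, hn, h⟩ ⟨q', hq', n', hn', h'⟩
        refine ⟨q * q', mul_ne_zero hq hq', q' • n + q • n',
          N.add_mem (N.smul_mem _ hn) (N.smul_mem _ hn'), ?_⟩
        rw [map_add, hι's, hι's, ← h, ← h', smul_add, map_mul, mul_smul, mul_smul,
          smul_comm (algebraMap K[X] L q) (algebraMap K[X] L q') v]
      zero_mem' := ⟨1, one_ne_zero, 0, N.zero_mem, by simp⟩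
      smul_mem' := by
        rintro l v ⟨q, hq, n, hn, h⟩
        obtain ⟨⟨a, c⟩, hac⟩ := IsLocalization.surj (nonZeroDivisors K[X]) l
        refine ⟨c * q, mul_ne_zero (nonZeroDivisors.ne_zero c.2) hq, a • n, N.smul_mem _ hn, ?_⟩
        rw [hι's, ← h, map_mul, smul_smul, smul_smul]
        congr 1
        rw [← hac]
        ring }
  have hNL : NL ≠ ⊥ := by
    obtain ⟨n, hn, hn0⟩ := Submodule.exists_mem_ne_zero_of_ne_bot hN
    refine (Submodule.ne_bot_iff _).mpr ⟨ι' n, ⟨1, one_ne_zero, n, hn, by simp⟩, fun h => hn0 ?_⟩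
    exact hι'inj (by rw [h, map_zero])
  have hNLst : ∀ v ∈ NL, D v ∈ NL := by
    rintro v ⟨q, hq, n, hn, h⟩
    obtain ⟨q2, hq2, hn2⟩ := hst n hn
    refine ⟨q * (q * q2), mul_ne_zero hq (mul_ne_zero hq hq2),
      q • (q2 • thetaOp T A n) - (q2 * (T * derivative q)) • n,
      N.sub_mem (N.smul_mem _ hn2) (N.smul_mem _ hn), ?_⟩
    have h1 := hDι n
    rw [← h, hDs, Derivation.smul_apply, hd] at h1
    rw [map_sub, hι's, hι's, hι's, ← h1, ← h]
    funext i
    simp only [Pi.smul_apply, Pi.sub_apply, Pi.add_apply, smul_eq_mul, map_mul]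
    ring
  obtain ⟨u, huU, hu0, q1, hq1, n, hn, hun⟩ := hUN NL hNL hNLst
  have hcomb : algebraMap K[X] L q • u = ι' (∑ k, b.repr ⟨u, huU⟩ k • fun i => B (k, i)) := by
    have h1 : u = ∑ k, b.repr ⟨u, huU⟩ k • (b k : ι → L) := by
      have := congrArg (Subtype.val) (b.sum_repr ⟨u, huU⟩)
      rw [Submodule.coe_sum] at this
      exact this.symm
    conv_lhs => rw [h1]
    rw [map_sum, Finset.smul_sum]
    refine Finset.sum_congr rfl fun k _ => ?_
    rw [map_smul, smul_comm]
    congr 1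
    funext i
    rw [hι', hB (k, i), Pi.smul_apply, ← algebraMap_smul L (q : K[X])]
  refine ⟨∑ k, b.repr ⟨u, huU⟩ k • fun i => B (k, i),
    Submodule.sum_mem _ fun k _ => Submodule.smul_mem _ _
    (Submodule.subset_span ⟨k, rfl⟩), ?_, q1, hq1, ?_⟩
  · intro h0
    rw [h0, map_zero] at hcomb
    exact hu0 ((smul_eq_zero.mp hcomb).resolve_left hqL)
  · have : ι' (q1 • ∑ k, b.repr ⟨u, huU⟩ k • fun i => B (k, i)) = ι' ((q : K[X]) • n) := by
      rw [hι's, ← hcomb, smul_comm, hun, hι's]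
    rw [hι'inj this]
    exact N.smul_mem _ hn

end Theta

theorem exists_minor_ne_zero {R ι : Type*} [CommRing R] [IsDomain R] [Finite ι] {l : ℕ}
    (S : Fin l → ι → R) (hS : LinearIndependent R S) :
    ∃ e : Fin l → ι, (Matrix.of fun j k => S j (e k)).det ≠ 0 := by
  classical
  have := Fintype.ofFinite ι
  let L := FractionRing R
  have hinj : Function.Injective (algebraMap R L) := IsFractionRing.injective R L
  let M : Matrix (Fin l) ι L := Matrix.of fun j i => algebraMap R L (S j i)
  have hM : LinearIndependent L M.row := by
    have h1 : LinearIndependent R M.row := by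
      have := hS.map_injOn ((Algebra.linearMap R L).compLeft ι)
        (fun v _ w _ h => funext fun i => hinj (congr_fun h i))
      exact this
    exact (LinearIndependent.iff_fractionRing R L).mp h1
  have hrank : M.rank = l := by
    rw [Matrix.rank_eq_finrank_span_row, finrank_span_eq_card hM, Fintype.card_fin]
  obtain ⟨κ, a, ha, hspan, hli⟩ := exists_linearIndependent' L M.col
  have := Fintype.ofInjective a ha
  have hcard : Fintype.card κ = l := by
    rw [← hrank, Matrix.rank_eq_finrank_span_cols, ← hspan, finrank_span_eq_card hli]
  let e : Fin l ≃ κ := (Fintype.equivFinOfCardEq hcard).symm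
  refine ⟨fun k => a (e k), fun h => ?_⟩
  have h2 := hli.comp e e.injective
  have h3 : IsUnit (Matrix.of fun j k => algebraMap R L (S j (a (e k)))) := by
    rw [← Matrix.linearIndependent_cols_iff_isUnit]
    exact h2
  rw [Matrix.isUnit_iff_isUnit_det] at h3
  apply h3.ne_zero
  have h4 := congrArg (algebraMap R L) h
  rw [RingHom.map_det, map_zero] at h4
  exact h4

theorem natDegree_det_le_mul {R : Type*} [CommRing R] {l : ℕ} (M : Matrix (Fin l) (Fin l) R[X])
    (d : ℕ) (h : ∀ i j, (M i j).natDegree ≤ d) : M.det.natDegree ≤ l * d := by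
  rw [Matrix.det_apply]
  refine natDegree_sum_le_of_forall_le _ _ fun σ _ => ?_
  refine (natDegree_smul_le _ _).trans ((natDegree_prod_le _ _).trans ?_)
  refine (Finset.sum_le_card_nsmul _ _ d fun i _ => h _ _).trans ?_
  simp

theorem exists_smul_mem_span_natDegree_le {K ι : Type*} [Field K] [Finite ι] {l : ℕ}
    (S : Fin l → ι → K[X]) (hS : LinearIndependent K[X] S) (d : ℕ)
    (hd : ∀ j i, (S j i).natDegree ≤ d) {u : ι → K[X]} {q : K[X]} (hq : q ≠ 0)
    (hu : q • u ∈ Submodule.span K[X] (Set.range S)) :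
    ∃ Δ : K[X], Δ ≠ 0 ∧ Δ.natDegree ≤ l * d ∧ Δ • u ∈ Submodule.span K[X] (Set.range S) := by
  obtain ⟨e, he⟩ := exists_minor_ne_zero S hS
  set G : Matrix (Fin l) (Fin l) K[X] := Matrix.of fun j k => S j (e k) with hG
  refine ⟨G.det, he, natDegree_det_le_mul G d fun i j => hd _ _, ?_⟩
  obtain ⟨a, ha⟩ := (Submodule.mem_span_range_iff_exists_fun K[X]).mp hu
  have h1 : Matrix.vecMul a G = q • fun k => u (e k) := by
    funext k
    have := congr_fun ha (e k)
    simpa [Matrix.vecMul, dotProduct, hG] using this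
  set c := Matrix.vecMul (fun k => u (e k)) G.adjugate with hc
  have h2 : q • c = G.det • a := by
    have := congrArg (fun x => Matrix.vecMul x G.adjugate) h1
    simp only [Matrix.vecMul_vecMul, Matrix.mul_adjugate, Matrix.smul_vecMul] at this
    rw [hc, ← this, Matrix.vecMul_smul, Matrix.vecMul_one]
  have h3 : G.det • u = ∑ j, c j • S j := by
    have h4 : q • (G.det • u) = q • ∑ j, c j • S j := by
      rw [smul_comm, ← ha, Finset.smul_sum, Finset.smul_sum]
      refine Finset.sum_congr rfl fun j _ => ?_
      have := congr_fun h2 j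
      simp only [Pi.smul_apply, smul_eq_mul] at this
      rw [smul_smul, smul_smul, this]
    exact smul_right_injective _ hq h4
  rw [h3]
  exact Submodule.sum_mem _ fun j _ => Submodule.smul_mem _ _ (Submodule.subset_span ⟨j, rfl⟩)

theorem exists_order_bound {K : Type*} [Field K] (U : Submodule K (PowerSeries K))
    [FiniteDimensional K U] :
    ∃ c : ℕ, ∀ x ∈ U, PowerSeries.X ^ c ∣ x → x = 0 := by
  let F : ℕ →o (Submodule K U)ᵒᵈ :=
    { toFun := fun n => OrderDual.toDual
        { carrier := {x | PowerSeries.X ^ n ∣ (x : PowerSeries K)}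
          add_mem' := fun h h' => dvd_add h h'
          zero_mem' := dvd_zero _
          smul_mem' := fun c x h => by
            simp only [Set.mem_ofPred_eq, Submodule.coe_smul, PowerSeries.smul_eq_C_mul]
            exact h.mul_left _ }
      monotone' := fun a b hab x hx => (pow_dvd_pow _ hab).trans hx }
  obtain ⟨n, hn⟩ := IsArtinian.monotone_stabilizes F
  refine ⟨n, fun x hx hdvd => ?_⟩
  ext k
  have h1 : (⟨x, hx⟩ : U) ∈ OrderDual.ofDual (F (max n (k + 1))) := by
    rw [← hn _ (le_max_left _ _)]
    exact hdvd
  have h2 : PowerSeries.X ^ (max n (k + 1)) ∣ x := h1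
  simpa using PowerSeries.X_pow_dvd_iff.mp h2 k (by simp)

theorem exists_natDegree_bound {K ι : Type*} [Field K] [Finite ι] (U : Submodule K (ι → K[X]))
    [FiniteDimensional K U] : ∃ c : ℕ, ∀ u ∈ U, ∀ i, (u i).natDegree ≤ c := by
  have := Fintype.ofFinite ι
  let b := Module.finBasis K U
  refine ⟨∑ k, ∑ i, ((b k : ι → K[X]) i).natDegree, fun u hu i => ?_⟩
  have h1 : u = ∑ k, b.repr ⟨u, hu⟩ k • (b k : ι → K[X]) := by
    have := congrArg (Subtype.val) (b.sum_repr ⟨u, hu⟩)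
    rw [Submodule.coe_sum] at this
    exact this.symm
  rw [h1, Finset.sum_apply]
  refine natDegree_sum_le_of_forall_le _ _ fun k _ => ?_
  refine (natDegree_smul_le _ _).trans ?_
  refine le_trans ?_ (Finset.single_le_sum (f := fun k => ∑ i, ((b k : ι → K[X]) i).natDegree)
    (fun _ _ => Nat.zero_le _) (Finset.mem_univ k))
  exact Finset.single_le_sum (f := fun i => ((b k : ι → K[X]) i).natDegree)
    (fun _ _ => Nat.zero_le _) (Finset.mem_univ i)

/-- The coefficient vectors of `Tʲ Dʲ R`, when `P` is the coefficient vector of `R`. -/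
def thetaIter {K ι : Type*} [Field K] [Fintype ι] (T : K[X]) (A : Matrix ι ι K[X])
    (P : ι → K[X]) : ℕ → ι → K[X]
  | 0 => P
  | j + 1 => thetaOp T A (thetaIter T A P j) - ((j : K[X]) * derivative T) • thetaIter T A P j

section Iter

variable {K ι : Type*} [Field K] [Fintype ι] (T : K[X]) (A : Matrix ι ι K[X]) (P : ι → K[X])

/-- The span of the first iterates. -/
def thetaSpan (j : ℕ) : Submodule K[X] (ι → K[X]) :=
  Submodule.span K[X] (Set.range fun k : Fin j => thetaIter T A P k)

theorem thetaIter_mem {j k : ℕ} (h : k < j) : thetaIter T A P k ∈ thetaSpan T A P j :=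
  Submodule.subset_span ⟨⟨k, h⟩, rfl⟩

theorem thetaSpan_mono {j k : ℕ} (h : j ≤ k) : thetaSpan T A P j ≤ thetaSpan T A P k :=
  Submodule.span_le.mpr (by
    rintro _ ⟨i, rfl⟩
    exact thetaIter_mem T A P (i.2.trans_le h))

theorem thetaOp_thetaIter (j : ℕ) : thetaOp T A (thetaIter T A P j) =
    thetaIter T A P (j + 1) + ((j : K[X]) * derivative T) • thetaIter T A P j := by
  rw [thetaIter, sub_add_cancel]

theorem thetaOp_mem_thetaSpan {j : ℕ} {v : ι → K[X]} (hv : v ∈ thetaSpan T A P j) :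
    thetaOp T A v ∈ thetaSpan T A P (j + 1) := by
  refine Submodule.span_induction (p := fun v _ => thetaOp T A v ∈ thetaSpan T A P (j + 1))
    ?_ ?_ ?_ ?_ hv
  · rintro _ ⟨k, rfl⟩
    simp only [thetaOp_thetaIter]
    exact Submodule.add_mem _ (thetaIter_mem T A P (by omega))
      (Submodule.smul_mem _ _ (thetaIter_mem T A P (by omega)))
  · rw [thetaOp_zero]
    exact Submodule.zero_mem _
  · intro x y _ _ hx hy
    rw [thetaOp_add]
    exact Submodule.add_mem _ hx hy
  · intro a x hx' hx
    rw [thetaOp_smul]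
    exact Submodule.add_mem _ (Submodule.smul_mem _ _ (thetaSpan_mono T A P (by omega) hx'))
      (Submodule.smul_mem _ _ hx)

theorem natDegree_thetaIter_le {n d : ℕ} (hP : ∀ i, (P i).natDegree ≤ n) (hT : T.natDegree ≤ d)
    (hA : ∀ i j, (A i j).natDegree ≤ d) (j : ℕ) (i : ι) :
    (thetaIter T A P j i).natDegree ≤ n + j * d := by
  induction j generalizing i with
  | zero => simpa [thetaIter] using hP i
  | succ j ih =>
    have hT' : (derivative T).natDegree ≤ d := (natDegree_derivative_le T).trans (by omega)
    have hmul : ∀ p q : K[X], p.natDegree ≤ d → q.natDegree ≤ n + j * d →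
        (p * q).natDegree ≤ n + (j + 1) * d := fun p q hp hq =>
      natDegree_mul_le.trans (by rw [add_mul]; omega)
    simp only [thetaIter, thetaOp, Pi.sub_apply, Pi.smul_apply, smul_eq_mul]
    refine (natDegree_sub_le _ _).trans (max_le ((natDegree_add_le _ _).trans (max_le ?_ ?_)) ?_)
    · exact hmul _ _ hT ((natDegree_derivative_le _).trans ((Nat.sub_le _ _).trans (ih i)))
    · exact natDegree_sum_le_of_forall_le _ _ fun k _ => hmul _ _ (hA _ _) (ih k)
    · refine hmul _ _ (natDegree_mul_le.trans ?_) (ih i)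
      simpa using (hT')

/-- Evaluation of a vector of polynomials at `α`. -/
def evalVec (α : K) (v : ι → K[X]) : ι → K := fun i => (v i).eval α

theorem evalVec_mem_of_mem_thetaSpan (α : K) {j : ℕ} {v : ι → K[X]} (hv : v ∈ thetaSpan T A P j) :
    evalVec α v ∈ Submodule.span K (Set.range fun k : Fin j => evalVec α (thetaIter T A P k)) := by
  obtain ⟨a, rfl⟩ := (Submodule.mem_span_range_iff_exists_fun K[X]).mp hv
  have : evalVec α (∑ k, a k • thetaIter T A P (k : Fin j)) =
      ∑ k, (a k).eval α • evalVec α (thetaIter T A P k) := by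
    funext i
    simp [evalVec, eval_finsetSum]
  rw [this]
  exact Submodule.sum_mem _ fun k _ => Submodule.smul_mem _ _ (Submodule.subset_span ⟨k, rfl⟩)

theorem evalVec_mem_of_pow_smul_mem [CharZero K] (α : K) (hα : T.eval α ≠ 0) (i : ℕ) {j : ℕ}
    {v : ι → K[X]} (hv : (X - C α) ^ i • v ∈ thetaSpan T A P j) :
    evalVec α v ∈
      Submodule.span K (Set.range fun k : Fin (j + i) => evalVec α (thetaIter T A P k)) := by
  induction i generalizing v j with
  | zero =>
    rw [pow_zero, one_smul] at hv
    exact evalVec_mem_of_mem_thetaSpan T A P α hv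
  | succ i ih =>
    have h1 := thetaOp_mem_thetaSpan T A P hv
    rw [thetaOp_smul] at h1
    have h2 : (T * derivative ((X - C α) ^ (i + 1))) • v + (X - C α) ^ (i + 1) • thetaOp T A v =
        (X - C α) ^ i • ((T * ((i + 1 : ℕ) : K[X])) • v + (X - C α) • thetaOp T A v) := by
      rw [derivative_X_sub_C_pow, smul_add, smul_smul, smul_smul, ← pow_succ]
      congr 2
      simp only [Nat.add_sub_cancel, map_natCast]
      ring
    rw [h2] at h1
    have h3 := ih h1
    have h4 : evalVec α ((T * ((i + 1 : ℕ) : K[X])) • v + (X - C α) • thetaOp T A v) =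
        (T.eval α * ((i + 1 : ℕ) : K)) • evalVec α v := by
      funext k
      simp [evalVec]
    rw [h4, show j + 1 + i = j + (i + 1) by omega] at h3
    have hne : (T.eval α * ((i + 1 : ℕ) : K)) ≠ 0 :=
      mul_ne_zero hα (Nat.cast_ne_zero.mpr (Nat.succ_ne_zero i))
    exact (Submodule.smul_mem_iff _ hne).mp h3

theorem X_pow_dvd_derivative {p : ℕ} {f : PowerSeries K} (h : PowerSeries.X ^ (p + 1) ∣ f) :
    PowerSeries.X ^ p ∣ PowerSeries.derivative K f := by
  rw [PowerSeries.X_pow_dvd_iff] at h ⊢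
  intro m hm
  rw [PowerSeries.coeff_derivative, h _ (by omega), zero_mul]

theorem X_pow_dvd_iterate_derivative {p j : ℕ} {f : PowerSeries K}
    (h : PowerSeries.X ^ (p + j) ∣ f) :
    PowerSeries.X ^ p ∣ (PowerSeries.derivative K)^[j] f := by
  induction j generalizing p with
  | zero => exact h
  | succ j ih =>
    rw [Function.iterate_succ_apply']
    exact X_pow_dvd_derivative (ih (by rwa [add_right_comm, add_assoc]))

theorem map_thetaIter (φ : (ι → K[X]) →ₗ[K[X]] PowerSeries K)
    (hφ : ∀ v, φ (thetaOp T A v) = T • PowerSeries.derivative K (φ v)) (j : ℕ) :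
    φ (thetaIter T A P j) = T ^ j • (PowerSeries.derivative K)^[j] (φ P) := by
  induction j with
  | zero => simp [thetaIter]
  | succ j ih =>
    rw [thetaIter, map_sub, hφ, map_smul, ih, Function.iterate_succ_apply']
    simp only [Algebra.smul_def, Derivation.leibniz, map_pow, Derivation.leibniz_pow, map_mul]
    have : PowerSeries.derivative K (algebraMap K[X] (PowerSeries K) T) =
        algebraMap K[X] (PowerSeries K) (derivative T) := PowerSeries.derivative_coe T
    rw [this]
    simp only [map_natCast, nsmul_eq_mul, Algebra.algebraMap_self, RingHom.id_apply]
    cases j with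
    | zero => simp
    | succ j => simp only [Nat.add_sub_cancel]; ring

end Iter

theorem exists_first_dependent {R V : Type*} [CommRing R] [AddCommGroup V] [Module R V]
    (S : ℕ → V) (m : ℕ) (h : ¬ LinearIndependent R fun k : Fin m => S k) :
    ∃ l < m, LinearIndependent R (fun k : Fin l => S k) ∧
      ∃ q : R, q ≠ 0 ∧ q • S l ∈ Submodule.span R (Set.range fun k : Fin l => S k) := by
  induction m with
  | zero => exact absurd linearIndependent_empty_type h
  | succ m ih =>
    by_cases hm : LinearIndependent R fun k : Fin m => S k
    · refine ⟨m, Nat.lt_succ_self m, hm, ?_⟩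
      obtain ⟨g, hg, hg0⟩ := Fintype.not_linearIndependent_iff.mp h
      rw [Fin.sum_univ_castSucc] at hg
      refine ⟨g (Fin.last m), fun h0 => ?_, ?_⟩
      · rw [h0, zero_smul, add_zero] at hg
        have h1 := Fintype.linearIndependent_iff.mp hm (fun k => g k.castSucc) hg
        obtain ⟨i, hi⟩ := hg0
        refine Fin.lastCases (motive := fun i => g i ≠ 0 → False) ?_ ?_ i hi
        · exact fun h => h h0
        · exact fun i h => h (h1 i)
      · have : g (Fin.last m) • S m = - ∑ i : Fin m, g i.castSucc • S i :=
          eq_neg_of_add_eq_zero_right hg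
        rw [this]
        exact Submodule.neg_mem _ (Submodule.sum_mem _ fun k _ => Submodule.smul_mem _ _
          (Submodule.subset_span ⟨k, rfl⟩))
    · obtain ⟨l, hl, h'⟩ := ih hm
      exact ⟨l, hl.trans (Nat.lt_succ_self m), h'⟩

section Spanning

variable {K ι : Type*} [Field K] [Fintype ι]

theorem X_pow_dvd_smul {p : ℕ} {f : PowerSeries K} (q : K[X]) (h : PowerSeries.X ^ p ∣ f) :
    PowerSeries.X ^ p ∣ q • f := by
  rw [Algebra.smul_def]
  exact h.mul_left _

theorem X_pow_dvd_of_smul {p c : ℕ} {Δ : K[X]} {f : PowerSeries K}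
    (hf : ¬ PowerSeries.X ^ c ∣ f) (h : PowerSeries.X ^ (p + c) ∣ Δ • f) : X ^ p ∣ Δ := by
  by_contra hΔ
  have h1 : ¬ PowerSeries.X ^ p ∣ (Δ : PowerSeries K) := by
    rw [PowerSeries.X_pow_dvd_iff]
    rw [Polynomial.X_pow_dvd_iff] at hΔ
    simpa using hΔ
  rw [Algebra.smul_def] at h
  have h2 : (algebraMap K[X] (PowerSeries K) Δ) = (Δ : PowerSeries K) := rfl
  rw [h2] at h
  rw [pow_dvd_iff_le_emultiplicity, ← PowerSeries.order_eq_emultiplicity_X] at h h1 hf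
  simp only [not_le] at h1 hf
  rw [PowerSeries.order_mul] at h
  obtain ⟨a, ha⟩ := ENat.ne_top_iff_exists.mp h1.ne_top
  obtain ⟨b, hb⟩ := ENat.ne_top_iff_exists.mp hf.ne_top
  rw [← ha] at h h1
  rw [← hb] at h hf
  norm_cast at *
  omega

theorem X_pow_dvd_map_of_mem_thetaSpan (T : K[X]) (A : Matrix ι ι K[X]) (P : ι → K[X])
    (φ : (ι → K[X]) →ₗ[K[X]] PowerSeries K)
    (hφ : ∀ v, φ (thetaOp T A v) = T • PowerSeries.derivative K (φ v)) {p l : ℕ}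
    (hP : PowerSeries.X ^ (p + l) ∣ φ P) {v : ι → K[X]} (hv : v ∈ thetaSpan T A P l) :
    PowerSeries.X ^ p ∣ φ v := by
  refine Submodule.span_induction (p := fun v _ => PowerSeries.X ^ p ∣ φ v) ?_ ?_ ?_ ?_ hv
  · rintro _ ⟨k, rfl⟩
    rw [map_thetaIter T A P φ hφ]
    refine X_pow_dvd_smul _ (X_pow_dvd_iterate_derivative (dvd_trans (pow_dvd_pow _ ?_) hP))
    omega
  · simp
  · intro x y _ _ hx hy
    rw [map_add]
    exact dvd_add hx hy
  · intro a x _ hx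
    rw [map_smul]
    exact X_pow_dvd_smul _ hx

theorem exists_smul_single_mem_span {R : Type*} [CommRing R] [IsDomain R] [DecidableEq ι]
    (S : Fin (Fintype.card ι) → ι → R) (hS : LinearIndependent R S) (i : ι) :
    ∃ q : R, q ≠ 0 ∧ q • Pi.single i 1 ∈ Submodule.span R (Set.range S) := by
  obtain ⟨e, he⟩ := exists_minor_ne_zero S hS
  have hinj : Function.Injective e := by
    intro a b hab
    by_contra hne
    exact he (Matrix.det_zero_of_column_eq hne fun k => by simp [hab])
  have hbij : Function.Bijective e :=
    (Fintype.bijective_iff_injective_and_card e).mpr ⟨hinj, by simp⟩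
  obtain ⟨k0, rfl⟩ := hbij.2 i
  set G := Matrix.of fun j k => S j (e k) with hG
  refine ⟨G.det, he, ?_⟩
  have h1 : G.det • (Pi.single (e k0) 1 : ι → R) = ∑ j, G.adjugate k0 j • S j := by
    funext x
    obtain ⟨k, rfl⟩ := hbij.2 x
    have h2 := congr_fun (congr_fun G.adjugate_mul k0) k
    rw [Matrix.mul_apply] at h2
    simp only [Finset.sum_apply, Pi.smul_apply, smul_eq_mul]
    refine Eq.trans ?_ h2.symm
    simp [Matrix.one_apply, Pi.single_apply, hinj.eq_iff, eq_comm]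
  rw [h1]
  exact Submodule.sum_mem _ fun j _ => Submodule.smul_mem _ _ (Submodule.subset_span ⟨j, rfl⟩)

theorem exists_forall_span_evalVec_eq_top [CharZero K] (T : K[X]) (hT : T ≠ 0)
    (A : Matrix ι ι K[X]) (φ : (ι → K[X]) →ₗ[K[X]] PowerSeries K)
    (hφi : Function.Injective φ)
    (hφ : ∀ v, φ (thetaOp T A v) = T • PowerSeries.derivative K (φ v))
    (α : K) (hα : α ≠ 0) (hTα : T.eval α ≠ 0) :
    ∃ c : ℕ, ∀ (n p τ : ℕ) (P : ι → K[X]), P ≠ 0 → (∀ i, (P i).natDegree ≤ n) →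
      PowerSeries.X ^ p ∣ φ P → (Fintype.card ι - 1) * n + c ≤ p →
      Fintype.card ι * n + c ≤ p + τ →
      Submodule.span K (Set.range fun k : Fin (Fintype.card ι + τ) =>
        evalVec α (thetaIter T A P k)) = ⊤ := by
  classical
  obtain ⟨U, hU, hUN⟩ := exists_finiteDimensional_meeting_thetaOp_stable T A hT (FractionRing K[X])
  obtain ⟨c1, hc1⟩ := exists_natDegree_bound U
  obtain ⟨c2, hc2⟩ := exists_order_bound (U.map (φ.restrictScalars K))
  have hw : ∀ i : ι, ∃ c, ¬ PowerSeries.X ^ c ∣ φ (Pi.single i 1) := fun i => by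
    have h1 : φ (Pi.single i 1) ≠ 0 := fun h => by
      have := hφi (h.trans (map_zero φ).symm)
      simpa using congr_fun this i
    by_contra! h
    apply h1
    ext k
    simpa using PowerSeries.X_pow_dvd_iff.mp (h (k + 1)) k (Nat.lt_succ_self k)
  choose c3 hc3 using hw
  set m := Fintype.card ι with hm
  obtain ⟨d, hTd, hAd⟩ : ∃ d, T.natDegree ≤ d ∧ ∀ i j, (A i j).natDegree ≤ d := by
    refine ⟨T.natDegree + ∑ i, ∑ j, (A i j).natDegree, by omega, fun i j => ?_⟩
    have h1 : ∑ j, (A i j).natDegree ≤ ∑ i, ∑ j, (A i j).natDegree :=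
      Finset.single_le_sum (f := fun i => ∑ j, (A i j).natDegree)
        (fun _ _ => Nat.zero_le _) (Finset.mem_univ i)
    have h2 : (A i j).natDegree ≤ ∑ j, (A i j).natDegree :=
      Finset.single_le_sum (f := fun j => (A i j).natDegree)
        (fun _ _ => Nat.zero_le _) (Finset.mem_univ j)
    omega
  refine ⟨m * (m * d) + m + c2 + 1 + ∑ i, c3 i, fun n p τ P hP0 hPn hPp hp hpτ => ?_⟩
  have hdeg : ∀ k < m, ∀ i, (thetaIter T A P k i).natDegree ≤ n + m * d := fun k hk i =>
    (natDegree_thetaIter_le T A P hPn hTd hAd k i).trans (by gcongr)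
  have hli : LinearIndependent K[X] fun k : Fin m => thetaIter T A P k := by
    by_contra hdep
    obtain ⟨l, hl, hlil, q, hq0, hq⟩ := exists_first_dependent _ m hdep
    have hl0 : l ≠ 0 := by
      rintro rfl
      rw [Set.range_eq_empty, Submodule.span_empty, Submodule.mem_bot] at hq
      exact (smul_ne_zero hq0 hP0) hq
    obtain ⟨u, huU, hu0, q1, hq1, hqu⟩ := hUN (thetaSpan T A P l)
      ((Submodule.ne_bot_iff _).mpr ⟨P, thetaIter_mem T A P (Nat.pos_of_ne_zero hl0), hP0⟩)
      (fun v hv => ⟨q, hq0, by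
        have h1 := thetaOp_mem_thetaSpan T A P hv
        obtain ⟨a, ha⟩ := (Submodule.mem_span_range_iff_exists_fun K[X]).mp h1
        rw [Fin.sum_univ_castSucc] at ha
        rw [← ha, smul_add, Finset.smul_sum]
        refine Submodule.add_mem _ (Submodule.sum_mem _ fun k _ => ?_) ?_
        · exact Submodule.smul_mem _ _ (Submodule.smul_mem _ _ (Submodule.subset_span ⟨k, rfl⟩))
        · rw [smul_comm]
          exact Submodule.smul_mem _ _ hq⟩)
    obtain ⟨Δ, hΔ0, hΔd, hΔu⟩ := exists_smul_mem_span_natDegree_le _ hlil (n + m * d)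
      (fun k i => hdeg k (k.2.trans hl) i) hq1 hqu
    have hl1 : l * n ≤ (m - 1) * n := Nat.mul_le_mul_right _ (by omega)
    have hl2 : l * (m * d) ≤ m * (m * d) := Nat.mul_le_mul_right _ hl.le
    rw [mul_add] at hΔd
    have h1 : PowerSeries.X ^ ((p - l - c2) + c2) ∣ φ (Δ • u) :=
      X_pow_dvd_map_of_mem_thetaSpan T A P φ hφ (dvd_trans (pow_dvd_pow _ (by omega)) hPp) hΔu
    rw [map_smul] at h1
    have h2 : X ^ (p - l - c2) ∣ Δ := X_pow_dvd_of_smul (fun h => hu0 (hφi (by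
      rw [map_zero]
      exact hc2 _ (Submodule.mem_map.mpr ⟨u, huU, rfl⟩) h))) h1
    have h3 := natDegree_le_of_dvd h2 hΔ0
    rw [natDegree_X_pow] at h3
    omega
  rw [eq_top_iff, ← (Pi.basisFun K ι).span_eq, Submodule.span_le]
  rintro _ ⟨i, rfl⟩
  have hfull : ∃ q : K[X], q ≠ 0 ∧ q • Pi.single i 1 ∈
      Submodule.span K[X] (Set.range fun k : Fin m => thetaIter T A P k) := by
    exact exists_smul_single_mem_span _ hli i
  obtain ⟨q, hq0, hq⟩ := hfull
  obtain ⟨Δ, hΔ0, hΔd, hΔu⟩ := exists_smul_mem_span_natDegree_le _ hli (n + m * d)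
      (fun k i => hdeg k k.2 i) hq0 hq
  have hc3i := Finset.single_le_sum (f := c3) (fun _ _ => Nat.zero_le _) (Finset.mem_univ i)
  have h1 : PowerSeries.X ^ ((p - m - c3 i) + c3 i) ∣ φ (Δ • Pi.single i 1) :=
    X_pow_dvd_map_of_mem_thetaSpan T A P φ hφ (dvd_trans (pow_dvd_pow _ (by omega)) hPp) hΔu
  rw [map_smul] at h1
  obtain ⟨Δ', hΔ'⟩ := X_pow_dvd_of_smul (hc3 i) h1
  have hΔ'0 : Δ' ≠ 0 := by
    rintro rfl
    exact hΔ0 (by rw [hΔ', mul_zero])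
  obtain ⟨h, hh, hhα⟩ := exists_eq_pow_rootMultiplicity_mul_and_not_dvd Δ hΔ0 α
  have hτ : rootMultiplicity α Δ ≤ τ := by
    have h2 : rootMultiplicity α Δ = rootMultiplicity α Δ' := by
      rw [hΔ', rootMultiplicity_mul (hΔ' ▸ hΔ0), rootMultiplicity_eq_zero, zero_add]
      simpa using fun h => absurd h hα
    have h3 : rootMultiplicity α Δ' ≤ Δ'.natDegree := by
      rw [← count_roots]
      exact (Multiset.count_le_card _ _).trans (card_roots' _)
    have h4 : Δ.natDegree = (p - m - c3 i) + Δ'.natDegree := by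
      rw [hΔ', natDegree_mul (pow_ne_zero _ X_ne_zero) hΔ'0, natDegree_X_pow]
    rw [mul_add] at hΔd
    omega
  have h5 := evalVec_mem_of_pow_smul_mem T A P α hTα (rootMultiplicity α Δ) (j := m)
    (v := h • Pi.single i 1) (by rw [smul_smul, ← hh]; exact hΔu)
  have h6 : evalVec α (h • Pi.single i (1 : K[X])) = h.eval α • (Pi.basisFun K ι) i := by
    funext k
    by_cases hk : k = i
    · subst hk; simp [evalVec]
    · simp [evalVec, hk]
  rw [h6, Submodule.smul_mem_iff _ (fun h0 => hhα (dvd_iff_isRoot.mpr h0))] at h5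
  refine Submodule.span_mono ?_ h5
  rintro _ ⟨k, rfl⟩
  exact ⟨⟨k, k.2.trans_le (by omega)⟩, rfl⟩

end Spanning

section EType

variable {K : Type*} [Field K]

/-- The `n`-th coefficient of `F` seen as an exponential generating series. -/
def expCoeff (n : ℕ) (F : PowerSeries K) : K := n.factorial * PowerSeries.coeff n F

theorem expCoeff_add (n : ℕ) (F G : PowerSeries K) :
    expCoeff n (F + G) = expCoeff n F + expCoeff n G := by
  simp [expCoeff, mul_add]

theorem expCoeff_mul (n : ℕ) (F G : PowerSeries K) :
    expCoeff n (F * G) =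
      ∑ kl ∈ Finset.HasAntidiagonal.antidiagonal n,
        (n.choose kl.1 : K) * (expCoeff kl.1 F * expCoeff kl.2 G) := by
  rw [expCoeff, PowerSeries.coeff_mul, Finset.mul_sum]
  refine Finset.sum_congr rfl fun kl hkl => ?_
  have h := Finset.HasAntidiagonal.mem_antidiagonal.mp hkl
  have h1 : kl.2 = n - kl.1 := by omega
  have h2 := Nat.choose_mul_factorial_mul_factorial (n := n) (k := kl.1) (by omega)
  rw [← h1] at h2
  rw [← h2, expCoeff, expCoeff]
  push_cast
  ring

theorem expCoeff_derivative (n : ℕ) (F : PowerSeries K) :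
    expCoeff n (PowerSeries.derivative K F) = expCoeff (n + 1) F := by
  rw [expCoeff, expCoeff, PowerSeries.coeff_derivative, Nat.factorial_succ]
  push_cast
  ring

theorem expCoeff_C (n : ℕ) (x : K) :
    expCoeff n (PowerSeries.C x) = if n = 0 then x else 0 := by
  rw [expCoeff, PowerSeries.coeff_C]
  split_ifs with h
  · simp [h]
  · simp

theorem expCoeff_X (n : ℕ) :
    expCoeff n (PowerSeries.X : PowerSeries K) = if n = 1 then 1 else 0 := by
  rw [expCoeff, PowerSeries.coeff_X]
  split_ifs with h
  · simp [h]
  · simp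

variable [NumberField K]

/-- The growth and denominator conditions, with explicit data, on a power series. -/
def ETypeWith (C : ℝ) (d : ℕ → ℕ) (F : PowerSeries K) : Prop :=
  (∀ n, house (expCoeff n F) ≤ C ^ (n + 1)) ∧
    ∀ n, ∀ k ≤ n, IsIntegral ℤ ((d n : K) * expCoeff k F)

/-- Growth condition for a sequence of denominators. -/
def DenomBound (C : ℝ) (d : ℕ → ℕ) : Prop := ∀ n, 0 < d n ∧ (d n : ℝ) ≤ C ^ (n + 1)

/-- Power series satisfying the growth and denominator conditions of E-functions. -/
def EType (F : PowerSeries K) : Prop :=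
  ∃ C : ℝ, 1 ≤ C ∧ ∃ d, DenomBound C d ∧ ETypeWith C d F

theorem house_natCast_mul (c : ℕ) (x : K) : house ((c : K) * x) = c * house x :=
  house_nat_mul x c

theorem ETypeWith.mono {C C' : ℝ} {d d' : ℕ → ℕ} {F : PowerSeries K} (h : ETypeWith C d F)
    (hC : 1 ≤ C) (hCC : C ≤ C') (hd : ∀ n, d n ∣ d' n) : ETypeWith C' d' F := by
  refine ⟨fun n => (h.1 n).trans (by gcongr), fun n k hk => ?_⟩
  obtain ⟨e, he⟩ := hd n
  rw [he, Nat.cast_mul, mul_comm (d n : K), mul_assoc]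
  exact (isIntegral_natCast _).mul (h.2 n k hk)

theorem exists_uniform_ETypeWith {ι : Type*} (s : Finset ι) (F : ι → PowerSeries K)
    (h : ∀ i ∈ s, EType (F i)) :
    ∃ C : ℝ, 1 ≤ C ∧ ∃ d, DenomBound C d ∧ ∀ i ∈ s, ETypeWith C d (F i) := by
  classical
  induction s using Finset.induction_on with
  | empty => exact ⟨1, le_rfl, fun _ => 1, fun n => by simp, by simp⟩
  | insert i s hi ih =>
    obtain ⟨C, hC, d, hd, hF⟩ := ih fun j hj => h j (Finset.mem_insert_of_mem hj)
    obtain ⟨C', hC', d', hd', hF'⟩ := h i (Finset.mem_insert_self _ _)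
    refine ⟨C * C', one_le_mul_of_one_le_of_one_le hC hC', fun n => d n * d' n,
      fun n => ⟨Nat.mul_pos (hd n).1 (hd' n).1, ?_⟩, fun j hj => ?_⟩
    · push_cast
      rw [mul_pow]
      exact mul_le_mul (hd n).2 (hd' n).2 (Nat.cast_nonneg _) (by positivity)
    · rcases Finset.mem_insert.mp hj with rfl | hj
      · exact hF'.mono hC' (le_mul_of_one_le_left (by linarith) hC) fun n => Dvd.intro_left _ rfl
      · exact (hF j hj).mono hC (le_mul_of_one_le_right (by linarith) hC')
          fun n => Dvd.intro _ rfl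

theorem exists_natCast_mul_isIntegral (x : K) : ∃ d : ℕ, 0 < d ∧ IsIntegral ℤ ((d : K) * x) := by
  have h0 : IsAlgebraic ℤ x :=
    (IsFractionRing.isAlgebraic_iff ℤ ℚ K).mpr (Algebra.IsAlgebraic.isAlgebraic x)
  obtain ⟨y, hy, h⟩ := h0.exists_integral_multiple
  refine ⟨y.natAbs, Int.natAbs_pos.mpr hy, ?_⟩
  rw [zsmul_eq_mul] at h
  rcases Int.natAbs_eq y with h1 | h1
  · rw [h1] at h
    simpa using h
  · rw [h1] at h
    simpa using h.neg

theorem EType.add {F G : PowerSeries K} (hF : EType F) (hG : EType G) : EType (F + G) := by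
  obtain ⟨C, hC, d, hd, h⟩ := exists_uniform_ETypeWith Finset.univ ![F, G] (fun i _ => by
    fin_cases i <;> assumption)
  have h0 : ETypeWith C d F := h 0 (Finset.mem_univ _)
  have h1 : ETypeWith C d G := h 1 (Finset.mem_univ _)
  refine ⟨2 * C, by linarith, d, fun n => ⟨(hd n).1, (hd n).2.trans (by gcongr; linarith)⟩,
    fun n => ?_, fun n k hk => ?_⟩
  · rw [expCoeff_add]
    refine (house_add_le _ _).trans ?_
    have h2 : (2 : ℝ) ≤ 2 ^ (n + 1) := le_self_pow₀ (by norm_num) (by omega)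
    have h3 : 0 ≤ C ^ (n + 1) := by positivity
    rw [mul_pow]
    nlinarith [h0.1 n, h1.1 n]
  · rw [expCoeff_add, mul_add]
    exact (h0.2 n k hk).add (h1.2 n k hk)

theorem EType.mul {F G : PowerSeries K} (hF : EType F) (hG : EType G) : EType (F * G) := by
  obtain ⟨C, hC, d, hd, h⟩ := exists_uniform_ETypeWith Finset.univ ![F, G] (fun i _ => by
    fin_cases i <;> assumption)
  have h0 : ETypeWith C d F := h 0 (Finset.mem_univ _)
  have h1 : ETypeWith C d G := h 1 (Finset.mem_univ _)
  have hC2 : 1 ≤ C ^ 2 := one_le_pow₀ hC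
  have hC22 : C ^ 2 ≤ 2 * C ^ 2 := by linarith
  refine ⟨2 * C ^ 2, by linarith, fun n => d n * d n, fun n =>
    ⟨Nat.mul_pos (hd n).1 (hd n).1, ?_⟩, fun n => ?_, fun n k hk => ?_⟩
  · push_cast
    refine (mul_le_mul (hd n).2 (hd n).2 (Nat.cast_nonneg _) (by positivity)).trans ?_
    rw [← mul_pow, ← sq]
    gcongr
  · rw [expCoeff_mul]
    refine (house_sum_le_sum_house _ _).trans ?_
    have h2 : ∀ kl ∈ Finset.HasAntidiagonal.antidiagonal n,
        house ((n.choose kl.1 : K) * (expCoeff kl.1 F * expCoeff kl.2 G)) ≤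
          n.choose kl.1 * C ^ (n + 2) := fun kl hkl => by
      rw [house_natCast_mul]
      refine mul_le_mul_of_nonneg_left ((house_mul_le _ _).trans ?_) (Nat.cast_nonneg _)
      refine (mul_le_mul (h0.1 _) (h1.1 _) (house_nonneg _) (by positivity)).trans ?_
      rw [← pow_add, ← Finset.HasAntidiagonal.mem_antidiagonal.mp hkl]
      apply le_of_eq
      congr 1
      ring
    refine (Finset.sum_le_sum h2).trans ?_
    rw [← Finset.sum_mul]
    have h3 : ∑ kl ∈ Finset.HasAntidiagonal.antidiagonal n, (n.choose kl.1 : ℝ) = 2 ^ n := by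
      rw [Finset.Nat.sum_antidiagonal_eq_sum_range_succ (fun i _ => (n.choose i : ℝ))]
      exact_mod_cast Nat.sum_range_choose n
    rw [h3, mul_pow, ← pow_mul]
    gcongr
    · norm_num
    · omega
    · omega
  · rw [expCoeff_mul, Finset.mul_sum]
    refine IsIntegral.sum _ fun kl hkl => ?_
    have h2 := Finset.HasAntidiagonal.mem_antidiagonal.mp hkl
    have h3 : ((d n * d n : ℕ) : K) * ((k.choose kl.1 : K) * (expCoeff kl.1 F * expCoeff kl.2 G)) =
      (k.choose kl.1 : K) * ((d n * expCoeff kl.1 F) * (d n * expCoeff kl.2 G)) := by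
      push_cast; ring
    rw [h3]
    exact (isIntegral_natCast _).mul ((h0.2 n _ (by omega)).mul (h1.2 n _ (by omega)))

theorem EType.derivative {F : PowerSeries K} (hF : EType F) :
    EType (PowerSeries.derivative K F) := by
  obtain ⟨C, hC, d, hd, h0, h1⟩ := hF
  have h2 : ∀ n, C ^ (n + 1 + 1) ≤ (C ^ 2) ^ (n + 1) := fun n => by
    rw [← pow_mul]
    exact pow_le_pow_right₀ hC (by omega)
  refine ⟨C ^ 2, one_le_pow₀ hC, fun n => d (n + 1), fun n =>
    ⟨(hd _).1, (hd _).2.trans (h2 n)⟩, fun n => ?_, fun n k hk => ?_⟩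
  · rw [expCoeff_derivative]
    exact (h0 _).trans (h2 n)
  · rw [expCoeff_derivative]
    exact h1 _ _ (by omega)

theorem eType_C (x : K) : EType (PowerSeries.C x) := by
  obtain ⟨d, hd, hdx⟩ := exists_natCast_mul_isIntegral x
  have hd1 : (1 : ℝ) ≤ d := by exact_mod_cast hd
  have hx := house_nonneg x
  have h1 : (1 : ℝ) ≤ d + house x := by linarith
  refine ⟨d + house x, h1, fun _ => d, fun n => ⟨hd, ?_⟩, fun n => ?_, fun n k hk => ?_⟩
  · exact (le_add_of_nonneg_right hx).trans (le_self_pow₀ h1 (by omega))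
  · rw [expCoeff_C]
    split_ifs
    · exact (le_add_of_nonneg_left (by linarith)).trans (le_self_pow₀ h1 (by omega))
    · have : house (0 : K) = 0 := by simpa using house_intCast (K := K) 0
      rw [this]
      positivity
  · rw [expCoeff_C]
    split_ifs
    · exact hdx
    · simpa using isIntegral_zero

theorem eType_X : EType (PowerSeries.X : PowerSeries K) := by
  refine ⟨1, le_rfl, fun _ => 1, fun n => by simp, fun n => ?_, fun n k hk => ?_⟩
  · rw [expCoeff_X]
    split_ifs
    · simpa using (house_intCast (K := K) 1).le
    · simpa using ((house_intCast (K := K) 0).trans_le (by simp))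
  · rw [expCoeff_X]
    split_ifs
    · simpa using isIntegral_one
    · simpa using isIntegral_zero

variable (K) in
/-- The `K`-algebra of power series of E-type. -/
def eTypeSubalgebra : Subalgebra K (PowerSeries K) where
  carrier := {F | EType F}
  mul_mem' := EType.mul
  add_mem' := EType.add
  algebraMap_mem' := eType_C

theorem EType.polynomial (p : K[X]) : EType (p : PowerSeries K) := by
  have h : p ∈ (Algebra.adjoin K {X} : Subalgebra K K[X]) := by
    rw [Polynomial.adjoin_X]; trivial
  have h2 : (Algebra.adjoin K {X}).map (Polynomial.coeToPowerSeries.algHom K) ≤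
      eTypeSubalgebra K := by
    rw [AlgHom.map_adjoin, Algebra.adjoin_le_iff]
    rintro _ ⟨_, rfl, rfl⟩
    have : (Polynomial.coeToPowerSeries.algHom K) (X : K[X]) = PowerSeries.X := by simp
    rw [this]
    exact eType_X
  have h3 := h2 ⟨p, h, rfl⟩
  have h4 : (p : PowerSeries K) ∈ eTypeSubalgebra K := by simpa using h3
  exact h4

theorem EType.smul {F : PowerSeries K} (hF : EType F) (p : K[X]) : EType (p • F) := by
  rw [Algebra.smul_def]
  exact (EType.polynomial p).mul hF

end EType

section Eval

variable {K : Type*} [Field K] [NumberField K] [Algebra K ℂ]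

/-- The value at `z` of a power series with coefficients in `K`. -/
def evalAt (z : ℂ) (F : PowerSeries K) : ℂ := ∑' n, algebraMap K ℂ (PowerSeries.coeff n F) * z ^ n

theorem norm_term_le {F : PowerSeries K} {C : ℝ} {n : ℕ}
    (h : house (expCoeff n F) ≤ C ^ (n + 1)) (z : ℂ) :
    ‖algebraMap K ℂ (PowerSeries.coeff n F) * z ^ n‖ ≤ C * ((C * ‖z‖) ^ n / n.factorial) := by
  have h1 := (norm_embedding_le_house (expCoeff n F) (algebraMap K ℂ)).trans h
  have hn : (0 : ℝ) < n.factorial := by exact_mod_cast n.factorial_pos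
  rw [expCoeff, map_mul, map_natCast, norm_mul, Complex.norm_natCast] at h1
  rw [norm_mul, norm_pow, mul_pow, ← mul_div_assoc, le_div_iff₀ hn]
  have h2 : 0 ≤ ‖z‖ ^ n := by positivity
  calc _ = (n.factorial * ‖algebraMap K ℂ (PowerSeries.coeff n F)‖) * ‖z‖ ^ n := by ring
    _ ≤ C ^ (n + 1) * ‖z‖ ^ n := by gcongr
    _ = _ := by ring

theorem EType.summable_norm {F : PowerSeries K} (hF : EType F) (z : ℂ) :
    Summable fun n => ‖algebraMap K ℂ (PowerSeries.coeff n F) * z ^ n‖ := by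
  obtain ⟨C, hC, d, hd, h, _⟩ := hF
  exact Summable.of_nonneg_of_le (fun n => norm_nonneg _) (fun n => norm_term_le (h n) z)
    ((Real.summable_pow_div_factorial (C * ‖z‖)).mul_left C)

theorem EType.summable {F : PowerSeries K} (hF : EType F) (z : ℂ) :
    Summable fun n => algebraMap K ℂ (PowerSeries.coeff n F) * z ^ n :=
  (hF.summable_norm z).of_norm

theorem evalAt_add {F G : PowerSeries K} (hF : EType F) (hG : EType G) (z : ℂ) :
    evalAt z (F + G) = evalAt z F + evalAt z G := by
  simp only [evalAt, map_add, add_mul]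
  exact (hF.summable z).tsum_add (hG.summable z)

theorem evalAt_mul {F G : PowerSeries K} (hF : EType F) (hG : EType G) (z : ℂ) :
    evalAt z (F * G) = evalAt z F * evalAt z G := by
  simp only [evalAt]
  rw [tsum_mul_tsum_eq_tsum_sum_antidiagonal_of_summable_norm (hF.summable_norm z)
    (hG.summable_norm z)]
  refine tsum_congr fun n => ?_
  rw [PowerSeries.coeff_mul, map_sum, Finset.sum_mul]
  refine Finset.sum_congr rfl fun kl hkl => ?_
  rw [map_mul, ← Finset.HasAntidiagonal.mem_antidiagonal.mp hkl, pow_add]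
  ring

omit [NumberField K] in
theorem evalAt_C (x : K) (z : ℂ) : evalAt z (PowerSeries.C x) = algebraMap K ℂ x := by
  rw [evalAt, tsum_eq_single 0]
  · simp
  · intro n hn
    simp [PowerSeries.coeff_C, hn]

variable (K) in
/-- Evaluation at `z` as an algebra homomorphism on power series of E-type. -/
def evalHom (z : ℂ) : eTypeSubalgebra K →ₐ[K] ℂ where
  toFun F := evalAt z F.1
  map_one' := by simpa using evalAt_C (1 : K) z
  map_mul' F G := evalAt_mul F.2 G.2 z
  map_zero' := by simpa using evalAt_C (0 : K) z
  map_add' F G := evalAt_add F.2 G.2 z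
  commutes' x := evalAt_C x z

theorem evalAt_polynomial (p : K[X]) (z : ℂ) : evalAt z (p : PowerSeries K) = aeval z p := by
  induction p using Polynomial.induction_on' with
  | add p q hp hq =>
    rw [Polynomial.coe_add, evalAt_add (EType.polynomial p) (EType.polynomial q), hp, hq, map_add]
  | monomial n a =>
    rw [evalAt, tsum_eq_single n]
    · simp [aeval_monomial]
    · intro m hm
      simp [PowerSeries.coeff_monomial, hm]

theorem evalAt_smul {F : PowerSeries K} (hF : EType F) (p : K[X]) (z : ℂ) :
    evalAt z (p • F) = aeval z p * evalAt z F := by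
  rw [Algebra.smul_def, show algebraMap K[X] (PowerSeries K) p = (p : PowerSeries K) from rfl,
    evalAt_mul (EType.polynomial p) hF, evalAt_polynomial]

theorem evalAt_sum {ι : Type*} (s : Finset ι) (F : ι → PowerSeries K)
    (hF : ∀ i ∈ s, EType (F i)) (z : ℂ) : evalAt z (∑ i ∈ s, F i) = ∑ i ∈ s, evalAt z (F i) := by
  classical
  induction s using Finset.induction_on with
  | empty => simpa using evalAt_C (0 : K) z
  | insert i s hi ih =>
    have hs : ∀ j ∈ s, EType (F j) := fun j hj => hF j (Finset.mem_insert_of_mem hj)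
    rw [Finset.sum_insert hi, Finset.sum_insert hi,
      evalAt_add (hF i (Finset.mem_insert_self _ _)) ?_, ih hs]
    exact (eTypeSubalgebra K).sum_mem hs

end Eval

section Siegel

variable (K : Type*) [Field K] [NumberField K]

theorem exists_siegel_constant : ∃ c : ℝ, 1 ≤ c ∧ ∀ (β : Type) [Fintype β] (p q : ℕ)
    (a : Matrix (Fin p) β (𝓞 K)) (A : ℝ), 0 < p → p < q → Fintype.card β = q → 1 ≤ A →
    (∀ k l, house (algebraMap (𝓞 K) K (a k l)) ≤ A) →
    ∃ ξ : β → 𝓞 K, ξ ≠ 0 ∧ a.mulVec ξ = 0 ∧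
      ∀ l, house (algebraMap (𝓞 K) K (ξ l)) ≤ c * (c * q * A) ^ ((p : ℝ) / (q - p)) := by
  classical
  have key : ∃ c : ℝ, ∀ (β : Type) [Fintype β] (p q : ℕ)
    (a : Matrix (Fin p) β (𝓞 K)) (A : ℝ), 0 < p → p < q → Fintype.card β = q → a ≠ 0 →
    (∀ k l, house (algebraMap (𝓞 K) K (a k l)) ≤ A) →
    ∃ ξ : β → 𝓞 K, ξ ≠ 0 ∧ a.mulVec ξ = 0 ∧
      ∀ l, house (algebraMap (𝓞 K) K (ξ l)) ≤ c * (c * q * A) ^ ((p : ℝ) / (q - p)) := by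
    refine Exists.intro ?c ?h
    case h =>
      intro β _ p q a A hp hpq hβ ha hA
      exact house.exists_ne_zero_int_vec_house_le K a ha hp hpq hβ hA (Fintype.card_fin p)
  obtain ⟨c, hc⟩ := key
  refine ⟨max 1 |c|, le_max_left _ _, fun β _ p q a A hp hpq hβ hA1 hA => ?_⟩
  have hc1 : (1 : ℝ) ≤ max 1 |c| := le_max_left _ _
  have hpq' : (0 : ℝ) ≤ (p : ℝ) / (q - p) := by
    have : (p : ℝ) < q := by exact_mod_cast hpq
    exact div_nonneg (by positivity) (by linarith)
  have hq1 : (1 : ℝ) ≤ q := by exact_mod_cast (by omega : 1 ≤ q)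
  by_cases ha : a = 0
  · have : Nonempty β := Fintype.card_pos_iff.mp (by omega)
    refine ⟨fun _ => 1, fun h => one_ne_zero (congrFun h (Classical.arbitrary β)), by simp [ha],
      fun l => ?_⟩
    have h1 : house (algebraMap (𝓞 K) K 1) = 1 := by
      simpa using house_intCast (K := K) 1
    rw [h1]
    have h2 : (1 : ℝ) ≤ max 1 |c| * q * A :=
      one_le_mul_of_one_le_of_one_le (one_le_mul_of_one_le_of_one_le hc1 hq1) hA1
    exact one_le_mul_of_one_le_of_one_le hc1 (Real.one_le_rpow h2 hpq')
  · obtain ⟨ξ, h1, h2, h3⟩ := hc β p q a A hp hpq hβ ha hA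
    refine ⟨ξ, h1, h2, fun l => (h3 l).trans ((le_abs_self _).trans ?_)⟩
    rw [abs_mul]
    refine mul_le_mul (le_max_right _ _) ((Real.abs_rpow_le_abs_rpow _ _).trans ?_)
      (abs_nonneg _) (by positivity)
    refine Real.rpow_le_rpow (abs_nonneg _) ?_ hpq'
    rw [abs_mul, abs_mul, abs_of_nonneg (by linarith : (0 : ℝ) ≤ A),
      abs_of_nonneg (by linarith : (0 : ℝ) ≤ q)]
    gcongr
    exact le_max_right _ _

end Siegel

section Auxiliary

variable {K : Type*} [Field K]

/-- The polynomial `∑_{j ≤ n} (n! / j!) b_j X^j`. -/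
def expPoly (n : ℕ) (b : ℕ → K) : K[X] :=
  ∑ j ∈ Finset.range (n + 1), Polynomial.monomial j ((n.descFactorial (n - j) : K) * b j)

theorem coeff_expPoly (n : ℕ) (b : ℕ → K) (j : ℕ) :
    (expPoly n b).coeff j = if j ≤ n then (n.descFactorial (n - j) : K) * b j else 0 := by
  simp [expPoly, Polynomial.finsetSum_coeff, Polynomial.coeff_monomial]

theorem factorial_mul_coeff_expPoly (n : ℕ) (b : ℕ → K) {j : ℕ} (hj : j ≤ n) :
    (j.factorial : K) * (expPoly n b).coeff j = n.factorial * b j := by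
  have h := Nat.factorial_mul_descFactorial (n := n) (k := n - j) (Nat.sub_le _ _)
  rw [Nat.sub_sub_self hj] at h
  rw [coeff_expPoly, if_pos hj, ← h]
  push_cast
  ring

theorem natDegree_expPoly_le (n : ℕ) (b : ℕ → K) : (expPoly n b).natDegree ≤ n := by
  refine Polynomial.natDegree_le_iff_coeff_eq_zero.mpr fun N hN => ?_
  rw [coeff_expPoly, if_neg (by omega)]

theorem expCoeff_expPoly_mul (n : ℕ) (b : ℕ → K) (F : PowerSeries K) (k : ℕ) :
    expCoeff k (expPoly n b • F) =
      n.factorial * ∑ j ∈ Finset.range (n + 1), (k.choose j : K) * expCoeff (k - j) F * b j := by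
  rw [Algebra.smul_def, show algebraMap K[X] (PowerSeries K) (expPoly n b) =
    (expPoly n b : PowerSeries K) from rfl, expCoeff_mul,
    Finset.Nat.sum_antidiagonal_eq_sum_range_succ_mk, Finset.mul_sum]
  have h1 : ∀ j, expCoeff j (expPoly n b : PowerSeries K) =
      if j ≤ n then n.factorial * b j else 0 := by
    intro j
    rw [expCoeff, Polynomial.coeff_coe]
    split_ifs with hj
    · exact factorial_mul_coeff_expPoly n b hj
    · rw [coeff_expPoly, if_neg hj, mul_zero]
  simp only [h1]
  have h2 : ∀ N, n ≤ N → k ≤ N → ∑ j ∈ Finset.range (k + 1),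
      (k.choose j : K) * ((if j ≤ n then n.factorial * b j else 0) * expCoeff (k - j) F) =
      ∑ j ∈ Finset.range (N + 1),
      (k.choose j : K) * ((if j ≤ n then n.factorial * b j else 0) * expCoeff (k - j) F) := by
    intro N hn hk
    refine Finset.sum_subset (fun j => by simp only [Finset.mem_range]; omega) fun j _ hj => ?_
    rw [Finset.mem_range] at hj
    rw [Nat.choose_eq_zero_of_lt (by omega)]
    simp
  rw [h2 (n + k) (by omega) (by omega)]
  symm
  refine (Finset.sum_congr rfl fun j hj => ?_).trans (Finset.sum_subset
    (fun j => by simp only [Finset.mem_range]; omega) fun j _ hj => ?_)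
  · rw [Finset.mem_range] at hj
    rw [if_pos (by omega)]
    ring
  · rw [Finset.mem_range] at hj
    rw [if_neg (by omega)]
    ring

variable [NumberField K]

theorem house_one : house (1 : K) = 1 := by
  simpa using house_intCast (K := K) 1

theorem house_zero : house (0 : K) = 0 := by
  simpa using house_intCast (K := K) 0

theorem house_sum_le {ι : Type*} (s : Finset ι) (x : ι → K) (M : ℝ)
    (h : ∀ i ∈ s, house (x i) ≤ M) : house (∑ i ∈ s, x i) ≤ s.card * M := by
  refine (house_sum_le_sum_house s x).trans ?_
  simpa using Finset.sum_le_card_nsmul s _ M h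

end Auxiliary

section AuxiliaryInequalities

variable {K : Type*} [Field K] [NumberField K]

theorem house_choose_mul_expCoeff_le {C : ℝ} (hC : 1 ≤ C) {F : PowerSeries K}
    (hF : ∀ n, house (expCoeff n F) ≤ C ^ (n + 1)) (k j : ℕ) :
    house ((k.choose j : K) * expCoeff (k - j) F) ≤ (2 * C) ^ (k + 1) := by
  rw [house_natCast_mul, mul_pow]
  have h1 : ((k.choose j : ℕ) : ℝ) ≤ 2 ^ (k + 1) := by
    have := (Nat.choose_le_two_pow k j).trans (Nat.pow_le_pow_right two_pos (Nat.le_succ k))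
    exact_mod_cast this
  refine mul_le_mul h1 ((hF _).trans (pow_le_pow_right₀ hC (by omega))) (house_nonneg _)
    (by positivity)

/-- The quantity bounding the size of the auxiliary polynomials grows geometrically. -/
theorem siegel_bound_le {c C : ℝ} (hc : 1 ≤ c) (hC : 1 ≤ C) {m g s p q : ℕ} (hs : 1 ≤ s)
    (hq : q = m * (g * s + 1)) (hp : p + s = q) :
    c * (c * q * ((2 * C) ^ (p + 1) * C ^ (p + 1))) ^ ((p : ℝ) / (q - p)) ≤
      (c * (c * 2 ^ (m * (g + 1)) * (2 * C * C) ^ (m * (g + 1) + 1)) ^ (m * (g + 1))) ^ s := by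
  have hqE : q ≤ m * (g + 1) * s := by
    rw [hq, mul_assoc]
    refine Nat.mul_le_mul le_rfl ?_
    nlinarith
  have h1 : (q : ℝ) ≤ (2 ^ (m * (g + 1))) ^ s := by
    rw [← pow_mul]
    exact_mod_cast (Nat.lt_two_pow_self).le.trans (Nat.pow_le_pow_right two_pos hqE)
  have h2 : (2 * C) ^ (p + 1) * C ^ (p + 1) ≤ ((2 * C * C) ^ (m * (g + 1) + 1)) ^ s := by
    rw [← mul_pow, ← pow_mul]
    refine pow_le_pow_right₀ (by nlinarith) ?_
    nlinarith
  have h3 : c ≤ c ^ s := le_self_pow₀ hc (by omega)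
  have h4 : c * q * ((2 * C) ^ (p + 1) * C ^ (p + 1)) ≤
      (c * 2 ^ (m * (g + 1)) * (2 * C * C) ^ (m * (g + 1) + 1)) ^ s := by
    rw [mul_pow (c * _) _ s, mul_pow c _ s]
    exact mul_le_mul (mul_le_mul h3 h1 (by positivity) (by positivity)) h2 (by positivity)
      (by positivity)
  have hpe : (p : ℝ) / (q - p) ≤ (m * (g + 1) : ℕ) := by
    have : (q : ℝ) - p = s := by rw [← hp]; push_cast; ring
    rw [this, div_le_iff₀ (by exact_mod_cast hs)]
    exact_mod_cast (by omega : p ≤ m * (g + 1) * s)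
  have h5 : (1 : ℝ) ≤ (c * 2 ^ (m * (g + 1)) * (2 * C * C) ^ (m * (g + 1) + 1)) ^ s := by
    refine one_le_pow₀ (one_le_mul_of_one_le_of_one_le (one_le_mul_of_one_le_of_one_le hc
      (one_le_pow₀ one_le_two)) (one_le_pow₀ (by nlinarith)))
  have h6 : (0 : ℝ) ≤ (p : ℝ) / (q - p) := by
    have : (q : ℝ) - p = s := by rw [← hp]; push_cast; ring
    rw [this]
    positivity
  rw [mul_pow c, ← pow_mul, mul_comm (m * (g + 1)) s, pow_mul]
  refine mul_le_mul h3 ?_ (by positivity) (by positivity)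
  calc _ ≤ ((c * 2 ^ (m * (g + 1)) * (2 * C * C) ^ (m * (g + 1) + 1)) ^ s) ^
          ((p : ℝ) / (q - p)) := Real.rpow_le_rpow (by positivity) h4 h6
    _ ≤ _ := Real.rpow_le_rpow_of_exponent_le h5 hpe
    _ = _ := Real.rpow_natCast _ _

theorem exists_auxiliary {ι : Type} [Fintype ι] [Nonempty ι] (w : ι → PowerSeries K)
    (hw : ∀ i, EType (w i)) (g : ℕ) (hg : 1 ≤ g) : ∃ B : ℝ, 1 ≤ B ∧ ∀ s : ℕ, 1 ≤ s →
    ∃ P : ι → K[X], P ≠ 0 ∧ (∀ i, (P i).natDegree ≤ g * s) ∧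
      (∀ i j, IsIntegral ℤ ((P i).coeff j)) ∧
      (∀ i j, house ((P i).coeff j) * j.factorial ≤ B ^ s * (g * s).factorial) ∧
      PowerSeries.X ^ (Fintype.card ι * (g * s + 1) - s) ∣ Fintype.linearCombination K[X] w P ∧
      ∀ k, house (expCoeff k (Fintype.linearCombination K[X] w P)) ≤
        B ^ s * (g * s).factorial * B ^ (k + 1) := by
  classical
  obtain ⟨C, hC, d, hd, hF⟩ := exists_uniform_ETypeWith Finset.univ w fun i _ => hw i
  obtain ⟨c, hc, hsiegel⟩ := exists_siegel_constant K
  set m := Fintype.card ι with hm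
  have hm1 : 1 ≤ m := Fintype.card_pos
  set G : ℝ := c * (c * 2 ^ (m * (g + 1)) * (2 * C * C) ^ (m * (g + 1) + 1)) ^ (m * (g + 1))
    with hG
  have hG1 : 1 ≤ G := one_le_mul_of_one_le_of_one_le hc (one_le_pow₀
    (one_le_mul_of_one_le_of_one_le (one_le_mul_of_one_le_of_one_le hc (one_le_pow₀ one_le_two))
      (one_le_pow₀ (by nlinarith))))
  have h2E : (1 : ℝ) ≤ 2 ^ (m * (g + 1)) := one_le_pow₀ one_le_two
  have hGE : 1 ≤ G * 2 ^ (m * (g + 1)) := one_le_mul_of_one_le_of_one_le hG1 h2E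
  refine ⟨G * 2 ^ (m * (g + 1)) * (2 * C),
    one_le_mul_of_one_le_of_one_le hGE (by linarith), fun s hs => ?_⟩
  have hGB : G ≤ G * 2 ^ (m * (g + 1)) * (2 * C) := by
    rw [mul_assoc]
    refine le_mul_of_one_le_right (by linarith) (one_le_mul_of_one_le_of_one_le h2E (by linarith))
  have hgs : s ≤ g * s := Nat.le_mul_of_pos_left s hg
  have hmgs : g * s + 1 ≤ m * (g * s + 1) := Nat.le_mul_of_pos_left _ hm1
  set n := g * s with hn
  set q := m * (n + 1) with hq
  set p := q - s with hp
  have hpq : p + s = q := by omega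
  have hInt : ∀ i k j, k < p → IsIntegral ℤ ((k.choose j : K) * (d p * expCoeff (k - j) (w i))) :=
    fun i k j hk => (isIntegral_natCast _).mul ((hF i (Finset.mem_univ _)).2 p (k - j) (by omega))
  let a : Matrix (Fin p) (ι × Fin (n + 1)) (𝓞 K) := fun k l => ⟨_, hInt l.1 k l.2 k.2⟩
  have hcard : Fintype.card (ι × Fin (n + 1)) = q := by simp [hq, hm]
  obtain ⟨ξ, hξ0, hξ, hξb⟩ := hsiegel (ι × Fin (n + 1)) p q a
    ((2 * C) ^ (p + 1) * C ^ (p + 1)) (by omega) (by omega) hcard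
    (one_le_mul_of_one_le_of_one_le (one_le_pow₀ (by linarith)) (one_le_pow₀ hC)) (by
      intro k l
      change house ((k.1.choose l.2.1 : K) * (d p * expCoeff (k - l.2.1) (w l.1))) ≤ _
      rw [mul_left_comm, house_natCast_mul, mul_comm]
      refine mul_le_mul ((house_choose_mul_expCoeff_le hC (hF l.1 (Finset.mem_univ _)).1 _ _).trans
        (pow_le_pow_right₀ (by linarith) (by have := k.2; omega))) (hd p).2
        (Nat.cast_nonneg _) (by positivity))
  replace hξb := fun l => (hξb l).trans
    (siegel_bound_le hc hC (m := m) (g := g) (s := s) hs hq hpq)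
  let b : ι → ℕ → K := fun i j => if h : j < n + 1 then algebraMap (𝓞 K) K (ξ (i, ⟨j, h⟩)) else 0
  have hbint : ∀ i j, IsIntegral ℤ (b i j) := by
    intro i j
    by_cases h : j < n + 1
    · simpa only [b, dif_pos h] using RingOfIntegers.isIntegral_coe _
    · simpa only [b, dif_neg h] using isIntegral_zero
  have hbb : ∀ i j, house (b i j) ≤ G ^ s := by
    intro i j
    by_cases h : j < n + 1
    · simpa only [b, dif_pos h] using hξb _
    · simp only [b, dif_neg h, house_zero]
      positivity
  have hphi : ∀ k, expCoeff k (Fintype.linearCombination K[X] w fun i => expPoly n (b i)) =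
      n.factorial * ∑ i, ∑ j ∈ Finset.range (n + 1),
        (k.choose j : K) * expCoeff (k - j) (w i) * b i j := by
    intro k
    rw [Fintype.linearCombination_apply, expCoeff, map_sum, Finset.mul_sum, Finset.mul_sum]
    exact Finset.sum_congr rfl fun i _ => expCoeff_expPoly_mul n (b i) (w i) k
  refine ⟨fun i => expPoly n (b i), ?_, fun i => natDegree_expPoly_le n _, fun i j => ?_,
    fun i j => ?_, ?_, fun k => ?_⟩
  · intro h0
    apply hξ0
    refine funext fun ⟨i, j⟩ => ?_
    have h1 := factorial_mul_coeff_expPoly n (b i) (j := j) (by have := j.2; omega)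
    have h2 : expPoly n (b i) = 0 := congrFun h0 i
    rw [h2, Polynomial.coeff_zero, mul_zero, eq_comm, mul_eq_zero] at h1
    have h3 := h1.resolve_left (by exact_mod_cast n.factorial_ne_zero)
    simp only [b, dif_pos j.2, RingOfIntegers.coe_eq_zero_iff] at h3
    exact h3
  · rw [coeff_expPoly]
    split_ifs
    · exact (isIntegral_natCast _).mul (hbint i j)
    · exact isIntegral_zero
  · rcases le_or_gt j n with hj | hj
    · rw [mul_comm, ← house_natCast_mul, factorial_mul_coeff_expPoly n _ hj, house_natCast_mul,
        mul_comm]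
      gcongr
      exact (hbb i j).trans (by gcongr)
    · rw [coeff_expPoly, if_neg (by omega), house_zero, zero_mul]
      positivity
  · rw [PowerSeries.X_pow_dvd_iff]
    intro k hk
    have h1 := congrFun hξ ⟨k, hk⟩
    have h2 := congrArg (algebraMap (𝓞 K) K) h1
    rw [Matrix.mulVec, dotProduct, map_sum, Fintype.sum_prod_type] at h2
    have h3 : (d p : K) * ∑ i, ∑ j ∈ Finset.range (n + 1),
        (k.choose j : K) * expCoeff (k - j) (w i) * b i j = 0 := by
      rw [Finset.mul_sum]
      refine (Finset.sum_congr rfl fun i _ => ?_).trans h2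
      rw [Finset.mul_sum, Finset.sum_range]
      refine Finset.sum_congr rfl fun j _ => ?_
      have : b i j = algebraMap (𝓞 K) K (ξ (i, j)) := dif_pos j.2
      rw [this, map_mul]
      change _ = ((k.choose j.1 : K) * (d p * expCoeff (k - j.1) (w i))) * _
      ring
    have h4 := (mul_eq_zero.mp h3).resolve_left (by exact_mod_cast (hd p).1.ne')
    have h5 := hphi k
    rw [h4, mul_zero, expCoeff, mul_eq_zero] at h5
    exact h5.resolve_left (by exact_mod_cast k.factorial_ne_zero)
  · rw [hphi, house_natCast_mul]
    have h1 : house (∑ i, ∑ j ∈ Finset.range (n + 1),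
        (k.choose j : K) * expCoeff (k - j) (w i) * b i j) ≤
        m * ((n + 1 : ℕ) * ((2 * C) ^ (k + 1) * G ^ s)) := by
      rw [hm]
      refine house_sum_le _ _ _ fun i _ => ?_
      refine (house_sum_le _ _ ((2 * C) ^ (k + 1) * G ^ s) fun j _ => ?_).trans ?_
      · refine (house_mul_le _ _).trans (mul_le_mul
          (house_choose_mul_expCoeff_le hC (hF i (Finset.mem_univ _)).1 _ _) (hbb i j)
          (house_nonneg _) (by positivity))
      · rw [Finset.card_range]
    have hq2 : (q : ℝ) ≤ (2 ^ (m * (g + 1))) ^ s := by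
      rw [← pow_mul]
      have hqE : q ≤ m * (g + 1) * s := by
        rw [hq, mul_assoc]
        refine Nat.mul_le_mul le_rfl ?_
        nlinarith
      exact_mod_cast (Nat.lt_two_pow_self).le.trans (Nat.pow_le_pow_right two_pos hqE)
    calc (n.factorial : ℝ) * _
          ≤ n.factorial * (m * ((n + 1 : ℕ) * ((2 * C) ^ (k + 1) * G ^ s))) := by
          gcongr
      _ = n.factorial * (q * G ^ s) * (2 * C) ^ (k + 1) := by rw [hq]; push_cast; ring
      _ ≤ n.factorial * ((2 ^ (m * (g + 1))) ^ s * G ^ s) * (2 * C) ^ (k + 1) := by gcongr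
      _ = (G * 2 ^ (m * (g + 1))) ^ s * n.factorial * (2 * C) ^ (k + 1) := by rw [mul_pow]; ring
      _ ≤ _ := by
          have h2 : G * 2 ^ (m * (g + 1)) ≤ G * 2 ^ (m * (g + 1)) * (2 * C) :=
            le_mul_of_one_le_right (by linarith) (by linarith)
          have h3 : 2 * C ≤ G * 2 ^ (m * (g + 1)) * (2 * C) :=
            le_mul_of_one_le_left (by linarith) hGE
          gcongr

end AuxiliaryInequalities

section Tail

variable {K : Type*} [Field K]

theorem expCoeff_iterate_derivative (j n : ℕ) (F : PowerSeries K) :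
    expCoeff n ((PowerSeries.derivative K)^[j] F) = expCoeff (n + j) F := by
  induction j generalizing n with
  | zero => rfl
  | succ j ih =>
    rw [Function.iterate_succ_apply', expCoeff_derivative, ih, Nat.succ_add_eq_add_succ]

variable [NumberField K]

theorem EType.iterate_derivative {F : PowerSeries K} (hF : EType F) (j : ℕ) :
    EType ((PowerSeries.derivative K)^[j] F) := by
  induction j with
  | zero => exact hF
  | succ j ih => rw [Function.iterate_succ_apply']; exact ih.derivative

variable [Algebra K ℂ]

theorem norm_evalAt_iterate_derivative_le {F : PowerSeries K} {p j : ℕ} {Q B Z : ℝ} {z : ℂ}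
    (hp : PowerSeries.X ^ p ∣ F) (hj : j ≤ p) (hB : 1 ≤ B) (hQ : 0 ≤ Q) (hZ : 1 ≤ Z) (hz : ‖z‖ ≤ Z)
    (hF : ∀ k, house (expCoeff k F) ≤ Q * B ^ (k + 1)) :
    ‖evalAt z ((PowerSeries.derivative K)^[j] F)‖ * (p - j).factorial ≤
      Q * B ^ (p + 1) * Z ^ p * Real.exp (B * Z) := by
  set G := (PowerSeries.derivative K)^[j] F with hG
  set t : ℕ → ℂ := fun n => algebraMap K ℂ (PowerSeries.coeff n G) * z ^ n with ht
  have hnorm : ∀ n, ‖t n‖ * n.factorial ≤ house (expCoeff (n + j) F) * Z ^ n := by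
    intro n
    have h1 := norm_embedding_le_house (expCoeff (n + j) F) (algebraMap K ℂ)
    rw [← expCoeff_iterate_derivative, ← hG, expCoeff, map_mul, map_natCast, norm_mul,
      Complex.norm_natCast] at h1
    rw [← expCoeff_iterate_derivative, ← hG, ht, norm_mul, norm_pow]
    calc _ = (n.factorial * ‖algebraMap K ℂ (PowerSeries.coeff n G)‖) * ‖z‖ ^ n := by ring
      _ ≤ _ := by
        gcongr
        · exact house_nonneg _
        · exact h1
  have hzero : ∀ n < p - j, t n = 0 := by
    intro n hn
    have h1 : expCoeff (n + j) F = 0 := by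
      rw [expCoeff, (PowerSeries.X_pow_dvd_iff.mp hp) _ (by omega), mul_zero]
    have h2 := hnorm n
    rw [h1, house_zero, zero_mul] at h2
    have h3 : (0 : ℝ) < n.factorial := by exact_mod_cast n.factorial_pos
    exact norm_le_zero_iff.mp (nonpos_of_mul_nonpos_left h2 h3)
  set c : ℝ := Q * B ^ (p + 1) * Z ^ p / (p - j).factorial with hc
  have hfac : (0 : ℝ) < (p - j).factorial := by exact_mod_cast (p - j).factorial_pos
  have hbound : ∀ l, ‖t (l + (p - j))‖ ≤ c * ((B * Z) ^ l / l.factorial) := by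
    intro l
    have hl : (0 : ℝ) < l.factorial := by exact_mod_cast l.factorial_pos
    have h1 := (hnorm (l + (p - j))).trans (mul_le_mul_of_nonneg_right (hF _) (by positivity))
    have h2 : ((p - j).factorial : ℝ) * l.factorial ≤ (l + (p - j)).factorial := by
      rw [add_comm l]
      exact_mod_cast Nat.le_of_dvd (Nat.factorial_pos _)
          (Nat.factorial_mul_factorial_dvd_factorial_add _ _)
    rw [show l + (p - j) + j = p + l by omega] at h1
    have h3 : Z ^ (l + (p - j)) ≤ Z ^ (p + l) := pow_le_pow_right₀ hZ (by omega)
    rw [hc, div_mul_div_comm, le_div_iff₀ (by positivity)]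
    calc _ ≤ ‖t (l + (p - j))‖ * (l + (p - j)).factorial := by gcongr
      _ ≤ _ := h1
      _ ≤ Q * B ^ (p + l + 1) * Z ^ (p + l) := by gcongr
      _ = _ := by rw [mul_pow]; ring
  have hsum := (Real.summable_pow_div_factorial (B * Z)).mul_left c
  have h1 : evalAt z G = ∑' l, t (l + (p - j)) := by
    have hs : Summable t := by
      refine (summable_nat_add_iff (p - j)).mp ?_
      exact (Summable.of_nonneg_of_le (fun _ => norm_nonneg _) hbound hsum).of_norm
    change ∑' n, t n = _
    rw [← hs.sum_add_tsum_nat_add (p - j),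
      Finset.sum_eq_zero fun n hn => hzero n (Finset.mem_range.mp hn), zero_add]
  have h2 : ‖evalAt z G‖ ≤ c * Real.exp (B * Z) := by
    rw [h1, Real.exp_eq_exp_ℝ, NormedSpace.exp_eq_tsum_div, ← tsum_mul_left]
    exact tsum_of_norm_bounded hsum.hasSum hbound
  calc _ ≤ c * Real.exp (B * Z) * (p - j).factorial := by gcongr
    _ = _ := by rw [hc]; field_simp

end Tail

section PolyHouse

variable {K : Type*} [Field K] [NumberField K]

/-- The sum of the houses of the coefficients. -/
def polyHouse (p : K[X]) : ℝ := ∑ i ∈ p.support, house (p.coeff i)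

theorem polyHouse_eq_sum {p : K[X]} {s : Finset ℕ} (hs : p.support ⊆ s) :
    polyHouse p = ∑ i ∈ s, house (p.coeff i) :=
  Finset.sum_subset hs fun i _ hi => by rw [Polynomial.notMem_support_iff.mp hi, house_zero]

theorem polyHouse_eq_sum_range {p : K[X]} {n : ℕ} (hn : p.natDegree ≤ n) :
    polyHouse p = ∑ i ∈ Finset.range (n + 1), house (p.coeff i) :=
  polyHouse_eq_sum fun i hi => by
    have := Polynomial.le_natDegree_of_mem_supp i hi
    rw [Finset.mem_range]
    omega

theorem polyHouse_nonneg (p : K[X]) : 0 ≤ polyHouse p :=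
  Finset.sum_nonneg fun _ _ => house_nonneg _

theorem polyHouse_zero : polyHouse (0 : K[X]) = 0 := by simp [polyHouse]

theorem polyHouse_add_le (p q : K[X]) : polyHouse (p + q) ≤ polyHouse p + polyHouse q := by
  classical
  rw [polyHouse_eq_sum Polynomial.support_add, polyHouse_eq_sum Finset.subset_union_left,
    polyHouse_eq_sum (p := q) Finset.subset_union_right, ← Finset.sum_add_distrib]
  exact Finset.sum_le_sum fun i _ => by rw [Polynomial.coeff_add]; exact house_add_le _ _

theorem polyHouse_sum_le {ι : Type*} (s : Finset ι) (p : ι → K[X]) :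
    polyHouse (∑ i ∈ s, p i) ≤ ∑ i ∈ s, polyHouse (p i) := by
  classical
  induction s using Finset.induction_on with
  | empty => simp [polyHouse_zero]
  | insert i s hi ih =>
    rw [Finset.sum_insert hi, Finset.sum_insert hi]
    exact (polyHouse_add_le _ _).trans (by gcongr)

theorem polyHouse_monomial (n : ℕ) (x : K) : polyHouse (Polynomial.monomial n x) = house x := by
  rw [polyHouse_eq_sum (Polynomial.support_monomial_subset n x)]
  simp

theorem polyHouse_mul_le (p q : K[X]) : polyHouse (p * q) ≤ polyHouse p * polyHouse q := by
  rw [Polynomial.mul_eq_sum_sum]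
  refine (polyHouse_sum_le _ _).trans ?_
  rw [polyHouse, polyHouse, Finset.sum_mul_sum]
  refine Finset.sum_le_sum fun i _ => ?_
  rw [Polynomial.sum]
  refine (polyHouse_sum_le _ _).trans (Finset.sum_le_sum fun j _ => ?_)
  rw [polyHouse_monomial]
  exact house_mul_le _ _

theorem polyHouse_natCast_mul (n : ℕ) (p : K[X]) :
    polyHouse ((n : K[X]) * p) ≤ n * polyHouse p := by
  refine (polyHouse_mul_le _ _).trans ?_
  have h : polyHouse (n : K[X]) = n := by
    rw [← Polynomial.C_eq_natCast, ← Polynomial.monomial_zero_left, polyHouse_monomial]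
    simpa [house_one] using house_natCast_mul n (1 : K)
  rw [h]

theorem polyHouse_neg_le (p : K[X]) : polyHouse (-p) ≤ polyHouse p := by
  rw [polyHouse, polyHouse, Polynomial.support_neg]
  refine Finset.sum_le_sum fun i _ => ?_
  have h := house_mul_le (-1) (p.coeff i)
  have h1 : house (-1 : K) = 1 := by simpa using house_intCast (K := K) (-1)
  rwa [h1, one_mul, neg_one_mul, ← Polynomial.coeff_neg] at h

theorem polyHouse_derivative_le {p : K[X]} {n : ℕ} (hn : p.natDegree ≤ n) :
    polyHouse (derivative p) ≤ n * polyHouse p := by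
  have h : derivative p = ∑ i ∈ Finset.range (n + 1),
      Polynomial.monomial (i - 1) (p.coeff i * i) := by
    conv_lhs => rw [p.as_sum_range_C_mul_X_pow' (Nat.lt_succ_of_le hn)]
    simp [Polynomial.derivative_monomial, Polynomial.C_mul_X_pow_eq_monomial]
  rw [h, polyHouse_eq_sum_range hn, Finset.mul_sum]
  refine (polyHouse_sum_le _ _).trans (Finset.sum_le_sum fun i hi => ?_)
  rw [Finset.mem_range] at hi
  rw [polyHouse_monomial, mul_comm (p.coeff i), house_natCast_mul]
  have : (i : ℝ) ≤ n := by exact_mod_cast (by omega : i ≤ n)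
  exact mul_le_mul_of_nonneg_right this (house_nonneg _)

theorem house_eval_le {p : K[X]} {n : ℕ} (hn : p.natDegree ≤ n) {α : K} {Z : ℝ} (hZ : 1 ≤ Z)
    (hα : house α ≤ Z) : house (p.eval α) ≤ polyHouse p * Z ^ n := by
  rw [Polynomial.eval_eq_sum_range' (Nat.lt_succ_of_le hn), polyHouse_eq_sum_range hn,
    Finset.sum_mul]
  refine (house_sum_le_sum_house _ _).trans (Finset.sum_le_sum fun i hi => ?_)
  rw [Finset.mem_range] at hi
  refine (house_mul_le _ _).trans (mul_le_mul_of_nonneg_left ?_ (house_nonneg _))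
  refine (house_pow_le _ _).trans ((pow_le_pow_left₀ (house_nonneg _) hα i).trans
    (pow_le_pow_right₀ hZ (by omega)))

variable (K) in
/-- Polynomials whose coefficients are algebraic integers. -/
def integralPolys : Subring K[X] := (Polynomial.mapRingHom (algebraMap (𝓞 K) K)).range

omit [NumberField K] in
theorem mem_integralPolys {p : K[X]} : p ∈ integralPolys K ↔ ∀ i, IsIntegral ℤ (p.coeff i) := by
  constructor
  · rintro ⟨q, rfl⟩ i
    rw [Polynomial.coe_mapRingHom, Polynomial.coeff_map]
    exact RingOfIntegers.isIntegral_coe _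
  · intro h
    have : (p : K[X]) ∈ Polynomial.lifts (algebraMap (𝓞 K) K) := by
      rw [Polynomial.lifts_iff_coeff_lifts]
      exact fun i => ⟨⟨_, h i⟩, rfl⟩
    exact this

omit [NumberField K] in
theorem derivative_mem_integralPolys {p : K[X]} (hp : p ∈ integralPolys K) :
    derivative p ∈ integralPolys K := by
  obtain ⟨q, rfl⟩ := hp
  exact ⟨derivative q, by simp⟩

omit [NumberField K] in
theorem isIntegral_pow_mul_eval {p : K[X]} (hp : p ∈ integralPolys K) {n : ℕ}
    (hn : p.natDegree ≤ n) {α : K} {d : ℕ} (hd : IsIntegral ℤ ((d : K) * α)) :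
    IsIntegral ℤ ((d : K) ^ n * p.eval α) := by
  rw [Polynomial.eval_eq_sum_range' (Nat.lt_succ_of_le hn), Finset.mul_sum]
  refine IsIntegral.sum _ fun i hi => ?_
  rw [Finset.mem_range] at hi
  have : (d : K) ^ n * (p.coeff i * α ^ i) = d ^ (n - i) * p.coeff i * (d * α) ^ i := by
    rw [mul_pow, show n = (n - i) + i by omega, pow_add, Nat.add_sub_cancel]
    ring
  rw [this]
  exact (((isIntegral_natCast _).pow _).mul (mem_integralPolys.mp hp i)).mul (hd.pow _)

variable {ι : Type*} [Fintype ι] {T : K[X]} {A : Matrix ι ι K[X]} {P : ι → K[X]}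

omit [NumberField K] in
theorem thetaIter_mem_integralPolys (hT : T ∈ integralPolys K)
    (hA : ∀ i j, A i j ∈ integralPolys K) (hP : ∀ i, P i ∈ integralPolys K) (j : ℕ) (i : ι) :
    thetaIter T A P j i ∈ integralPolys K := by
  induction j generalizing i with
  | zero => exact hP i
  | succ j ih =>
    simp only [thetaIter, thetaOp, Pi.sub_apply, Pi.smul_apply, smul_eq_mul]
    refine sub_mem (add_mem (mul_mem hT (derivative_mem_integralPolys (ih i)))
      (sum_mem fun l _ => mul_mem (hA l i) (ih l)))
      (mul_mem (mul_mem (natCast_mem _ _) (derivative_mem_integralPolys hT)) (ih i))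

theorem polyHouse_thetaIter_succ_le (T : K[X]) (A : Matrix ι ι K[X]) {j N : ℕ} {R : ℝ}
    (hR : 0 ≤ R) (hN : ∀ i, (thetaIter T A P j i).natDegree ≤ N)
    (hPR : ∀ i, polyHouse (thetaIter T A P j i) ≤ R) (i : ι) :
    polyHouse (thetaIter T A P (j + 1) i) ≤ polyHouse T * (N * R) +
      (∑ i, ∑ l, polyHouse (A l i)) * R + j * (polyHouse (derivative T) * R) := by
  have h1 : polyHouse (T * derivative (thetaIter T A P j i)) ≤ polyHouse T * (N * R) := by
    refine (polyHouse_mul_le _ _).trans (mul_le_mul_of_nonneg_left ?_ (polyHouse_nonneg _))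
    exact (polyHouse_derivative_le (hN i)).trans
      (mul_le_mul_of_nonneg_left (hPR i) (Nat.cast_nonneg _))
  have h2 : polyHouse (∑ l, A l i * thetaIter T A P j l) ≤
      (∑ i, ∑ l, polyHouse (A l i)) * R := by
    have h : ∑ l, polyHouse (A l i) ≤ ∑ i, ∑ l, polyHouse (A l i) :=
      Finset.single_le_sum (f := fun i => ∑ l, polyHouse (A l i))
        (fun i _ => Finset.sum_nonneg fun l _ => polyHouse_nonneg _) (Finset.mem_univ i)
    refine (polyHouse_sum_le _ _).trans (le_trans ?_ (mul_le_mul_of_nonneg_right h hR))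
    rw [Finset.sum_mul]
    exact Finset.sum_le_sum fun l _ => (polyHouse_mul_le _ _).trans
      (mul_le_mul_of_nonneg_left (hPR l) (polyHouse_nonneg _))
  have h3 : polyHouse (-((j : K[X]) * derivative T * thetaIter T A P j i)) ≤
      j * (polyHouse (derivative T) * R) := by
    refine (polyHouse_neg_le _).trans ?_
    rw [mul_assoc]
    refine (polyHouse_natCast_mul _ _).trans (mul_le_mul_of_nonneg_left ?_ (Nat.cast_nonneg _))
    exact (polyHouse_mul_le _ _).trans (mul_le_mul_of_nonneg_left (hPR i) (polyHouse_nonneg _))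
  have h4 : thetaIter T A P (j + 1) i = T * derivative (thetaIter T A P j i) +
      ∑ l, A l i * thetaIter T A P j l + -((j : K[X]) * derivative T * thetaIter T A P j i) := by
    simp only [thetaIter, thetaOp, Pi.sub_apply, Pi.smul_apply, smul_eq_mul, sub_eq_add_neg]
  rw [h4]
  exact (polyHouse_add_le _ _).trans (add_le_add ((polyHouse_add_le _ _).trans
    (add_le_add h1 h2)) h3)

theorem step_bound_le {t a b R : ℝ} (ht : 0 ≤ t) (ha : 0 ≤ a) (hb : 0 ≤ b) (hR : 0 ≤ R)
    {n d J j : ℕ} (hj : j ≤ J) : t * ((n + j * d : ℕ) * R) + a * R + j * (b * R) ≤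
      R * ((t * (1 + d) + a + b + 1) * (n + J + 1 : ℕ)) := by
  have e1 : ((n + j * d : ℕ) : ℝ) ≤ (1 + d) * (n + J + 1 : ℕ) := by
    have : n + j * d ≤ (1 + d) * (n + J + 1) := by nlinarith
    exact_mod_cast this
  have e2 : (j : ℝ) ≤ (n + J + 1 : ℕ) := by exact_mod_cast (by omega : j ≤ n + J + 1)
  have e3 : (1 : ℝ) ≤ (n + J + 1 : ℕ) := by exact_mod_cast (by omega : 1 ≤ n + J + 1)
  generalize ((n + J + 1 : ℕ) : ℝ) = x at *
  generalize ((n + j * d : ℕ) : ℝ) = y at *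
  have f1 : t * (y * R) ≤ t * (((1 + d) * x) * R) := by gcongr
  have f2 : a * R ≤ a * R * x := le_mul_of_one_le_right (by positivity) e3
  have f3 : j * (b * R) ≤ x * (b * R) := by gcongr
  have f4 : 0 ≤ R * x := by positivity
  linear_combination f1 + f2 + f3 + f4

theorem exists_polyHouse_thetaIter_le (T : K[X]) (A : Matrix ι ι K[X]) (d : ℕ)
    (hT : T.natDegree ≤ d) (hA : ∀ i j, (A i j).natDegree ≤ d) : ∃ c : ℝ, 1 ≤ c ∧
    ∀ (P : ι → K[X]) (n : ℕ) (M : ℝ), 0 ≤ M → (∀ i, (P i).natDegree ≤ n) →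
      (∀ i, polyHouse (P i) ≤ M) → ∀ J j, j ≤ J → ∀ i,
      polyHouse (thetaIter T A P j i) ≤ M * (c * (n + J + 1 : ℕ)) ^ j := by
  have ha : 0 ≤ ∑ i, ∑ l, polyHouse (A l i) :=
    Finset.sum_nonneg fun i _ => Finset.sum_nonneg fun l _ => polyHouse_nonneg _
  have hb := polyHouse_nonneg (derivative T)
  have ht := polyHouse_nonneg T
  have ht' : 0 ≤ polyHouse T * (1 + d) := by positivity
  refine ⟨polyHouse T * (1 + d) + ∑ i, ∑ l, polyHouse (A l i) + polyHouse (derivative T) + 1,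
    by linarith, fun P n M hM hPn hPM J j hj => ?_⟩
  induction j with
  | zero => simpa [thetaIter] using hPM
  | succ j ih =>
    intro i
    have hR : 0 ≤ M * ((polyHouse T * (1 + d) + ∑ i, ∑ l, polyHouse (A l i) +
        polyHouse (derivative T) + 1) * (n + J + 1 : ℕ)) ^ j :=
      mul_nonneg hM (pow_nonneg (mul_nonneg (by linarith) (Nat.cast_nonneg _)) _)
    have h1 := polyHouse_thetaIter_succ_le T A hR (natDegree_thetaIter_le T A P hPn hT hA j)
      (ih (by omega)) i
    refine h1.trans ((step_bound_le ht ha hb hR (J := J) (by omega)).trans (le_of_eq ?_))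
    rw [pow_succ, mul_assoc]

end PolyHouse

section Determinant

theorem norm_det_le_of_col_le {ρ : ℕ} (M : Matrix (Fin ρ) (Fin ρ) ℂ) (k : Fin ρ) {H ε : ℝ}
    (h : ∀ i j, j ≠ k → ‖M i j‖ ≤ H) (hε : ∀ i, ‖M i k‖ ≤ ε) :
    ‖M.det‖ ≤ ρ.factorial * (ε * H ^ (ρ - 1)) := by
  rw [Matrix.det_apply]
  refine (norm_sum_le _ _).trans ?_
  have : ∀ σ : Equiv.Perm (Fin ρ), ‖Equiv.Perm.sign σ • ∏ i, M (σ i) i‖ ≤ ε * H ^ (ρ - 1) := by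
    intro σ
    have h1 : ‖Equiv.Perm.sign σ • ∏ i, M (σ i) i‖ = ∏ i, ‖M (σ i) i‖ := by
      rcases Int.units_eq_one_or (Equiv.Perm.sign σ) with hs | hs <;> simp [hs]
    rw [h1, ← Finset.mul_prod_erase _ _ (Finset.mem_univ k)]
    refine mul_le_mul (hε _) ?_ (Finset.prod_nonneg fun _ _ => norm_nonneg _)
      ((norm_nonneg _).trans (hε k))
    refine (Finset.prod_le_prod (fun _ _ => norm_nonneg _)
      fun i hi => h (σ i) i (Finset.ne_of_mem_erase hi)).trans (le_of_eq ?_)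
    simp
  refine (Finset.sum_le_sum fun σ _ => this σ).trans (le_of_eq ?_)
  simp [Fintype.card_perm]

variable {K : Type*} [Field K] [NumberField K]

theorem house_det_le {ρ : ℕ} (M : Matrix (Fin ρ) (Fin ρ) K) {H : ℝ}
    (h : ∀ i j, house (M i j) ≤ H) : house M.det ≤ ρ.factorial * H ^ ρ := by
  have hprod : ∀ (s : Finset (Fin ρ)) (x : Fin ρ → K), (∀ i, house (x i) ≤ H) →
      house (∏ i ∈ s, x i) ≤ H ^ s.card := by
    classical
    intro s x hx
    induction s using Finset.induction_on with
    | empty => simp [house_one]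
    | insert i s hi ih =>
      rw [Finset.prod_insert hi, Finset.card_insert_of_notMem hi, pow_succ']
      exact (house_mul_le _ _).trans (mul_le_mul (hx i) ih (house_nonneg _)
        ((house_nonneg _).trans (hx i)))
  rw [Matrix.det_apply]
  refine (house_sum_le _ _ (H ^ ρ) fun σ _ => ?_).trans (le_of_eq ?_)
  · have h1 : house (Equiv.Perm.sign σ • ∏ i, M (σ i) i) ≤ house (∏ i, M (σ i) i) := by
      rcases Int.units_eq_one_or (Equiv.Perm.sign σ) with hs | hs
      · simp [hs]
      · have h2 := house_mul_le (-1) (∏ i, M (σ i) i)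
        have h3 : house (-1 : K) = 1 := by simpa using house_intCast (K := K) (-1)
        rw [h3, one_mul, neg_one_mul] at h2
        simpa [hs] using h2
    refine h1.trans ?_
    simpa using hprod Finset.univ (fun i => M (σ i) i) fun i => h _ _
  · simp [Fintype.card_perm]

variable [Algebra K ℂ]

/-- A Liouville-type lower bound for linear forms with linearly independent coefficients. -/
theorem norm_le_of_linear_forms {ρ : ℕ} (M : Matrix (Fin ρ) (Fin ρ) K) (hM : M.det ≠ 0) (D : ℕ)
    (hD : 0 < D) (hInt : ∀ i j, IsIntegral ℤ ((D : K) * M i j)) {H ε : ℝ}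
    (hH : ∀ i j, house (M i j) ≤ H) (θ : Fin ρ → ℂ)
    (hε : ∀ i, ‖∑ k, algebraMap K ℂ (M i k) * θ k‖ ≤ ε) (k : Fin ρ) :
    ‖θ k‖ ≤ (D : ℝ) ^ (ρ * Module.finrank ℚ K) * (ρ.factorial : ℝ) ^ Module.finrank ℚ K *
      (H ^ ρ) ^ (Module.finrank ℚ K - 1) * (ε * H ^ (ρ - 1)) := by
  set h := Module.finrank ℚ K with hh
  have hpos : 0 < h := Module.finrank_pos
  have hH0 : 0 ≤ H := (house_nonneg _).trans (hH k k)
  set x : K := (D : K) ^ ρ * M.det with hx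
  have hx0 : x ≠ 0 := mul_ne_zero (pow_ne_zero _ (by exact_mod_cast hD.ne')) hM
  have hxi : IsIntegral ℤ x := by
    have : x = ((D : K) • M).det := by rw [Matrix.det_smul, Fintype.card_fin]
    rw [this]
    exact IsIntegral.det fun i j => hInt i j
  have hnorm : 1 ≤ ‖Algebra.norm ℚ x‖ := by
    obtain ⟨y, hy⟩ := (IsIntegrallyClosed.isIntegral_iff (R := ℤ) (K := ℚ)).mp
      (Algebra.isIntegral_norm ℚ hxi)
    have hy0 : y ≠ 0 := by
      rintro rfl
      rw [map_zero, eq_comm, Algebra.norm_eq_zero_iff] at hy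
      exact hx0 hy
    rw [← hy]
    have : (1 : ℝ) ≤ |(y : ℝ)| := by exact_mod_cast Int.one_le_abs hy0
    simpa [Int.norm_eq_abs] using this
  have h1 := hnorm.trans (norm_norm_le_norm_mul_house_pow x (algebraMap K ℂ))
  have hhouse : house x ≤ (D : ℝ) ^ ρ * (ρ.factorial * H ^ ρ) := by
    rw [hx, ← Nat.cast_pow, house_natCast_mul, Nat.cast_pow]
    exact mul_le_mul_of_nonneg_left (house_det_le M hH) (by positivity)
  have hcr : ‖algebraMap K ℂ M.det * θ k‖ ≤ ρ.factorial * (ε * H ^ (ρ - 1)) := by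
    have h2 : algebraMap K ℂ M.det * θ k =
        ((M.map (algebraMap K ℂ)).updateCol k ((M.map (algebraMap K ℂ)).mulVec θ)).det := by
      rw [← Matrix.cramer_apply, Matrix.cramer_eq_adjugate_mulVec, Matrix.mulVec_mulVec,
        Matrix.adjugate_mul, Matrix.smul_mulVec, Matrix.one_mulVec, Pi.smul_apply, smul_eq_mul,
        RingHom.map_det, RingHom.mapMatrix_apply]
    rw [h2]
    refine norm_det_le_of_col_le _ k (fun i j hj => ?_) fun i => ?_
    · rw [Matrix.updateCol_ne hj]
      exact (norm_embedding_le_house _ _).trans (hH i j)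
    · rw [Matrix.updateCol_self]
      exact hε i
  have h3 : ‖algebraMap K ℂ x‖ * ‖θ k‖ ≤ (D : ℝ) ^ ρ * (ρ.factorial * (ε * H ^ (ρ - 1))) := by
    rw [← norm_mul, hx, map_mul, map_pow, map_natCast, mul_assoc, norm_mul, norm_pow,
      Complex.norm_natCast]
    exact mul_le_mul_of_nonneg_left hcr (by positivity)
  have hε0 : 0 ≤ ε := (norm_nonneg _).trans (hε k)
  calc ‖θ k‖ ≤ (‖algebraMap K ℂ x‖ * house x ^ (h - 1)) * ‖θ k‖ :=
        le_mul_of_one_le_left (norm_nonneg _) h1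
    _ = (‖algebraMap K ℂ x‖ * ‖θ k‖) * house x ^ (h - 1) := by ring
    _ ≤ ((D : ℝ) ^ ρ * (ρ.factorial * (ε * H ^ (ρ - 1)))) *
        ((D : ℝ) ^ ρ * (ρ.factorial * H ^ ρ)) ^ (h - 1) := by
        have := house_nonneg x
        gcongr
    _ = _ := by
        obtain ⟨h', hh'⟩ : ∃ h', h = h' + 1 := ⟨h - 1, by omega⟩
        rw [hh', Nat.add_sub_cancel]
        simp only [mul_pow, pow_mul, pow_succ]
        ring

end Determinant

section Growth

/-- Sequences growing at most geometrically. -/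
def GeomBdd (u : ℕ → ℝ) : Prop := ∃ B : ℝ, 1 ≤ B ∧ ∀ s : ℕ, 1 ≤ s → u s ≤ B ^ s

theorem GeomBdd.mul {u v : ℕ → ℝ} (hu : GeomBdd u) (hv : GeomBdd v) (h : ∀ s, 0 ≤ v s) :
    GeomBdd fun s => u s * v s := by
  obtain ⟨B, hB, hu⟩ := hu
  obtain ⟨B', hB', hv⟩ := hv
  refine ⟨B * B', one_le_mul_of_one_le_of_one_le hB hB', fun s hs => ?_⟩
  rw [mul_pow]
  exact mul_le_mul (hu s hs) (hv s hs) (h s) (by positivity)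

theorem geomBdd_pow {c : ℝ} (hc : 1 ≤ c) {e : ℕ → ℕ} (E : ℕ) (he : ∀ s, 1 ≤ s → e s ≤ E * s) :
    GeomBdd fun s => c ^ e s :=
  ⟨c ^ E, one_le_pow₀ hc, fun s hs => by
    rw [← pow_mul]
    exact pow_le_pow_right₀ hc (he s hs)⟩

theorem geomBdd_const (c : ℝ) : GeomBdd fun _ => c :=
  ⟨max 1 c, le_max_left _ _, fun s hs => (le_max_right 1 c).trans
    (le_self_pow₀ (le_max_left _ _) (by omega))⟩

theorem geomBdd_natCast {e : ℕ → ℕ} (E : ℕ) (he : ∀ s, 1 ≤ s → e s ≤ E * s) :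
    GeomBdd fun s => (e s : ℝ) :=
  ⟨2 ^ E, one_le_pow₀ one_le_two, fun s hs => by
    rw [← pow_mul]
    change (e s : ℝ) ≤ _
    exact_mod_cast (he s hs).trans Nat.lt_two_pow_self.le⟩

theorem GeomBdd.mono {u v : ℕ → ℝ} (hu : GeomBdd u) (h : ∀ s, 1 ≤ s → v s ≤ u s) : GeomBdd v := by
  obtain ⟨B, hB, hu⟩ := hu
  exact ⟨B, hB, fun s hs => (h s hs).trans (hu s hs)⟩

theorem GeomBdd.pow {u : ℕ → ℝ} (hu : GeomBdd u) (h : ∀ s, 0 ≤ u s) (k : ℕ) :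
    GeomBdd fun s => u s ^ k := by
  obtain ⟨B, hB, hu⟩ := hu
  refine ⟨B ^ k, one_le_pow₀ hB, fun s hs => ?_⟩
  rw [← pow_mul, mul_comm, pow_mul]
  exact pow_le_pow_left₀ (h s) (hu s hs) k

theorem factorial_pow_mul_factorial_le (n k b : ℕ) :
    n.factorial ^ k * b.factorial ≤ (k * n + b).factorial := by
  induction k with
  | zero => simp
  | succ k ih =>
    calc n.factorial ^ (k + 1) * b.factorial = n.factorial * (n.factorial ^ k * b.factorial) := by
          ring
      _ ≤ n.factorial * (k * n + b).factorial := Nat.mul_le_mul_left _ ih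
      _ ≤ (n + (k * n + b)).factorial := Nat.le_of_dvd (Nat.factorial_pos _)
          (Nat.factorial_mul_factorial_dvd_factorial_add _ _)
      _ = _ := by congr 1; ring

theorem not_forall_factorial_le {m c s₀ : ℕ} (hm : 2 ≤ m) {t : ℝ} (ht : 0 < t) {u : ℕ → ℝ}
    (hu : GeomBdd u) (h : ∀ s, s₀ ≤ s → t * ((m * ((m + 3) * s) - 2 * s - c).factorial : ℝ) ≤
      u s * (((m + 3) * s).factorial : ℝ) ^ (m - 1) * ((s : ℝ) ^ s) ^ (m - 2)) : False := by
  obtain ⟨B, hB, hu⟩ := hu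
  obtain ⟨s, hs⟩ := exists_nat_gt (s₀ + c + 2 * B + t⁻¹)
  have ht' : 0 < t⁻¹ := inv_pos.mpr ht
  have hs0 : s₀ ≤ s := by
    have : (s₀ : ℝ) ≤ s := by
      have : (0 : ℝ) ≤ c := Nat.cast_nonneg _
      linarith
    exact_mod_cast this
  have hsc : c ≤ s := by
    have : (c : ℝ) ≤ s := by
      have : (0 : ℝ) ≤ s₀ := Nat.cast_nonneg _
      linarith
    exact_mod_cast this
  have hc0 : (0 : ℝ) ≤ c := Nat.cast_nonneg _
  have hs00 : (0 : ℝ) ≤ s₀ := Nat.cast_nonneg _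
  have hs2B : 2 * B ≤ s := by linarith
  have hst : t⁻¹ < s := by linarith
  have hs1 : 1 ≤ s := by
    have : (1 : ℝ) ≤ s := by linarith
    exact_mod_cast this
  have h1 := h s hs0
  obtain ⟨m, rfl⟩ : ∃ k, m = k + 2 := ⟨m - 2, by omega⟩
  rw [show m + 2 - 1 = m + 1 by omega, Nat.add_sub_cancel] at h1
  set n := (m + 2 + 3) * s with hn
  have hfac : n.factorial ^ (m + 1) * s ^ ((m + 1) * s) ≤ ((m + 2) * n - 2 * s - c).factorial := by
    have e1 : s ^ ((m + 1) * s) ≤ ((m + 2) * s).factorial := by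
      have := Nat.factorial_mul_pow_sub_le_factorial (n := s) (m := (m + 2) * s)
        (Nat.le_mul_of_pos_left _ (by omega))
      rw [show (m + 2) * s - s = (m + 1) * s by
        rw [show (m + 2) * s = (m + 1) * s + s by ring, Nat.add_sub_cancel]] at this
      exact (Nat.le_mul_of_pos_left _ (Nat.factorial_pos _)).trans this
    refine (Nat.mul_le_mul_left _ e1).trans ((factorial_pow_mul_factorial_le _ _ _).trans
      (Nat.factorial_le ?_))
    have e2 : n = (m + 2) * s + 3 * s := by rw [hn]; ring
    have e3 : (m + 2) * n = (m + 1) * n + n := by ring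
    omega
  have hfac' : ((n.factorial : ℝ)) ^ (m + 1) * ((s : ℝ) ^ s) ^ (m + 1) ≤
      (((m + 2) * n - 2 * s - c).factorial : ℝ) := by
    rw [← pow_mul (s : ℝ), mul_comm s (m + 1)]
    exact_mod_cast hfac
  have hn0 : (0 : ℝ) < n.factorial := by exact_mod_cast n.factorial_pos
  have hss : (0 : ℝ) < (s : ℝ) ^ s := by
    have : (0 : ℝ) < s := by exact_mod_cast hs1
    positivity
  have h2 : t * (n.factorial ^ (m + 1) * ((s : ℝ) ^ s) ^ (m + 1)) ≤
      B ^ s * n.factorial ^ (m + 1) * ((s : ℝ) ^ s) ^ m := by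
    refine (mul_le_mul_of_nonneg_left hfac' ht.le).trans (h1.trans ?_)
    gcongr
    exact hu s hs1
  have h3 : t * (s : ℝ) ^ s ≤ B ^ s := by
    have hpos : 0 < (n.factorial : ℝ) ^ (m + 1) * ((s : ℝ) ^ s) ^ m := by positivity
    refine le_of_mul_le_mul_right ?_ hpos
    calc _ = t * (n.factorial ^ (m + 1) * ((s : ℝ) ^ s) ^ (m + 1)) := by ring
      _ ≤ _ := h2
      _ = _ := by ring
  have h4 : t * (2 ^ s * B ^ s) ≤ B ^ s := by
    rw [← mul_pow]
    exact (mul_le_mul_of_nonneg_left (pow_le_pow_left₀ (by positivity) hs2B s) ht.le).trans h3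
  have hBs : 0 < B ^ s := by positivity
  have h5 : t * 2 ^ s ≤ 1 := by
    refine le_of_mul_le_mul_right ?_ hBs
    linarith
  have h6 : (s : ℝ) < 2 ^ s := by exact_mod_cast Nat.lt_two_pow_self
  have h7 : 1 < t * s := by
    rw [inv_lt_iff_one_lt_mul₀ ht] at hst
    linarith
  nlinarith

end Growth

section Estimates

variable {K : Type*} [Field K] [NumberField K]

theorem polyHouse_le_of_house_mul_factorial_le {p : K[X]} {n : ℕ} (hn : p.natDegree ≤ n) {Q : ℝ}
    (h : ∀ j, house (p.coeff j) * j.factorial ≤ Q) : polyHouse p ≤ (n + 1 : ℕ) * Q := by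
  rw [polyHouse_eq_sum_range hn]
  have h1 : ∀ j ∈ Finset.range (n + 1), house (p.coeff j) ≤ Q := fun j _ => by
    refine le_trans (le_mul_of_one_le_right (house_nonneg _) ?_) (h j)
    exact_mod_cast Nat.factorial_pos j
  simpa using Finset.sum_le_card_nsmul _ _ Q h1

variable {ι : Type*} [Fintype ι]

theorem exists_house_eval_thetaIter_le (T : K[X]) (A : Matrix ι ι K[X]) (α : K) (g k : ℕ)
    (hg : 1 ≤ g) {B₀ : ℝ} (hB₀ : 1 ≤ B₀) :
    ∃ u : ℕ → ℝ, GeomBdd u ∧ (∀ s, 1 ≤ u s) ∧ ∀ (s : ℕ) (P : ι → K[X]), 1 ≤ s →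
      (∀ i, (P i).natDegree ≤ g * s) →
      (∀ i j, house ((P i).coeff j) * j.factorial ≤ B₀ ^ s * (g * s).factorial) →
      ∀ j ≤ s + k, ∀ i, house ((thetaIter T A P j i).eval α) ≤
        u s * (g * s).factorial * (s : ℝ) ^ s := by
  obtain ⟨d, hdT, hdA⟩ : ∃ d, T.natDegree ≤ d ∧ ∀ i j, (A i j).natDegree ≤ d := by
    refine ⟨T.natDegree + ∑ i, ∑ j, (A i j).natDegree, by omega, fun i j => ?_⟩
    have h1 : (A i j).natDegree ≤ ∑ j, (A i j).natDegree :=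
      Finset.single_le_sum (f := fun j => (A i j).natDegree) (fun _ _ => Nat.zero_le _)
        (Finset.mem_univ j)
    have h2 : ∑ j, (A i j).natDegree ≤ ∑ i, ∑ j, (A i j).natDegree :=
      Finset.single_le_sum (f := fun i => ∑ j, (A i j).natDegree) (fun _ _ => Nat.zero_le _)
        (Finset.mem_univ i)
    omega
  obtain ⟨c, hc, H⟩ := exists_polyHouse_thetaIter_le T A d hdT hdA
  set Z : ℝ := max 1 (house α)
  have hZ : 1 ≤ Z := le_max_left _ _
  set E := g + k + 2 with hE
  have hE1 : (1 : ℝ) ≤ c * E := one_le_mul_of_one_le_of_one_le hc (by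
    exact_mod_cast (by omega : 1 ≤ E))
  refine ⟨fun s => ((g * s + 1 : ℕ) : ℝ) * B₀ ^ s * (c * E) ^ (s + k) * (((s + 1 : ℕ) : ℝ) ^ k) *
    Z ^ (g * s + (s + k) * d), ?_, fun s => ?_, fun s P hs hPn hPb j hj i => ?_⟩
  · refine ((((geomBdd_natCast (g + 1) fun s hs => by nlinarith).mul
      (geomBdd_pow hB₀ 1 fun s hs => by omega) fun s => by positivity).mul
      (geomBdd_pow hE1 (k + 1) fun s hs => by nlinarith) fun s => by positivity).mul
      ((geomBdd_natCast 2 fun s hs => by omega).pow (fun s => by positivity) k)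
        fun s => by positivity).mul
      (geomBdd_pow hZ (g + (1 + k) * d) fun s hs => ?_) fun s => by positivity
    have : s + k ≤ (1 + k) * s := by nlinarith
    have : (s + k) * d ≤ (1 + k) * s * d := Nat.mul_le_mul_right _ this
    linarith
  · have h1 : (1 : ℝ) ≤ (g * s + 1 : ℕ) := by exact_mod_cast (by omega : 1 ≤ g * s + 1)
    have h2 : (1 : ℝ) ≤ (s + 1 : ℕ) := by exact_mod_cast (by omega : 1 ≤ s + 1)
    exact one_le_mul_of_one_le_of_one_le (one_le_mul_of_one_le_of_one_le
      (one_le_mul_of_one_le_of_one_le (one_le_mul_of_one_le_of_one_le h1 (one_le_pow₀ hB₀))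
      (one_le_pow₀ hE1)) (one_le_pow₀ h2)) (one_le_pow₀ hZ)
  · have hM := fun i => polyHouse_le_of_house_mul_factorial_le (hPn i) (hPb i)
    have h1 := H P (g * s) _ (by positivity) hPn hM (s + k) j hj i
    have h2 := house_eval_le (natDegree_thetaIter_le T A P hPn hdT hdA j i) hZ
      (le_max_right 1 (house α))
    have h3 : (c * (g * s + (s + k) + 1 : ℕ)) ^ j ≤
        (c * E) ^ (s + k) * (s : ℝ) ^ s * ((s + 1 : ℕ) : ℝ) ^ k := by
      have e1 : g * s + (s + k) + 1 ≤ E * s := by rw [hE]; nlinarith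
      have e2 : ((g * s + (s + k) + 1 : ℕ) : ℝ) ≤ E * s := by exact_mod_cast e1
      have e3 : (1 : ℝ) ≤ c * (g * s + (s + k) + 1 : ℕ) := one_le_mul_of_one_le_of_one_le hc (by
        exact_mod_cast (by omega : 1 ≤ g * s + (s + k) + 1))
      have e4 : (s : ℝ) ≤ (s + 1 : ℕ) := by exact_mod_cast (by omega : s ≤ s + 1)
      calc _ ≤ (c * (g * s + (s + k) + 1 : ℕ)) ^ (s + k) := pow_le_pow_right₀ e3 hj
        _ ≤ (c * (E * s)) ^ (s + k) := by gcongr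
        _ = (c * E) ^ (s + k) * (s : ℝ) ^ s * (s : ℝ) ^ k := by
          rw [← mul_assoc, mul_pow, pow_add (s : ℝ)]
          ring
        _ ≤ _ := by gcongr
    have h4 : Z ^ (g * s + j * d) ≤ Z ^ (g * s + (s + k) * d) :=
      pow_le_pow_right₀ hZ (by gcongr)
    have hp0 := polyHouse_nonneg (thetaIter T A P j i)
    calc _ ≤ _ := h2
      _ ≤ ((g * s + 1 : ℕ) * (B₀ ^ s * (g * s).factorial) *
          ((c * E) ^ (s + k) * (s : ℝ) ^ s * ((s + 1 : ℕ) : ℝ) ^ k)) *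
          Z ^ (g * s + (s + k) * d) := by
        refine mul_le_mul (h1.trans (mul_le_mul_of_nonneg_left h3 (by positivity))) h4
          (by positivity) (by positivity)
      _ = _ := by ring

theorem exists_isIntegral_eval_thetaIter {T : K[X]} {A : Matrix ι ι K[X]}
    (hT : T ∈ integralPolys K) (hA : ∀ i j, A i j ∈ integralPolys K) (α : K) (g k : ℕ) :
    ∃ D : ℕ → ℕ, GeomBdd (fun s => (D s : ℝ)) ∧ (∀ s, 0 < D s) ∧ ∀ (s : ℕ) (P : ι → K[X]),
      (∀ i, (P i).natDegree ≤ g * s) → (∀ i, P i ∈ integralPolys K) →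
      ∀ j ≤ s + k, ∀ i, IsIntegral ℤ ((D s : K) * (thetaIter T A P j i).eval α) := by
  obtain ⟨d, hdT, hdA⟩ : ∃ d, T.natDegree ≤ d ∧ ∀ i j, (A i j).natDegree ≤ d := by
    refine ⟨T.natDegree + ∑ i, ∑ j, (A i j).natDegree, by omega, fun i j => ?_⟩
    have h1 : (A i j).natDegree ≤ ∑ j, (A i j).natDegree :=
      Finset.single_le_sum (f := fun j => (A i j).natDegree) (fun _ _ => Nat.zero_le _)
        (Finset.mem_univ j)
    have h2 : ∑ j, (A i j).natDegree ≤ ∑ i, ∑ j, (A i j).natDegree :=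
      Finset.single_le_sum (f := fun i => ∑ j, (A i j).natDegree) (fun _ _ => Nat.zero_le _)
        (Finset.mem_univ i)
    omega
  obtain ⟨a, ha, haα⟩ := exists_natCast_mul_isIntegral α
  refine ⟨fun s => a ^ (g * s + (s + k) * d), ?_, fun s => pow_pos ha _,
    fun s P hPn hP j hj i => ?_⟩
  · have h1 : (1 : ℝ) ≤ a := by exact_mod_cast ha
    refine (geomBdd_pow h1 (e := fun s => g * s + (s + k) * d) (g + (1 + k) * d)
      fun s hs => ?_).mono fun s _ => by push_cast; rfl
    have : s + k ≤ (1 + k) * s := by nlinarith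
    have : (s + k) * d ≤ (1 + k) * s * d := Nat.mul_le_mul_right _ this
    linarith
  · push_cast
    refine isIntegral_pow_mul_eval (thetaIter_mem_integralPolys hT hA hP j i)
      ((natDegree_thetaIter_le T A P hPn hdT hdA j i).trans ?_) haα
    gcongr

variable [Algebra K ℂ]

theorem exists_norm_evalAt_le (T : K[X]) (z : ℂ) (m g k : ℕ) {B : ℝ} (hB : 1 ≤ B) :
    ∃ u : ℕ → ℝ, GeomBdd u ∧ (∀ s, 0 ≤ u s) ∧ ∀ (s : ℕ) (R : PowerSeries K), EType R →
      s + (s + k) ≤ m * (g * s + 1) →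
      PowerSeries.X ^ (m * (g * s + 1) - s) ∣ R →
      (∀ l, house (expCoeff l R) ≤ B ^ s * (g * s).factorial * B ^ (l + 1)) →
      ∀ j ≤ s + k, ‖evalAt z (T ^ j • (PowerSeries.derivative K)^[j] R)‖ *
        (m * (g * s + 1) - s - (s + k)).factorial ≤ u s * (g * s).factorial := by
  set Z : ℝ := max 1 ‖z‖
  have hZ : 1 ≤ Z := le_max_left _ _
  set t : ℝ := max 1 ‖aeval z T‖
  have ht : 1 ≤ t := le_max_left _ _
  refine ⟨fun s => B ^ s * B ^ (m * (g * s + 1) + 1) * Z ^ (m * (g * s + 1)) *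
    Real.exp (B * Z) * t ^ (s + k), ?_, fun s => by positivity, fun s R hRE hJ hX hRb j hj => ?_⟩
  · refine ((((geomBdd_pow hB 1 fun s hs => by omega).mul
      (geomBdd_pow hB (m * (g + 1) + 1) fun s hs => ?_) fun s => by positivity).mul
      (geomBdd_pow hZ (m * (g + 1)) fun s hs => ?_) fun s => by positivity).mul
      (geomBdd_const _) fun s => by positivity).mul
      (geomBdd_pow ht (k + 1) fun s hs => by nlinarith) fun s => by positivity
    · have : g * s + 1 ≤ (g + 1) * s := by nlinarith
      have := Nat.mul_le_mul_left m this
      nlinarith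
    · have : g * s + 1 ≤ (g + 1) * s := by nlinarith
      have := Nat.mul_le_mul_left m this
      nlinarith
  · set p := m * (g * s + 1) - s with hp
    have hjp : j ≤ p := by omega
    have h1 := norm_evalAt_iterate_derivative_le hX hjp hB (by positivity) hZ
      (le_max_right 1 ‖z‖) hRb
    rw [evalAt_smul (hRE.iterate_derivative j), norm_mul, map_pow, norm_pow]
    have h2 : ‖aeval z T‖ ^ j ≤ t ^ (s + k) :=
      (pow_le_pow_left₀ (norm_nonneg _) (le_max_right _ _) j).trans (pow_le_pow_right₀ ht hj)
    have h3 : ((p - (s + k)).factorial : ℝ) ≤ (p - j).factorial := by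
      exact_mod_cast Nat.factorial_le (by omega)
    have h4 : B ^ (p + 1) ≤ B ^ (m * (g * s + 1) + 1) := pow_le_pow_right₀ hB (by omega)
    have h5 : Z ^ p ≤ Z ^ (m * (g * s + 1)) := pow_le_pow_right₀ hZ (by omega)
    calc _ ≤ t ^ (s + k) * ‖evalAt z ((PowerSeries.derivative K)^[j] R)‖ * (p - j).factorial := by
          gcongr
      _ = t ^ (s + k) * (‖evalAt z ((PowerSeries.derivative K)^[j] R)‖ * (p - j).factorial) := by
          ring
      _ ≤ t ^ (s + k) * (B ^ s * (g * s).factorial * B ^ (p + 1) * Z ^ p * Real.exp (B * Z)) := by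
          gcongr
      _ ≤ t ^ (s + k) * (B ^ s * (g * s).factorial * B ^ (m * (g * s + 1) + 1) *
          Z ^ (m * (g * s + 1)) * Real.exp (B * Z)) := by gcongr
      _ = _ := by ring

end Estimates

section RankBound

variable {K : Type*} [Field K] [NumberField K]

theorem exists_common_denominator {κ : Type*} [Fintype κ] (x : κ → K) :
    ∃ D : ℕ, 0 < D ∧ ∀ i, IsIntegral ℤ ((D : K) * x i) := by
  classical
  choose d hd hx using fun i => exists_natCast_mul_isIntegral (x i)
  refine ⟨∏ i, d i, Finset.prod_pos fun i _ => hd i, fun i => ?_⟩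
  rw [← Finset.mul_prod_erase _ _ (Finset.mem_univ i), Nat.cast_mul, mul_comm (d i : K), mul_assoc]
  exact (isIntegral_natCast _).mul (hx i)

variable [Algebra K ℂ] {ι : Type} [Fintype ι]

theorem exists_coordinates (W : ι → ℂ) {ρ : ℕ}
    (hρ : ρ = Module.finrank K (Submodule.span K (Set.range W))) :
    ∃ (L : Matrix (Fin ρ) ι K) (θ : Fin ρ → ℂ), LinearIndependent K θ ∧
      Function.Surjective L.mulVec ∧ ∀ v : ι → K,
      ∑ i, algebraMap K ℂ (v i) * W i = ∑ k, algebraMap K ℂ (L.mulVec v k) * θ k := by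
  subst hρ
  have : FiniteDimensional K (Submodule.span K (Set.range W)) :=
    FiniteDimensional.span_of_finite K (Set.finite_range W)
  let b := Module.finBasis K (Submodule.span K (Set.range W))
  let Wv : ι → Submodule.span K (Set.range W) := fun i => ⟨W i, Submodule.subset_span ⟨i, rfl⟩⟩
  let L : Matrix (Fin (Module.finrank K (Submodule.span K (Set.range W)))) ι K :=
    fun k i => b.repr (Wv i) k
  have hθ : LinearIndependent K fun k => (b k : ℂ) :=
    b.linearIndependent.map' (Submodule.subtype _) (Submodule.ker_subtype _)
  have key : ∀ v : ι → K,
      ∑ i, algebraMap K ℂ (v i) * W i = ∑ k, algebraMap K ℂ (L.mulVec v k) * (b k : ℂ) := by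
    intro v
    have h1 : ∀ i, W i = ∑ k, algebraMap K ℂ (L k i) * (b k : ℂ) := by
      intro i
      have := congrArg (Submodule.subtype _) (b.sum_repr (Wv i))
      simp only [map_sum, map_smul, Submodule.subtype_apply, Algebra.smul_def] at this
      exact this.symm
    simp only [Matrix.mulVec, dotProduct, map_sum, map_mul, Finset.sum_mul]
    rw [Finset.sum_comm]
    refine Finset.sum_congr rfl fun i _ => ?_
    rw [h1 i, Finset.mul_sum]
    exact Finset.sum_congr rfl fun k _ => by ring
  refine ⟨L, fun k => b k, hθ, fun c => ?_, key⟩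
  have h2 : ∑ k, c k • (b k : ℂ) ∈ Submodule.span K (Set.range W) :=
    Submodule.sum_mem _ fun k _ => Submodule.smul_mem _ _ (b k).2
  obtain ⟨v, hv⟩ := (Submodule.mem_span_range_iff_exists_fun K).mp h2
  refine ⟨v, ?_⟩
  have h3 := key v
  simp only [← Algebra.smul_def] at h3
  rw [hv] at h3
  have h4 := Fintype.linearIndependent_iff.mp hθ (fun k => c k - L.mulVec v k) (by
    simp only [sub_smul, Finset.sum_sub_distrib]
    rw [h3, sub_self])
  exact funext fun k => (sub_eq_zero.mp (h4 k)).symm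

theorem evalAt_linearCombination {w : ι → PowerSeries K} (hw : ∀ i, EType (w i)) (α : K)
    (v : ι → K[X]) : evalAt (algebraMap K ℂ α) (Fintype.linearCombination K[X] w v) =
      ∑ i, algebraMap K ℂ (evalVec α v i) * evalAt (algebraMap K ℂ α) (w i) := by
  rw [Fintype.linearCombination_apply, evalAt_sum _ _ fun i _ => (hw i).smul _]
  refine Finset.sum_congr rfl fun i _ => ?_
  rw [evalAt_smul (hw i), evalVec, Polynomial.aeval_algebraMap_apply_eq_algebraMap_eval]

theorem card_le_of_integral_system [Nonempty ι] {w : ι → PowerSeries K} (hw : ∀ i, EType (w i))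
    (hli : LinearIndependent K[X] w) {T : K[X]} {A : Matrix ι ι K[X]}
    (hTi : T ∈ integralPolys K) (hAi : ∀ i j, A i j ∈ integralPolys K)
    (hA : ∀ j, T • PowerSeries.derivative K (w j) = ∑ i, A j i • w i)
    {α : K} (hα : α ≠ 0) (hTα : T.eval α ≠ 0)
    (hne : ∃ i, evalAt (algebraMap K ℂ α) (w i) ≠ 0) :
    Fintype.card ι ≤ Module.finrank ℚ K * Module.finrank K
      (Submodule.span K (Set.range fun i => evalAt (algebraMap K ℂ α) (w i))) := by
  classical
  by_contra! hlt
  set m := Fintype.card ι with hm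
  set h := Module.finrank ℚ K with hh
  set z := algebraMap K ℂ α with hz
  set W : ι → ℂ := fun i => evalAt z (w i) with hW
  set ρ := Module.finrank K (Submodule.span K (Set.range W)) with hρ
  obtain ⟨L, θ, hθ, hLs, hL⟩ := exists_coordinates (K := K) W hρ
  set φ := Fintype.linearCombination K[X] w with hφ
  have hφi : Function.Injective φ := linearIndependent_iff_injective_fintypeLinearCombination.mp hli
  have hφT : ∀ v, φ (thetaOp T A v) = T • PowerSeries.derivative K (φ v) := by
    intro v
    have h1 : ∀ i, PowerSeries.derivative K (v i • w i) =
        derivative (v i) • w i + v i • PowerSeries.derivative K (w i) := by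
      intro i
      have e : ∀ (p : K[X]) (F : PowerSeries K), p • F = (p : PowerSeries K) * F :=
        fun p F => Algebra.smul_def p F
      rw [e, e, e, Derivation.leibniz, PowerSeries.derivative_coe, smul_eq_mul, smul_eq_mul]
      ring
    simp only [hφ, Fintype.linearCombination_apply, thetaOp, map_sum, h1, add_smul,
      Finset.sum_add_distrib, Finset.smul_sum, smul_add, mul_smul]
    congr 1
    simp only [Finset.sum_smul]
    rw [Finset.sum_comm]
    refine Finset.sum_congr rfl fun j _ => ?_
    rw [smul_comm, hA, Finset.smul_sum]
    exact Finset.sum_congr rfl fun i _ => by rw [mul_comm, mul_smul]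
  have hT0 : T ≠ 0 := by
    rintro rfl
    exact hTα Polynomial.eval_zero
  obtain ⟨c, hspan⟩ := exists_forall_span_evalVec_eq_top T hT0 A φ hφi hφT α hα hTα
  simp only [← hm] at hspan
  have hm1 : 1 ≤ m := Fintype.card_pos
  have hh1 : 1 ≤ h := Module.finrank_pos
  have hρ1 : 1 ≤ ρ := by
    obtain ⟨i, hi⟩ := hne
    have : FiniteDimensional K (Submodule.span K (Set.range W)) :=
      FiniteDimensional.span_of_finite K (Set.finite_range W)
    refine Module.finrank_pos_iff_exists_ne_zero.mpr ⟨⟨W i, Submodule.subset_span ⟨i, rfl⟩⟩, ?_⟩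
    exact fun h0 => hi (congrArg Subtype.val h0)
  have hm2 : 2 ≤ m := by
    have : 1 ≤ h * ρ := Nat.mul_pos hh1 hρ1
    omega
  set g := m + 3 with hg
  set k := m + c with hk
  obtain ⟨B, hB, haux⟩ := exists_auxiliary w hw g (by omega)
  simp only [← hm] at haux
  obtain ⟨u₁, hu₁, hu₁1, H₁⟩ := exists_house_eval_thetaIter_le T A α g k (by omega) hB
  obtain ⟨D, hD, hD0, HD⟩ := exists_isIntegral_eval_thetaIter hTi hAi α g k
  obtain ⟨u₂, hu₂, hu₂0, H₂⟩ := exists_norm_evalAt_le (K := K) T z m g k hB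
  obtain ⟨DL, hDL, hDLi⟩ := exists_common_denominator fun x : Fin ρ × ι => L x.1 x.2
  obtain ⟨ℓ, hℓ1, hℓ⟩ : ∃ ℓ : ℝ, 1 ≤ ℓ ∧ ∀ a b, house (L a b) ≤ ℓ := by
    refine ⟨1 + ∑ x : Fin ρ × ι, house (L x.1 x.2), ?_, fun a b => ?_⟩
    · have : 0 ≤ ∑ x : Fin ρ × ι, house (L x.1 x.2) := Finset.sum_nonneg fun _ _ => house_nonneg _
      linarith
    · have := Finset.single_le_sum (f := fun x : Fin ρ × ι => house (L x.1 x.2))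
        (fun _ _ => house_nonneg _) (Finset.mem_univ (a, b))
      dsimp only at this
      linarith
  let k₀ : Fin ρ := ⟨0, hρ1⟩
  have hmℓ : 1 ≤ (m : ℝ) * ℓ :=
    one_le_mul_of_one_le_of_one_le (by exact_mod_cast hm1) hℓ1
  have hpos : ∀ s, 0 ≤ (m : ℝ) * ℓ * u₁ s := fun s =>
    mul_nonneg (by linarith) (zero_le_one.trans (hu₁1 s))
  refine not_forall_factorial_le (c := c) (s₀ := c + 1) hm2 (t := ‖θ k₀‖)
    (norm_pos_iff.mpr (hθ.ne_zero _))
    (u := fun s => ((DL : ℝ) * D s) ^ (ρ * h) * (ρ.factorial : ℝ) ^ h *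
      (m * ℓ * u₁ s) ^ (m - 2) * u₂ s) ?_ fun s hs => ?_
  · exact ((((((geomBdd_const _).mul hD fun s => by positivity).pow (fun s => by positivity) _).mul
      (geomBdd_const _) fun s => by positivity).mul
      (((geomBdd_const _).mul hu₁ fun s => zero_le_one.trans (hu₁1 s)).pow hpos _)
      fun s => pow_nonneg (hpos s) _)).mul hu₂ hu₂0
  have hs1 : 1 ≤ s := by omega
  have hsc : c ≤ s := by omega
  obtain ⟨P, hP0, hPn, hPi, hPb, hPX, hPt⟩ := haux s hs1
  have hgs : m * (g * s) = m * m * s + 3 * (m * s) := by rw [hg]; ring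
  have hms : s ≤ m * s := Nat.le_mul_of_pos_left _ hm1
  have hm1gs : m * (g * s) = (m - 1) * (g * s) + g * s := by
    obtain ⟨m', hm'⟩ : ∃ m', m = m' + 1 := ⟨m - 1, by omega⟩
    rw [hm']
    simp only [Nat.add_sub_cancel]
    ring
  have hgs2 : g * s = m * s + 3 * s := by rw [hg]; ring
  have hgs3 : m * (g * s + 1) = m * (g * s) + m := by ring
  have htop := hspan (g * s) (m * (g * s + 1) - s) (s + c) P hP0 hPn hPX (by omega) (by omega)
  set V : Fin (m + (s + c)) → Fin ρ → K := fun j => L.mulVec (evalVec α (thetaIter T A P j)) with hV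
  have hVtop : Submodule.span K (Set.range V) = ⊤ := by
    have h1 : Set.range V = L.mulVecLin '' Set.range fun j : Fin (m + (s + c)) =>
        evalVec α (thetaIter T A P j) := by
      rw [← Set.range_comp]
      rfl
    rw [h1, Submodule.span_image, htop, Submodule.map_top, LinearMap.range_eq_top]
    exact hLs
  have hfr : Module.finrank K (Submodule.span K (Set.range V)) = ρ := by
    rw [hVtop, finrank_top, Module.finrank_fin_fun]
  have hf := Submodule.exists_fun_fin_finrank_span_eq K (Set.range V)
  rw [hfr] at hf
  obtain ⟨f, hfV, -, hfli⟩ := hf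
  choose e he using hfV
  have hdet : (Matrix.of f).det ≠ 0 := by
    have := (Matrix.linearIndependent_rows_iff_isUnit (A := Matrix.of f)).mp hfli
    exact ((Matrix.isUnit_iff_isUnit_det _).mp this).ne_zero
  have hek : ∀ i, ((e i : Fin _) : ℕ) ≤ s + k := fun i => by have := (e i).2; omega
  have hentry : ∀ i j, Matrix.of f i j = ∑ l, L j l * (thetaIter T A P (e i) l).eval α := by
    intro i j
    rw [Matrix.of_apply, ← he i]
    rfl
  have hmainbound := norm_le_of_linear_forms (Matrix.of f) hdet (DL * D s)
    (Nat.mul_pos hDL (hD0 s)) (fun i j => by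
      rw [hentry, Finset.mul_sum]
      refine IsIntegral.sum _ fun l _ => ?_
      have h1 := (hDLi (j, l)).mul
        (HD s P hPn (fun i => mem_integralPolys.mpr (hPi i)) (e i) (hek i) l)
      convert h1 using 1
      push_cast
      ring)
    (H := m * ℓ * u₁ s * (g * s).factorial * (s : ℝ) ^ s)
    (ε := u₂ s * (g * s).factorial / (m * (g * s + 1) - s - (s + k)).factorial)
    (fun i j => by
      rw [hentry]
      refine (house_sum_le _ _ (ℓ * (u₁ s * (g * s).factorial * (s : ℝ) ^ s))
        fun l _ => (house_mul_le _ _).trans ?_).trans (le_of_eq ?_)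
      · exact mul_le_mul (hℓ _ _) (H₁ s P hs1 hPn hPb _ (hek i) l) (house_nonneg _) (by linarith)
      · rw [Finset.card_univ, ← hm]
        ring)
    θ (fun i => by
      have h1 : ∑ k, algebraMap K ℂ (Matrix.of f i k) * θ k =
          evalAt z (T ^ (e i : ℕ) • (PowerSeries.derivative K)^[(e i : ℕ)] (φ P)) := by
        rw [← map_thetaIter T A P φ hφT, hφ, hz, evalAt_linearCombination hw]
        refine Eq.trans ?_ (hL _).symm
        refine Finset.sum_congr rfl fun k _ => ?_
        rw [Matrix.of_apply, ← he i]
      rw [h1, le_div_iff₀ (by exact_mod_cast Nat.factorial_pos _)]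
      refine H₂ s (φ P) ?_ (by omega) hPX hPt _ (hek i)
      rw [hφ, Fintype.linearCombination_apply]
      exact (eTypeSubalgebra K).sum_mem fun i _ => (hw i).smul _) k₀
  have hfac : m * (g * s + 1) - s - (s + k) = m * (g * s) - 2 * s - c := by omega
  rw [hfac, ← hh] at hmainbound
  have hF : (0 : ℝ) < (m * (g * s) - 2 * s - c).factorial := by exact_mod_cast Nat.factorial_pos _
  set N : ℝ := ((g * s).factorial : ℝ) with hN
  have hN1 : 1 ≤ N := Nat.one_le_cast.mpr (Nat.factorial_pos _)
  have hss1 : (1 : ℝ) ≤ (s : ℝ) ^ s := one_le_pow₀ (by exact_mod_cast hs1)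
  set Hh : ℝ := m * ℓ * u₁ s * N * (s : ℝ) ^ s with hHh
  have hHh1 : 1 ≤ Hh := one_le_mul_of_one_le_of_one_le (one_le_mul_of_one_le_of_one_le
    (one_le_mul_of_one_le_of_one_le hmℓ (hu₁1 s)) hN1) hss1
  have hexp : (Hh ^ ρ) ^ (h - 1) * Hh ^ (ρ - 1) ≤ Hh ^ (m - 2) := by
    rw [← pow_mul, ← pow_add]
    refine pow_le_pow_right₀ hHh1 ?_
    have : h * ρ = ρ * (h - 1) + ρ := by
      obtain ⟨h', hh'⟩ : ∃ h', h = h' + 1 := ⟨h - 1, by omega⟩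
      rw [hh', Nat.add_sub_cancel]
      ring
    omega
  have hu20 := hu₂0 s
  calc ‖θ k₀‖ * ((m * (g * s) - 2 * s - c).factorial : ℝ)
      ≤ _ * ((m * (g * s) - 2 * s - c).factorial : ℝ) :=
        mul_le_mul_of_nonneg_right hmainbound hF.le
    _ = ((DL : ℝ) * D s) ^ (ρ * h) * (ρ.factorial : ℝ) ^ h *
        ((Hh ^ ρ) ^ (h - 1) * Hh ^ (ρ - 1)) * u₂ s * N := by
        push_cast
        field_simp
    _ ≤ ((DL : ℝ) * D s) ^ (ρ * h) * (ρ.factorial : ℝ) ^ h * Hh ^ (m - 2) * u₂ s * N := by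
        gcongr
    _ = _ := by
        rw [hHh, mul_pow _ ((s : ℝ) ^ s), mul_pow _ N, show m - 1 = (m - 2) + 1 by omega]
        ring

end RankBound

section ModuleBound

variable {K : Type*} [Field K] [NumberField K] [Algebra K ℂ]

omit [Algebra K ℂ] in
theorem exists_natCast_mul_mem_integralPolys {κ : Type*} [Fintype κ] (p : κ → K[X]) :
    ∃ D : ℕ, 0 < D ∧ ∀ i, (D : K[X]) * p i ∈ integralPolys K := by
  classical
  have : ∀ i, ∃ D : ℕ, 0 < D ∧ (D : K[X]) * p i ∈ integralPolys K := by
    intro i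
    obtain ⟨D, hD, h⟩ := exists_common_denominator
      fun j : Fin ((p i).natDegree + 1) => (p i).coeff j
    refine ⟨D, hD, mem_integralPolys.mpr fun j => ?_⟩
    rw [← Polynomial.C_eq_natCast, Polynomial.coeff_C_mul]
    by_cases hj : j < (p i).natDegree + 1
    · exact h ⟨j, hj⟩
    · rw [Polynomial.coeff_eq_zero_of_natDegree_lt (by omega), mul_zero]
      exact isIntegral_zero
  choose d hd hx using this
  refine ⟨∏ i, d i, Finset.prod_pos fun i _ => hd i, fun i => ?_⟩
  rw [← Finset.mul_prod_erase _ _ (Finset.mem_univ i), Nat.cast_mul, mul_comm (d i : K[X]),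
    mul_assoc]
  exact (integralPolys K).mul_mem (natCast_mem _ _) (hx i)

instance isTorsionFree_polynomial_powerSeries (k : Type*) [Field k] :
    Module.IsTorsionFree k[X] (PowerSeries k) :=
  Module.isTorsionFree_iff_algebraMap_injective.mpr (Polynomial.coe_injective k)

theorem finrank_le_of_derivation_stable (M : Submodule K[X] (PowerSeries K)) (hfg : M.FG)
    (hM : ∀ F ∈ M, EType F) (h1 : 1 ∈ M) {T : K[X]}
    (hT : ∀ F ∈ M, T • PowerSeries.derivative K F ∈ M) {α : K} (hα : α ≠ 0)
    (hTα : T.eval α ≠ 0) {S : Submodule K ℂ} [FiniteDimensional K S]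
    (hS : ∀ F ∈ M, evalAt (algebraMap K ℂ α) F ∈ S) :
    Module.finrank K[X] M ≤ Module.finrank ℚ K * Module.finrank K S := by
  classical
  have : Module.Finite K[X] M := Module.Finite.iff_fg.mpr hfg
  have : Module.Free K[X] M := Module.free_of_finite_type_torsion_free'
  let b := Module.finBasis K[X] M
  set w : Fin (Module.finrank K[X] M) → PowerSeries K := fun i => b i with hw
  let A : Matrix (Fin (Module.finrank K[X] M)) (Fin (Module.finrank K[X] M)) K[X] :=
    fun j i => b.repr ⟨_, hT (w j) (b j).2⟩ i
  have hA : ∀ j, T • PowerSeries.derivative K (w j) = ∑ i, A j i • w i := by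
    intro j
    have := congrArg (Submodule.subtype _) (b.sum_repr ⟨_, hT (w j) (b j).2⟩)
    simp only [map_sum, map_smul, Submodule.subtype_apply] at this
    exact this.symm
  obtain ⟨D₁, hD₁, hT₁⟩ := exists_natCast_mul_mem_integralPolys fun _ : Unit => T
  obtain ⟨D₂, hD₂, hA₂⟩ := exists_natCast_mul_mem_integralPolys
    fun x : Fin (Module.finrank K[X] M) × Fin (Module.finrank K[X] M) => A x.1 x.2
  have hne : ∃ i, evalAt (algebraMap K ℂ α) (w i) ≠ 0 := by
    by_contra! h0
    have h2 := congrArg (Submodule.subtype _) (b.sum_repr ⟨1, h1⟩)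
    simp only [map_sum, map_smul, Submodule.subtype_apply] at h2
    have h3 := congrArg (evalAt (algebraMap K ℂ α)) h2
    rw [evalAt_sum _ _ fun i _ => (hM _ (b i).2).smul _, Finset.sum_eq_zero fun i _ => by
      rw [evalAt_smul (hM _ (b i).2), show evalAt (algebraMap K ℂ α) (b i : PowerSeries K) = 0 from
        h0 i, mul_zero]] at h3
    have h4 := evalAt_polynomial (1 : K[X]) (algebraMap K ℂ α)
    rw [Polynomial.coe_one, map_one] at h4
    exact zero_ne_one (h3.trans h4)
  have : Nonempty (Fin (Module.finrank K[X] M)) := ⟨hne.choose⟩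
  have key := card_le_of_integral_system (w := w) (fun i => hM _ (b i).2)
    (b.linearIndependent.map' (Submodule.subtype _) (Submodule.ker_subtype _))
    (T := ((D₁ * D₂ : ℕ) : K[X]) * T)
    (A := fun j i => ((D₁ * D₂ : ℕ) : K[X]) * A j i)
    (by
      rw [mul_comm D₁, Nat.cast_mul, mul_assoc]
      exact (integralPolys K).mul_mem (natCast_mem _ _) (hT₁ ()))
    (fun j i => by
      rw [Nat.cast_mul, mul_assoc]
      exact (integralPolys K).mul_mem (natCast_mem _ _) (hA₂ (j, i)))
    (fun j => by simp only [mul_smul, ← Finset.smul_sum, hA]) hα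
    (by
      rw [Polynomial.eval_mul, Polynomial.eval_natCast]
      exact mul_ne_zero (Nat.cast_ne_zero.mpr (Nat.mul_pos hD₁ hD₂).ne') hTα) hne
  rw [Fintype.card_fin] at key
  refine key.trans (Nat.mul_le_mul_left _ (Submodule.finrank_mono (Submodule.span_le.mpr ?_)))
  rintro _ ⟨i, rfl⟩
  exact hS _ (b i).2

end ModuleBound

section HilbertBound

theorem Submodule.FG.exists_le_of_monotone {R M : Type*} [Semiring R] [AddCommMonoid M] [Module R M]
    {S : Submodule R M} (hS : S.FG) {u : ℕ → Submodule R M} (hu : Monotone u)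
    (h : ∀ x ∈ S, ∃ n, x ∈ u n) : ∃ n, S ≤ u n := by
  obtain ⟨G, rfl⟩ := hS
  choose! n hn using h
  refine ⟨G.sup n, Submodule.span_le.mpr fun x hx => ?_⟩
  exact hu (Finset.le_sup hx) (hn x (Submodule.subset_span hx))

variable {K Ω : Type*} [Field K] [Field Ω] [Algebra K Ω]

theorem Submodule.pow_mono_of_one_le {R A : Type*} [CommSemiring R] [CommSemiring A] [Algebra R A]
    {V : Submodule R A} (h : (1 : A) ∈ V) : Monotone fun n => V ^ n :=
  monotone_nat_of_le_succ fun n => by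
    rw [pow_succ]
    exact le_mul_of_one_le_right' (Submodule.one_le.mpr h)

theorem exists_mem_pow_of_mem_adjoin {R A : Type*} [CommSemiring R] [CommSemiring A] [Algebra R A]
    {s : Set A} {V : Submodule R A} (h1 : (1 : A) ∈ V) (hs : s ⊆ V) {x : A}
    (hx : x ∈ Algebra.adjoin R s) : ∃ n, x ∈ V ^ n := by
  induction hx using Algebra.adjoin_induction with
  | mem x hx => exact ⟨1, by simpa using hs hx⟩
  | algebraMap r =>
    refine ⟨0, ?_⟩
    rw [pow_zero]
    exact Submodule.algebraMap_mem r
  | add x y _ _ hx hy =>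
    obtain ⟨m, hm⟩ := hx
    obtain ⟨n, hn⟩ := hy
    exact ⟨max m n, add_mem (Submodule.pow_mono_of_one_le h1 (le_max_left m n) hm)
      (Submodule.pow_mono_of_one_le h1 (le_max_right m n) hn)⟩
  | mul x y _ _ hx hy =>
    obtain ⟨m, hm⟩ := hx
    obtain ⟨n, hn⟩ := hy
    exact ⟨m + n, pow_add V m n ▸ Submodule.mul_mem_mul hm hn⟩

theorem span_insert_one_pow_le {s : ℕ} (τ : Fin s → Ω) (M : ℕ) :
    Submodule.span K (insert 1 (Set.range τ)) ^ M ≤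
      Submodule.span K (Set.range fun c : Fin s → Fin (M + 1) => ∏ i, τ i ^ (c i : ℕ)) := by
  classical
  induction M with
  | zero =>
    rw [pow_zero, Submodule.one_le]
    exact Submodule.subset_span ⟨fun _ => 0, by simp⟩
  | succ M ih =>
    rw [pow_succ]
    refine (mul_le_mul' ih le_rfl).trans ?_
    rw [Submodule.span_mul_span]
    refine Submodule.span_mono ?_
    rintro _ ⟨_, ⟨c, rfl⟩, y, hy, rfl⟩
    rcases hy with rfl | ⟨j, rfl⟩
    · exact ⟨fun i => (c i).castSucc, by simp⟩
    · refine ⟨fun i => if i = j then (c i).succ else (c i).castSucc, ?_⟩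
      have : ∀ i, τ i ^ ((if i = j then (c i).succ else (c i).castSucc : Fin (M + 2)) : ℕ) =
          τ i ^ (c i : ℕ) * if i = j then τ i else 1 := by
        intro i
        split_ifs <;> simp [pow_succ]
      simp only [this, Finset.prod_mul_distrib, Finset.prod_ite_eq', Finset.mem_univ, if_true]

theorem finrank_mul_span_insert_one_pow_le {s : ℕ} (τ : Fin s → Ω) (G : Finset Ω) (M : ℕ) :
    Module.finrank K (Submodule.span K (G : Set Ω) *
      Submodule.span K (insert 1 (Set.range τ)) ^ M : Submodule K Ω) ≤ G.card * (M + 1) ^ s := by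
  classical
  let L : Finset Ω := Finset.univ.image fun c : Fin s → Fin (M + 1) => ∏ i, τ i ^ (c i : ℕ)
  have hL : (Set.range fun c : Fin s → Fin (M + 1) => ∏ i, τ i ^ (c i : ℕ)) = L := by simp [L]
  have h1 := mul_le_mul' (le_refl (Submodule.span K (G : Set Ω)))
    (span_insert_one_pow_le (K := K) τ M)
  rw [hL, Submodule.span_mul_span, ← Finset.coe_mul] at h1
  refine (Submodule.finrank_mono h1).trans ((finrank_span_finset_le_card _).trans ?_)
  refine Finset.card_mul_le.trans (Nat.mul_le_mul_left _ (Finset.card_image_le.trans ?_))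
  simp

theorem exists_finrank_pow_le_of_isIntegral {s : ℕ} (τ : Fin s → Ω) {V : Submodule K Ω}
    (hVfg : V.FG) (hV : ∀ x ∈ V, IsIntegral (Algebra.adjoin K (Set.range τ)) x) :
    ∃ C, ∀ N, Module.finrank K (V ^ N : Submodule K Ω) ≤ C * (N + 1) ^ s := by
  classical
  obtain ⟨G, rfl⟩ := hVfg
  set A := Algebra.adjoin K (Set.range τ) with hA
  obtain ⟨e, he⟩ := fg_adjoin_of_finite (R := A) G.finite_toSet
    fun x hx => hV x (Submodule.subset_span hx)
  set B := Submodule.span K (insert 1 (Set.range τ)) with hB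
  set Q := Submodule.span K ((insert 1 e : Finset Ω) : Set Ω) with hQ
  have hB1 : (1 : Ω) ∈ B := Submodule.subset_span (Set.mem_insert _ _)
  have hQ1 : (1 : Ω) ∈ Q := Submodule.subset_span (Finset.mem_insert_self _ _)
  have hu : Monotone fun n => Q * B ^ n :=
    fun m n h => mul_le_mul' le_rfl (Submodule.pow_mono_of_one_le hB1 h)
  have hmem : ∀ x ∈ Algebra.adjoin A (G : Set Ω), ∃ n, x ∈ Q * B ^ n := by
    intro x hx
    rw [← Subalgebra.mem_toSubmodule, ← he] at hx
    induction hx using Submodule.span_induction with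
    | mem x hx =>
      exact ⟨0, by
        rw [pow_zero, mul_one]
        exact Submodule.subset_span (Finset.mem_insert_of_mem hx)⟩
    | zero => exact ⟨0, Submodule.zero_mem _⟩
    | add x y _ _ hx hy =>
      obtain ⟨m, hm⟩ := hx
      obtain ⟨n, hn⟩ := hy
      exact ⟨max m n, add_mem (hu (le_max_left m n) hm) (hu (le_max_right m n) hn)⟩
    | smul a x _ hx =>
      obtain ⟨m, hm⟩ := hx
      obtain ⟨n, hn⟩ := exists_mem_pow_of_mem_adjoin (V := B) hB1
        ((Set.subset_insert _ _).trans Submodule.subset_span) a.2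
      refine ⟨m + n, ?_⟩
      rw [pow_add, ← mul_assoc, Subalgebra.smul_def, smul_eq_mul, mul_comm (a : Ω)]
      exact Submodule.mul_mem_mul hm hn
  have hQA : Q ≤ (Algebra.adjoin A (G : Set Ω)).toSubmodule.restrictScalars K := by
    refine Submodule.span_le.mpr fun x hx => ?_
    rcases Finset.mem_insert.mp hx with rfl | hx
    · exact (Algebra.adjoin A (G : Set Ω)).one_mem
    · exact he.le (Submodule.subset_span hx)
  obtain ⟨E, hE⟩ := Submodule.FG.exists_le_of_monotone
    (S := Submodule.span K (G : Set Ω) * Q) ((Submodule.fg_span G.finite_toSet).mul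
      (Submodule.fg_span (Finset.finite_toSet _))) hu (by
    intro x hx
    refine hmem x ?_
    induction hx using Submodule.mul_induction_on' with
    | mem_mul_mem a ha b hb =>
      refine mul_mem ?_ (hQA hb)
      have : Submodule.span K (G : Set Ω) ≤
          (Algebra.adjoin A (G : Set Ω)).toSubmodule.restrictScalars K :=
        Submodule.span_le.mpr Algebra.subset_adjoin
      exact this ha
    | add a _ b _ ha hb => exact add_mem ha hb)
  have hN : ∀ N, Submodule.span K (G : Set Ω) ^ N * Q ≤ Q * B ^ (E * N) := by
    intro N
    induction N with
    | zero => simp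
    | succ N ih =>
      calc Submodule.span K (G : Set Ω) ^ (N + 1) * Q
          = Submodule.span K (G : Set Ω) ^ N * (Submodule.span K (G : Set Ω) * Q) := by ring
        _ ≤ Submodule.span K (G : Set Ω) ^ N * (Q * B ^ E) := mul_le_mul' le_rfl hE
        _ = (Submodule.span K (G : Set Ω) ^ N * Q) * B ^ E := by ring
        _ ≤ (Q * B ^ (E * N)) * B ^ E := mul_le_mul' ih le_rfl
        _ = Q * B ^ (E * (N + 1)) := by ring
  refine ⟨(insert 1 e : Finset Ω).card * (E + 1) ^ s, fun N => ?_⟩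
  have h2 : Submodule.span K (G : Set Ω) ^ N ≤ Q * B ^ (E * N) :=
    (le_mul_of_one_le_right' (Submodule.one_le.mpr hQ1)).trans (hN N)
  have : FiniteDimensional K (Q * B ^ (E * N) : Submodule K Ω) :=
    Module.Finite.iff_fg.mpr ((Submodule.fg_span (Finset.finite_toSet _)).mul
      ((Submodule.fg_span ((Set.finite_range τ).insert 1)).pow _))
  refine (Submodule.finrank_mono h2).trans
    ((finrank_mul_span_insert_one_pow_le τ (insert 1 e) (E * N)).trans ?_)
  rw [mul_assoc, ← mul_pow]
  refine Nat.mul_le_mul_left _ (Nat.pow_le_pow_left ?_ s)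
  nlinarith

end HilbertBound

section DependentFamily

variable {K Ω : Type*} [Field K] [Field Ω] [Algebra K Ω]

theorem exists_lt_isIntegral_adjoin {t : ℕ} (υ : Fin t → Ω) (h : ¬ AlgebraicIndependent K υ) :
    ∃ s < t, ∃ τ : Fin s → Ω, ∀ x ∈ Algebra.adjoin K (Set.range υ),
      IsIntegral (Algebra.adjoin K (Set.range τ)) x := by
  set S := Algebra.adjoin K (Set.range υ) with hS
  have : Algebra.FiniteType K S := (Subalgebra.fg_iff_finiteType _).mp
    (Subalgebra.fg_def.mpr ⟨_, Set.finite_range υ, rfl⟩)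
  obtain ⟨s, g, hgi, hg⟩ := exists_integral_inj_algHom_of_fg K S
  let τ : Fin s → Ω := fun i => g (MvPolynomial.X i)
  refine ⟨s, ?_, τ, fun x hx => ?_⟩
  · by_contra! hts
    apply h
    let υ' : Fin t → S := fun i => ⟨υ i, Algebra.subset_adjoin ⟨i, rfl⟩⟩
    have hadj : Algebra.adjoin K (Set.range υ') = ⊤ := by
      rw [← Algebra.adjoin_adjoin_coe_preimage]
      congr 1
      ext x
      simp [υ', Subtype.ext_iff]
    have hind : AlgebraicIndependent K fun i => g (MvPolynomial.X i) :=
      (MvPolynomial.algebraicIndependent_X (Fin s) K).map' hgi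
    have hcard := hind.lift_cardinalMk_le_trdeg
    have : Algebra.IsAlgebraic (Algebra.adjoin K (Set.range υ')) S := by
      rw [hadj]
      exact ⟨fun x => isAlgebraic_algebraMap (⟨x, trivial⟩ : (⊤ : Subalgebra K S))⟩
    have hb := Algebra.IsAlgebraic.isTranscendenceBasis_of_lift_le_trdeg_of_finite (R := K) υ' (by
      refine le_trans ?_ hcard
      simpa using hts)
    exact hb.1.map' (f := S.val) Subtype.val_injective
  · obtain ⟨p, hp, hp0⟩ := hg ⟨x, hx⟩
    have hval : S.val.comp g = MvPolynomial.aeval τ :=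
      MvPolynomial.algHom_ext fun i => by simp [τ]
    have hmem : ∀ q, (S.val.comp g) q ∈ Algebra.adjoin K (Set.range τ) := by
      intro q
      rw [hval, Algebra.adjoin_range_eq_range_aeval]
      exact ⟨q, rfl⟩
    refine ⟨p.map ((S.val.comp g).codRestrict _ hmem).toRingHom, hp.map _, ?_⟩
    rw [Polynomial.eval₂_map]
    have := congrArg S.val hp0
    rw [map_zero, ← AlgHom.coe_toRingHom, Polynomial.hom_eval₂] at this
    exact this

theorem exists_finrank_pow_le_of_not_algebraicIndependent {t : ℕ} (υ : Fin t → Ω)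
    (h : ¬ AlgebraicIndependent K υ) {V : Submodule K Ω} (hfg : V.FG)
    (hV : ∀ x ∈ V, IsIntegral (Algebra.adjoin K (Set.range υ)) x) :
    ∃ s < t, ∃ C, ∀ N, Module.finrank K (V ^ N : Submodule K Ω) ≤ C * (N + 1) ^ s := by
  obtain ⟨s, hs, τ, hτ⟩ := exists_lt_isIntegral_adjoin υ h
  refine ⟨s, hs, exists_finrank_pow_le_of_isIntegral τ hfg fun x hx => ?_⟩
  let R := Algebra.adjoin K (Set.range τ)
  have h1 : IsIntegral (integralClosure R Ω) x := by
    refine IsIntegral.map_of_comp_eq (a := x)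
      ((Algebra.adjoin K (Set.range υ)).val.toRingHom.codRestrict (integralClosure R Ω)
        fun y => hτ y y.2) (RingHom.id Ω) ?_ (hV x hx)
    rfl
  exact isIntegral_trans x h1

end DependentFamily

section PrimitiveRelation

theorem exists_polynomial_common_denominator {A : Type*} [CommRing A] [IsDomain A] {κ : Type*}
    (s : Finset κ) (p : κ → (FractionRing A)[X]) : ∃ d : A, d ≠ 0 ∧ ∃ q : κ → A[X], ∀ i ∈ s,
      (q i).map (algebraMap A (FractionRing A)) = C (algebraMap A (FractionRing A) d) * p i := by
  classical
  obtain ⟨b, hb⟩ := IsLocalization.exist_integer_multiples (nonZeroDivisors A)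
    (s.sigma fun i => (p i).support) fun x : (_ : κ) × ℕ => (p x.1).coeff x.2
  refine ⟨b, nonZeroDivisors.ne_zero b.2, ?_⟩
  have : ∀ i, ∃ q : A[X], i ∈ s → q.map (algebraMap A (FractionRing A)) =
      C (algebraMap A (FractionRing A) b) * p i := by
    intro i
    by_cases hi : i ∈ s
    · have hl : C (algebraMap A (FractionRing A) b) * p i ∈
          Polynomial.lifts (algebraMap A (FractionRing A)) := by
        refine (Polynomial.lifts_iff_coeff_lifts _).mpr fun n => ?_
        rw [Polynomial.coeff_C_mul]
        by_cases hn : n ∈ (p i).support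
        · obtain ⟨y, hy⟩ := hb ⟨i, n⟩ (Finset.mem_sigma.mpr ⟨hi, hn⟩)
          exact ⟨y, by rw [hy, Algebra.smul_def]⟩
        · rw [Polynomial.notMem_support_iff.mp hn, mul_zero]
          exact ⟨0, map_zero _⟩
      obtain ⟨q, hq⟩ := hl
      exact ⟨q, fun _ => hq⟩
    · exact ⟨0, fun h => absurd h hi⟩
  choose q hq using this
  exact ⟨q, fun i hi => hq i hi⟩

variable {A R : Type*} [CommRing A] [IsDomain A] [CommRing R] [IsDomain R] [Algebra A R]

omit [IsDomain A] [IsDomain R] in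
theorem exists_relation_of_isAlgebraic {t : ℕ} {u : Fin t → R}
    (hu : AlgebraicIndependent A u) {f : R} (hf : IsAlgebraic (Algebra.adjoin A (Set.range u)) f) :
    ∃ P : MvPolynomial (Fin t) A[X], P ≠ 0 ∧ P.eval₂ (aeval f : A[X] →ₐ[A] R).toRingHom u = 0 := by
  have h1 : ¬ AlgebraicIndependent A fun o : Option (Fin t) => o.elim f u := by
    rw [hu.option_iff_transcendental]
    exact not_not.mpr hf
  rw [algebraicIndependent_iff] at h1
  push Not at h1
  obtain ⟨p, hp, hp0⟩ := h1
  refine ⟨MvPolynomial.optionEquivRight A (Fin t) p,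
    (map_ne_zero_iff _ (AlgEquiv.injective _)).mpr hp0, ?_⟩
  rw [← hp]
  have : ∀ q, (MvPolynomial.optionEquivRight A (Fin t) q).eval₂
      (aeval f : A[X] →ₐ[A] R).toRingHom u = MvPolynomial.aeval (fun o => o.elim f u) q := by
    intro q
    induction q using MvPolynomial.induction_on with
    | C a => simp
    | add p q hp hq => rw [map_add, MvPolynomial.eval₂_add, hp, hq, map_add]
    | mul_X p o hp =>
      rw [map_mul, MvPolynomial.eval₂_mul, hp, map_mul]
      cases o <;> simp
  exact this p

theorem exists_primitive_relation {t : ℕ} {u : Fin t → R}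
    (hu : AlgebraicIndependent A u) {f : R} (hf : Transcendental A f)
    (hfu : IsAlgebraic (Algebra.adjoin A (Set.range u)) f) :
    ∃ P : MvPolynomial (Fin t) A[X], P.eval₂ (aeval f : A[X] →ₐ[A] R).toRingHom u = 0 ∧
      ∃ δ : A, δ ≠ 0 ∧ C δ ∈ Ideal.span (Set.range fun m => P.coeff m) := by
  classical
  obtain ⟨P, hP0, hP⟩ := exists_relation_of_isAlgebraic hu hfu
  let φ : A[X] →+* (FractionRing A)[X] := mapRingHom (algebraMap A (FractionRing A))
  have hφ : Function.Injective φ := map_injective _ (IsFractionRing.injective A (FractionRing A))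
  let J : Ideal (FractionRing A)[X] := Ideal.span ((fun m => φ (P.coeff m)) '' P.support)
  obtain ⟨c, hc⟩ : ∃ c, J = Ideal.span {c} := (IsPrincipalIdealRing.principal J).principal
  have hb : ∀ m, ∃ b, m ∈ P.support → φ (P.coeff m) = c * b := by
    intro m
    by_cases hm : m ∈ P.support
    · have : φ (P.coeff m) ∈ J := Ideal.subset_span ⟨m, hm, rfl⟩
      rw [hc, Ideal.mem_span_singleton'] at this
      obtain ⟨b, hb⟩ := this
      exact ⟨b, fun _ => by rw [← hb, mul_comm]⟩
    · exact ⟨0, fun h => absurd h hm⟩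
  choose b hb using hb
  obtain ⟨m₀, hm₀⟩ := MvPolynomial.support_nonempty.mpr hP0
  have hc0 : c ≠ 0 := by
    rintro rfl
    have := hb m₀ hm₀
    rw [zero_mul] at this
    exact MvPolynomial.mem_support_iff.mp hm₀ (hφ (this.trans (map_zero φ).symm))
  have hcJ : c ∈ J := hc ▸ Ideal.mem_span_singleton_self c
  obtain ⟨a, ha⟩ := (Submodule.mem_span_image_finset_iff_exists_fun' _).mp hcJ
  have hab : ∑ m ∈ P.support, a m * b m = 1 := by
    apply mul_left_cancel₀ hc0
    rw [mul_one, Finset.mul_sum]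
    nth_rewrite 2 [← ha]
    refine Finset.sum_congr rfl fun m hm => ?_
    rw [hb m hm, smul_eq_mul]
    ring
  obtain ⟨d₁, hd₁, c', hc'⟩ := exists_polynomial_common_denominator Finset.univ fun _ : Unit => c
  obtain ⟨d₂, hd₂, b', hb'⟩ := exists_polynomial_common_denominator P.support b
  obtain ⟨d₃, hd₃, a', ha'⟩ := exists_polynomial_common_denominator P.support a
  have hcb : ∀ m ∈ P.support, c' () * b' m = C (d₁ * d₂) * P.coeff m := by
    intro m hm
    apply hφ
    have h1 := hc' () (Finset.mem_univ _)
    have h2 := hb' m hm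
    have h3 := hb m hm
    simp only [φ, coe_mapRingHom, Polynomial.map_C, map_mul] at h3 ⊢
    rw [h1, h2, h3]
    ring
  have hba : ∑ m ∈ P.support, a' m * b' m = C (d₃ * d₂) := by
    apply hφ
    have h3 : ∀ m ∈ P.support, φ (a' m * b' m) =
        C (algebraMap A (FractionRing A) (d₃ * d₂)) * (a m * b m) := by
      intro m hm
      simp only [φ, coe_mapRingHom, map_mul, hb' m hm, ha' m hm]
      ring
    rw [map_sum, Finset.sum_congr rfl h3, ← Finset.mul_sum, hab, mul_one]
    simp [φ]
  let P' : MvPolynomial (Fin t) A[X] := ∑ m ∈ P.support, MvPolynomial.monomial m (b' m)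
  have hcoeff : ∀ m ∈ P.support, P'.coeff m = b' m := by
    intro m hm
    simp [P', MvPolynomial.coeff_sum, MvPolynomial.coeff_monomial, hm]
  have hP' : MvPolynomial.C (c' ()) * P' = MvPolynomial.C (C (d₁ * d₂)) * P := by
    conv_rhs => rw [← MvPolynomial.support_sum_monomial_coeff P]
    simp only [P', Finset.mul_sum, MvPolynomial.C_mul_monomial]
    exact Finset.sum_congr rfl fun m hm => by rw [hcb m hm]
  have hc'0 : c' () ≠ 0 := by
    intro h
    have h1 := hc' () (Finset.mem_univ _)
    rw [h, Polynomial.map_zero] at h1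
    refine mul_ne_zero ?_ hc0 h1.symm
    rw [Ne, Polynomial.C_eq_zero]
    exact fun h => hd₁ (IsFractionRing.injective A (FractionRing A) (h.trans (map_zero _).symm))
  refine ⟨P', ?_, d₃ * d₂, mul_ne_zero hd₃ hd₂, ?_⟩
  · have h1 := congrArg (MvPolynomial.eval₂ (aeval f : A[X] →ₐ[A] R).toRingHom u) hP'
    rw [MvPolynomial.eval₂_mul, MvPolynomial.eval₂_mul, hP, mul_zero, MvPolynomial.eval₂_C] at h1
    refine (mul_eq_zero.mp h1).resolve_left fun h2 => ?_
    exact hf ⟨c' (), hc'0, h2⟩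
  · rw [← hba]
    refine Ideal.sum_mem _ fun m hm => Ideal.mul_mem_left _ _ ?_
    rw [← hcoeff m hm]
    exact Ideal.subset_span ⟨m, rfl⟩

end PrimitiveRelation

section GenericNormalization

variable {A R : Type*} [CommRing A] [IsDomain A] [CommRing R] [IsDomain R] [Algebra A R]

omit [IsDomain R] in
theorem exists_mul_mem_adjoin_of_mem_adjoin_fractionRing {L E : Type*} [Field L] [Algebra A L]
    [IsFractionRing A L] [Field E] [Algebra R E] [Algebra A E] [IsScalarTower A R E] [Algebra L E]
    [IsScalarTower A L E] {s : Set R} {x : E}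
    (hx : x ∈ Algebra.adjoin L (algebraMap R E '' s)) :
    ∃ d : A, d ≠ 0 ∧ ∃ y ∈ Algebra.adjoin A s, algebraMap R E y = algebraMap A E d * x := by
  induction hx using Algebra.adjoin_induction with
  | mem x hx =>
    obtain ⟨y, hy, rfl⟩ := hx
    exact ⟨1, one_ne_zero, y, Algebra.subset_adjoin hy, by simp⟩
  | algebraMap r =>
    obtain ⟨a, d, hd, rfl⟩ := IsFractionRing.div_surjective (A := A) r
    refine ⟨d, nonZeroDivisors.ne_zero hd, algebraMap A R a, Subalgebra.algebraMap_mem _ _, ?_⟩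
    rw [← IsScalarTower.algebraMap_apply A R E, IsScalarTower.algebraMap_apply A L E,
      IsScalarTower.algebraMap_apply A L E, ← map_mul, mul_div_cancel₀]
    exact IsFractionRing.to_map_ne_zero_of_mem_nonZeroDivisors hd
  | add x y _ _ hx hy =>
    obtain ⟨d, hd, a, ha, h1⟩ := hx
    obtain ⟨e, he, b, hb, h2⟩ := hy
    refine ⟨d * e, mul_ne_zero hd he, algebraMap A R e * a + algebraMap A R d * b,
      add_mem (mul_mem (Subalgebra.algebraMap_mem _ _) ha)
        (mul_mem (Subalgebra.algebraMap_mem _ _) hb), ?_⟩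
    simp only [map_add, map_mul, h1, h2, ← IsScalarTower.algebraMap_apply A R E]
    ring
  | mul x y _ _ hx hy =>
    obtain ⟨d, hd, a, ha, h1⟩ := hx
    obtain ⟨e, he, b, hb, h2⟩ := hy
    refine ⟨d * e, mul_ne_zero hd he, a * b, mul_mem ha hb, ?_⟩
    simp only [map_mul, h1, h2]
    ring

omit [IsDomain R] in
theorem exists_isIntegral_mul_of_eval₂_eq_zero {L E : Type*} [Field L] [Algebra A L]
    [IsFractionRing A L] [Field E] [Algebra R E] [FaithfulSMul R E] [Algebra A E]
    [IsScalarTower A R E] [Algebra L E] [IsScalarTower A L E] {t : ℕ} (u : Fin t → R) (y : R)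
    {p : (MvPolynomial (Fin t) L)[X]} (hp : p.Monic)
    (hy : p.eval₂ (MvPolynomial.aeval fun i => algebraMap R E (u i)).toRingHom
      (algebraMap R E y) = 0) :
    ∃ d : A, d ≠ 0 ∧ IsIntegral (Algebra.adjoin A (Set.range u)) (algebraMap A R d * y) := by
  let _ : Algebra (MvPolynomial (Fin t) A) (MvPolynomial (Fin t) L) :=
    MvPolynomial.algebraMvPolynomial
  let _ : Algebra (MvPolynomial (Fin t) L) E :=
    (MvPolynomial.aeval fun i => algebraMap R E (u i)).toRingHom.toAlgebra
  let _ : Algebra (MvPolynomial (Fin t) A) E :=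
    (MvPolynomial.aeval fun i => algebraMap R E (u i)).toRingHom.toAlgebra
  have : IsScalarTower (MvPolynomial (Fin t) A) (MvPolynomial (Fin t) L) E := by
    refine IsScalarTower.of_algebraMap_eq fun q => ?_
    change MvPolynomial.aeval (fun i => algebraMap R E (u i)) q =
      MvPolynomial.aeval (fun i => algebraMap R E (u i)) (MvPolynomial.map (algebraMap A L) q)
    rw [MvPolynomial.aeval_map_algebraMap]
  obtain ⟨⟨_, d, hd, rfl⟩, q, hq, hq0⟩ := IsIntegral.exists_multiple_integral_of_isLocalization
    ((nonZeroDivisors A).map (MvPolynomial.C (σ := Fin t))) (Rₘ := MvPolynomial (Fin t) L)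
    (algebraMap R E y) ⟨p, hp, hy⟩
  refine ⟨d, nonZeroDivisors.ne_zero hd, ?_⟩
  have hmem : ∀ q, MvPolynomial.aeval (R := A) u q ∈ Algebra.adjoin A (Set.range u) := by
    intro q
    rw [Algebra.adjoin_range_eq_range_aeval]
    exact ⟨q, rfl⟩
  refine ⟨q.map ((MvPolynomial.aeval (R := A) u).codRestrict _ hmem).toRingHom, hq.map _, ?_⟩
  rw [Polynomial.eval₂_map]
  apply FaithfulSMul.algebraMap_injective R E
  rw [map_zero, Polynomial.hom_eval₂, ← hq0]
  congr 1
  · ext x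
    · simp [RingHom.algebraMap_toAlgebra, IsScalarTower.algebraMap_apply A R E]
    · simp [RingHom.algebraMap_toAlgebra]
  · rw [Submonoid.smul_def, Algebra.smul_def]
    simp [RingHom.algebraMap_toAlgebra, IsScalarTower.algebraMap_apply A R E]

theorem exists_generic_noether_normalization [FaithfulSMul A R] {ι : Type*} [Finite ι]
    (F : ι → R) : ∃ t, ∃ u : Fin t → R, (∀ i, u i ∈ Algebra.adjoin A (Set.range F)) ∧
      AlgebraicIndependent A u ∧ ∃ δ : A, δ ≠ 0 ∧
      ∀ j, IsIntegral (Algebra.adjoin A (Set.range u)) (algebraMap A R δ * F j) := by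
  let E := FractionRing R
  let L := FractionRing A
  have : FaithfulSMul A E := FaithfulSMul.trans A R E
  let _ : Algebra L E := FractionRing.liftAlgebra A E
  have : IsScalarTower A L E := FractionRing.isScalarTower_liftAlgebra A E
  set S := Algebra.adjoin L (algebraMap R E '' Set.range F) with hS
  have : Algebra.FiniteType L S := (Subalgebra.fg_iff_finiteType _).mp
    (Subalgebra.fg_def.mpr ⟨_, (Set.finite_range F).image _, rfl⟩)
  obtain ⟨t, g, hgi, hg⟩ := exists_integral_inj_algHom_of_fg L S
  choose d hd u hu hud using fun i =>
    exists_mul_mem_adjoin_of_mem_adjoin_fractionRing (A := A) (g (MvPolynomial.X i)).2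
  have hx : AlgebraicIndependent L fun i => (g (MvPolynomial.X i) : E) :=
    ((MvPolynomial.algebraicIndependent_X (Fin t) L).map' hgi).map' (f := S.val)
      Subtype.val_injective
  have hdL : ∀ i, algebraMap A L (d i) ≠ 0 := fun i h =>
    hd i (IsFractionRing.injective A L (h.trans (map_zero _).symm))
  have huL : AlgebraicIndependent L fun i => algebraMap R E (u i) := by
    have := hx.polynomial_aeval_of_transcendental
      (f := fun i => C (algebraMap A L (d i)) * X) fun i => by
        refine Polynomial.transcendental _ ?_ ?_
        · simp [natDegree_C_mul_X _ (hdL i)]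
        · simp [hdL i]
    convert this using 2 with i
    simp [hud i, IsScalarTower.algebraMap_apply A L E]
  have huA : AlgebraicIndependent A u :=
    ((IsScalarTower.toAlgHom A R E).algebraicIndependent_iff
      (IsFractionRing.injective R E)).mp (huL.restrictScalars (IsFractionRing.injective A L))
  have hInt : ∀ j, ∃ δ : A, δ ≠ 0 ∧
      IsIntegral (Algebra.adjoin A (Set.range u)) (algebraMap A R δ * F j) := by
    intro j
    have hj : algebraMap R E (F j) ∈ S := Algebra.subset_adjoin ⟨_, ⟨j, rfl⟩, rfl⟩
    obtain ⟨p, hp, hp0⟩ := hg ⟨_, hj⟩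
    let χ : MvPolynomial (Fin t) L →ₐ[L] MvPolynomial (Fin t) L :=
      MvPolynomial.aeval fun i => MvPolynomial.C (algebraMap A L (d i))⁻¹ * MvPolynomial.X i
    have hval : S.val.comp g = (MvPolynomial.aeval fun i => algebraMap R E (u i)).comp χ := by
      refine MvPolynomial.algHom_ext fun i => ?_
      simp [χ, hud i, IsScalarTower.algebraMap_apply A L E, hdL i]
    refine exists_isIntegral_mul_of_eval₂_eq_zero (L := L) (E := E) u (F j)
      (p := p.map χ.toRingHom) (hp.map _) ?_
    rw [Polynomial.eval₂_map]
    have := congrArg S.val hp0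
    rw [map_zero, ← AlgHom.coe_toRingHom, Polynomial.hom_eval₂] at this
    have h2 := congrArg AlgHom.toRingHom hval
    refine Eq.trans ?_ this
    exact congrArg (fun φ => p.eval₂ φ (algebraMap R E (F j))) h2.symm
  choose δ hδ hδi using hInt
  classical
  have := Fintype.ofFinite ι
  refine ⟨t, u, hu, huA, ∏ j, δ j, Finset.prod_ne_zero_iff.mpr fun j _ => hδ j, fun j => ?_⟩
  rw [← Finset.mul_prod_erase _ _ (Finset.mem_univ j), map_mul, mul_comm (algebraMap A R (δ j)),
    mul_assoc]
  refine IsIntegral.mul ?_ (hδi j)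
  exact isIntegral_algebraMap (x := algebraMap A (Algebra.adjoin A (Set.range u)) _)

end GenericNormalization

section Specialization

variable {A R : Type*} [CommRing A] [CommRing R] [Algebra A R] {K Ω : Type*} [Field K] [Field Ω]
  [Algebra K Ω]

theorem isIntegral_of_isIntegral_algebraMap_mul {t : ℕ} {u : Fin t → R} {δ : A} {x : R}
    (hx : IsIntegral (Algebra.adjoin A (Set.range u)) (algebraMap A R δ * x)) {φ : A →+* K}
    {ψ : R →+* Ω} (h : ∀ a, ψ (algebraMap A R a) = algebraMap K Ω (φ a)) (hδ : φ δ ≠ 0) :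
    IsIntegral (Algebra.adjoin K (Set.range (ψ ∘ u))) (ψ x) := by
  have hmem : ∀ y : Algebra.adjoin A (Set.range u),
      ψ y ∈ (Algebra.adjoin K (Set.range (ψ ∘ u))).toSubring := by
    rintro ⟨y, hy⟩
    induction hy using Algebra.adjoin_induction with
    | mem y hy =>
      obtain ⟨i, rfl⟩ := hy
      exact Algebra.subset_adjoin ⟨i, rfl⟩
    | algebraMap a =>
      change ψ (algebraMap A R a) ∈ _
      rw [h]
      exact Subalgebra.algebraMap_mem _ _
    | add y z _ _ hy hz =>
      change ψ (y + z) ∈ _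
      rw [map_add]
      exact add_mem hy hz
    | mul y z _ _ hy hz =>
      change ψ (y * z) ∈ _
      rw [map_mul]
      exact mul_mem hy hz
  have h1 := IsIntegral.map_of_comp_eq
    (((ψ.comp (Algebra.adjoin A (Set.range u)).val.toRingHom).codRestrict
      (Algebra.adjoin K (Set.range (ψ ∘ u))).toSubring hmem :
        Algebra.adjoin A (Set.range u) →+* Algebra.adjoin K (Set.range (ψ ∘ u)))) ψ
    (by ext y; rfl) hx
  have h2 : ψ x = algebraMap K Ω (φ δ)⁻¹ * ψ (algebraMap A R δ * x) := by
    rw [map_mul, h, ← mul_assoc, ← map_mul, inv_mul_cancel₀ hδ, map_one, one_mul]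
  rw [h2]
  exact IsIntegral.mul
    (isIntegral_algebraMap (x := algebraMap K (Algebra.adjoin K (Set.range (ψ ∘ u))) _)) h1

theorem not_algebraicIndependent_of_relation {t : ℕ} {u : Fin t → R} {f : R}
    {P : MvPolynomial (Fin t) A[X]} (hP : P.eval₂ (aeval f : A[X] →ₐ[A] R).toRingHom u = 0)
    {δ : A} (hPδ : C δ ∈ Ideal.span (Set.range fun m => P.coeff m)) {φ : A →+* K}
    {ψ : R →+* Ω} (h : ∀ a, ψ (algebraMap A R a) = algebraMap K Ω (φ a)) (hδ : φ δ ≠ 0) {b : K}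
    (hb : ψ f = algebraMap K Ω b) : ¬AlgebraicIndependent K (ψ ∘ u) := by
  intro hind
  have h0 : P.map (eval₂RingHom φ b) = 0 := by
    apply hind
    rw [map_zero, MvPolynomial.aeval_def, MvPolynomial.eval₂_map, ← map_zero ψ, ← hP,
      MvPolynomial.hom_eval₂]
    congr 1
    ext a
    · simp [h]
    · simp [hb]
  have hle : Ideal.span (Set.range fun m => P.coeff m) ≤ RingHom.ker (eval₂RingHom φ b) := by
    rw [Ideal.span_le]
    rintro _ ⟨m, rfl⟩
    have := congrArg (MvPolynomial.coeff m) h0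
    rwa [MvPolynomial.coeff_map] at this
  have := hle hPδ
  rw [RingHom.mem_ker] at this
  simp at this
  exact hδ this

theorem exists_generic_specialization [IsDomain A] [IsDomain R] [FaithfulSMul A R] {ι : Type*}
    [Finite ι] (F : ι → R) {f : R} (hfF : f ∈ Set.range F) (hf : Transcendental A f) :
    ∃ t, ∃ u : Fin t → R, (∀ i, u i ∈ Algebra.adjoin A (Set.range F)) ∧
      AlgebraicIndependent A u ∧ ∃ δ : A, δ ≠ 0 ∧ ∀ (K : Type) (Ω : Type) [Field K] [Field Ω]
        [Algebra K Ω] (φ : A →+* K) (ψ : R →+* Ω),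
        (∀ a, ψ (algebraMap A R a) = algebraMap K Ω (φ a)) → φ δ ≠ 0 →
        ∀ b : K, ψ f = algebraMap K Ω b → ¬AlgebraicIndependent K (ψ ∘ u) ∧
          ∀ j, IsIntegral (Algebra.adjoin K (Set.range (ψ ∘ u))) (ψ (F j)) := by
  obtain ⟨t, u, hu, hui, δ, hδ, hInt⟩ := exists_generic_noether_normalization (A := A) F
  obtain ⟨j₀, rfl⟩ := hfF
  have hδ' : algebraMap A R δ ≠ 0 := fun h =>
    hδ (FaithfulSMul.algebraMap_injective A R (h.trans (map_zero _).symm))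
  have : Nontrivial (Algebra.adjoin A (Set.range u)) := inferInstance
  have htr : Transcendental A (algebraMap A R δ * F j₀) := fun hal => by
    refine hf ?_
    rw [← Algebra.smul_def] at hal
    obtain ⟨p, hp, hp0⟩ := hal
    refine ⟨p.comp (C δ * X), ?_, ?_⟩
    · intro h
      refine hp ((Polynomial.comp_eq_zero_iff.mp h).resolve_right ?_)
      rintro ⟨-, h2⟩
      have := congrArg (fun q => coeff q 1) h2
      simp [hδ] at this
    · simpa [aeval_comp, Algebra.smul_def] using hp0
  obtain ⟨P, hP, δ', hδ'0, hPδ⟩ := exists_primitive_relation hui htr (hInt j₀).isAlgebraic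
  refine ⟨t, u, hu, hui, δ * δ', mul_ne_zero hδ hδ'0, fun K Ω _ _ _ φ ψ h hφ b hb => ?_⟩
  rw [map_mul] at hφ
  refine ⟨not_algebraicIndependent_of_relation hP hPδ h (right_ne_zero_of_mul hφ)
    (b := φ δ * b) ?_, fun j =>
    isIntegral_of_isIntegral_algebraMap_mul (hInt j) h (left_ne_zero_of_mul hφ)⟩
  rw [map_mul, h, hb, map_mul]

end Specialization

section Monomials

theorem AlgebraicIndependent.linearIndependent_monomials {A R : Type*} [CommRing A] [CommRing R]
    [Algebra A R] {t : ℕ} {u : Fin t → R} (hu : AlgebraicIndependent A u) :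
    LinearIndependent A fun m : Fin t →₀ ℕ => ∏ i, u i ^ m i := by
  have h := (MvPolynomial.basisMonomials (Fin t) A).linearIndependent.map_injOn
    (MvPolynomial.aeval u).toLinearMap (Function.Injective.injOn hu)
  convert h using 2 with m
  simp [MvPolynomial.aeval_monomial, Finsupp.prod_fintype]

theorem AlgebraicIndependent.pow_le_finrank_pow {A R : Type*} [CommRing A] [IsDomain A]
    [CommRing R] [Algebra A R] {t : ℕ} {u : Fin t → R} (hu : AlgebraicIndependent A u)
    {M : Submodule A R} (hM : M.FG) (h1 : 1 ∈ M) {e : ℕ} (he : ∀ i, u i ∈ M ^ e) (n : ℕ) :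
    (n + 1) ^ t ≤ Module.finrank A (M ^ (e * n * t) : Submodule A R) := by
  have hmem : ∀ c : Fin t → Fin (n + 1), ∏ i, u i ^ (c i : ℕ) ∈ M ^ (e * n * t) := by
    intro c
    have h2 : ∀ s : Finset (Fin t), ∏ i ∈ s, u i ^ (c i : ℕ) ∈ M ^ (e * n * s.card) := by
      classical
      intro s
      induction s using Finset.induction_on with
      | empty => simpa using ⟨1, map_one _⟩
      | insert i s hi ih =>
        rw [Finset.prod_insert hi, Finset.card_insert_of_notMem hi, mul_add_one, add_comm,
          pow_add]
        refine Submodule.mul_mem_mul ?_ ih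
        have := Submodule.pow_mem_pow _ (he i) (c i : ℕ)
        rw [← pow_mul] at this
        exact Submodule.pow_mono_of_one_le h1
          (Nat.mul_le_mul_left e (Nat.le_of_lt_succ (c i).2)) this
    simpa using h2 Finset.univ
  have hinj : Function.Injective fun c : Fin t → Fin (n + 1) =>
      Finsupp.equivFunOnFinite.symm fun i => (c i : ℕ) := by
    intro c c' h
    have := Finsupp.equivFunOnFinite.symm.injective h
    funext i
    exact Fin.ext (congrFun this i)
  have hli := hu.linearIndependent_monomials.comp _ hinj
  have : Module.Finite A (M ^ (e * n * t) : Submodule A R) :=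
    Module.Finite.iff_fg.mpr (hM.pow _)
  have hli' : LinearIndependent A fun c : Fin t → Fin (n + 1) =>
      (⟨_, hmem c⟩ : (M ^ (e * n * t) : Submodule A R)) :=
    LinearIndependent.of_comp (Submodule.subtype _) hli
  simpa using hli'.fintype_card_le_finrank

end Monomials

section BaseChange

variable {k K : Type*} [Field k] [Field K] [Algebra k K]

theorem mk_dual_coeff_mul_map (ℓ : Module.Dual k K) (P : K[X]) (v : PowerSeries k) :
    PowerSeries.mk (fun n => ℓ (PowerSeries.coeff n
      ((P : PowerSeries K) * PowerSeries.map (algebraMap k K) v))) =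
    PowerSeries.mk (fun n => ℓ (P.coeff n)) * v := by
  ext n
  rw [PowerSeries.coeff_mk, PowerSeries.coeff_mul, PowerSeries.coeff_mul, map_sum]
  refine Finset.sum_congr rfl fun x _ => ?_
  rw [PowerSeries.coeff_map, mul_comm, ← Algebra.smul_def, map_smul, PowerSeries.coeff_mk,
    smul_eq_mul, mul_comm, Polynomial.coeff_coe]

theorem exists_polynomial_coe_eq_mk_dual (ℓ : Module.Dual k K) (P : K[X]) :
    ∃ p : k[X], (∀ n, p.coeff n = ℓ (P.coeff n)) ∧
      (p : PowerSeries k) = PowerSeries.mk (fun n => ℓ (P.coeff n)) := by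
  have h : ∀ n, (∑ i ∈ Finset.range (P.natDegree + 1), monomial i (ℓ (P.coeff i))).coeff n =
      ℓ (P.coeff n) := by
    intro n
    rw [Polynomial.finsetSum_coeff]
    simp only [coeff_monomial]
    rw [Finset.sum_ite_eq']
    split_ifs with hn
    · rfl
    · rw [coeff_eq_zero_of_natDegree_lt (by simpa using hn), map_zero]
  exact ⟨_, h, by ext n; rw [Polynomial.coeff_coe, h, PowerSeries.coeff_mk]⟩

theorem AlgebraicIndependent.map_powerSeries {t : ℕ} {u : Fin t → PowerSeries k}
    (hu : AlgebraicIndependent k[X] u) :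
    AlgebraicIndependent K[X] fun i => PowerSeries.map (algebraMap k K) (u i) := by
  rw [algebraicIndependent_iff]
  intro q hq
  have h0 : ∑ m ∈ q.support, ((q.coeff m : K[X]) : PowerSeries K) *
      PowerSeries.map (algebraMap k K) (∏ i, u i ^ m i) = 0 := by
    rw [MvPolynomial.aeval_def, MvPolynomial.eval₂_eq'] at hq
    simp only [map_prod, map_pow]
    exact hq
  ext m n
  rw [MvPolynomial.coeff_zero, Polynomial.coeff_zero]
  rw [← Module.forall_dual_apply_eq_zero_iff k]
  intro ℓ
  choose p hp hp' using exists_polynomial_coe_eq_mk_dual (k := k) (K := K) ℓ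
  have h1 : ∑ m ∈ q.support, p (q.coeff m) • ∏ i, u i ^ m i = 0 := by
    have : ∀ m, p (q.coeff m) • ∏ i, u i ^ m i = PowerSeries.mk fun n => ℓ (PowerSeries.coeff n
        (((q.coeff m : K[X]) : PowerSeries K) *
          PowerSeries.map (algebraMap k K) (∏ i, u i ^ m i))) := by
      intro m
      rw [mk_dual_coeff_mul_map, ← hp']
      rfl
    simp only [this]
    ext n
    rw [map_sum]
    simp only [PowerSeries.coeff_mk]
    rw [← map_sum, ← map_sum, h0]
    simp
  by_cases hm : m ∈ q.support
  · have := linearIndependent_iff'.mp hu.linearIndependent_monomials _ _ h1 m hm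
    rw [← hp, this, Polynomial.coeff_zero]
  · rw [MvPolynomial.notMem_support_iff.mp hm, Polynomial.coeff_zero, map_zero]

end BaseChange

section ExceptionalPoint

variable {K : Type*} [Field K] [NumberField K]

omit [NumberField K] in
theorem derivative_polynomial_smul (p : K[X]) (x : PowerSeries K) :
    PowerSeries.derivative K (p • x) =
      p • PowerSeries.derivative K x + Polynomial.derivative p • x := by
  simp only [Algebra.smul_def]
  change PowerSeries.derivative K ((p : PowerSeries K) * x) = (p : PowerSeries K) * _ +
    ((Polynomial.derivative p : K[X]) : PowerSeries K) * x
  rw [Derivation.leibniz, PowerSeries.derivative_coe, smul_eq_mul, smul_eq_mul]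
  ring

omit [NumberField K] in
theorem smul_derivative_mem_span {s : Set (PowerSeries K)} {T : K[X]}
    {M : Submodule K[X] (PowerSeries K)} (hM : M = Submodule.span K[X] s)
    (h : ∀ x ∈ s, T • PowerSeries.derivative K x ∈ M) :
    ∀ x ∈ M, T • PowerSeries.derivative K x ∈ M := by
  intro x hx
  rw [hM] at hx
  induction hx using Submodule.span_induction with
  | mem x hx => exact h x hx
  | zero => simp
  | add x y _ _ hx hy =>
    rw [map_add, smul_add]
    exact add_mem hx hy
  | smul p x hxs hx =>
    rw [derivative_polynomial_smul, smul_add, smul_comm]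
    exact add_mem (M.smul_mem _ hx) (M.smul_mem _ (M.smul_mem _ (hM ▸ hxs)))

omit [NumberField K] in
theorem smul_derivative_mem_pow {T : K[X]} {M : Submodule K[X] (PowerSeries K)}
    (h : ∀ x ∈ M, T • PowerSeries.derivative K x ∈ M) {N : ℕ} :
    ∀ x ∈ M ^ N, T • PowerSeries.derivative K x ∈ M ^ N := by
  intro x hx
  induction hx using Submodule.pow_induction_on_left' with
  | algebraMap p =>
    rw [pow_zero, Algebra.algebraMap_eq_smul_one, derivative_polynomial_smul,
      Derivation.map_one_eq_zero, smul_zero, zero_add]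
    exact Submodule.smul_mem _ _ (Submodule.smul_mem _ _ (Submodule.one_le.mp le_rfl))
  | add x y i _ _ hx hy =>
    rw [map_add, smul_add]
    exact add_mem hx hy
  | mem_mul m hm i x hxi hx =>
    rw [Derivation.leibniz, smul_eq_mul, smul_eq_mul, smul_add, mul_comm x, pow_succ']
    rw [← mul_smul_comm, ← smul_mul_assoc]
    exact add_mem (Submodule.mul_mem_mul hm hx) (Submodule.mul_mem_mul (h m hm) hxi)

variable [Algebra K ℂ]

theorem evalAt_mem_span {s : Set (PowerSeries K)} (hs : ∀ x ∈ s, EType x) (α : K)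
    {V : Submodule K ℂ} (hV : ∀ x ∈ s, evalAt (algebraMap K ℂ α) x ∈ V) {x : PowerSeries K}
    (hx : x ∈ Submodule.span K[X] s) : EType x ∧ evalAt (algebraMap K ℂ α) x ∈ V := by
  induction hx using Submodule.span_induction with
  | mem x hx => exact ⟨hs x hx, hV x hx⟩
  | zero =>
    have h0 : EType (0 : PowerSeries K) := (eTypeSubalgebra K).zero_mem
    exact ⟨h0, by simp [evalAt]⟩
  | add x y _ _ hx hy =>
    refine ⟨hx.1.add hy.1, ?_⟩
    rw [evalAt_add hx.1 hy.1]
    exact add_mem hx.2 hy.2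
  | smul p x _ hx =>
    refine ⟨hx.1.smul p, ?_⟩
    rw [evalAt_smul hx.1, aeval_algebraMap_apply_eq_algebraMap_eval, ← Algebra.smul_def]
    exact V.smul_mem _ hx.2

theorem evalAt_mem_pow {M : Submodule K[X] (PowerSeries K)} {α : K} {V : Submodule K ℂ}
    (h : ∀ x ∈ M, EType x ∧ evalAt (algebraMap K ℂ α) x ∈ V) {N : ℕ} {x : PowerSeries K}
    (hx : x ∈ M ^ N) : EType x ∧ evalAt (algebraMap K ℂ α) x ∈ V ^ N := by
  induction hx using Submodule.pow_induction_on_left' with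
  | algebraMap p =>
    refine ⟨EType.polynomial p, ?_⟩
    change evalAt _ (p : PowerSeries K) ∈ _
    rw [evalAt_polynomial, aeval_algebraMap_apply_eq_algebraMap_eval, pow_zero]
    exact Submodule.mem_one.mpr ⟨_, rfl⟩
  | add x y i _ _ hx hy =>
    refine ⟨hx.1.add hy.1, ?_⟩
    rw [evalAt_add hx.1 hy.1]
    exact add_mem hx.2 hy.2
  | mem_mul m hm i x hxi hx =>
    refine ⟨(h m hm).1.mul hx.1, ?_⟩
    rw [evalAt_mul (h m hm).1 hx.1, pow_succ']
    exact Submodule.mul_mem_mul (h m hm).2 hx.2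

theorem exists_mul_pow_lt_pow {s t : ℕ} (hst : s < t) (B e : ℕ) :
    ∃ n, B * (e * n * t + 1) ^ s < (n + 1) ^ t := by
  set D := B * (e * t + 1) ^ s with hD
  refine ⟨D, ?_⟩
  calc B * (e * D * t + 1) ^ s ≤ B * ((e * t + 1) * (D + 1)) ^ s := by
        gcongr
        nlinarith [Nat.zero_le (e * t), Nat.zero_le D]
    _ = D * (D + 1) ^ s := by rw [mul_pow, ← mul_assoc]
    _ < (D + 1) * (D + 1) ^ s := by
        apply Nat.mul_lt_mul_of_pos_right (Nat.lt_succ_self D)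
        positivity
    _ = (D + 1) ^ (s + 1) := by rw [pow_succ']
    _ ≤ (D + 1) ^ t := Nat.pow_le_pow_right (Nat.succ_pos _) hst

/-- At a regular algebraic point, algebraically independent functions in the algebra generated by
a solution vector of E-functions take algebraically independent values, provided the values of the
whole solution vector are integral over them. -/
theorem algebraicIndependent_evalAt {ι : Type*} [Finite ι] {F : ι → PowerSeries K}
    (hF : ∀ j, EType (F j)) {T : K[X]}
    (hT : ∀ j, T • PowerSeries.derivative K (F j) ∈
      Submodule.span K[X] (insert 1 (Set.range F)))
    {α : K} (hα : α ≠ 0) (hTα : T.eval α ≠ 0) {t : ℕ} {u : Fin t → PowerSeries K}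
    (hu : ∀ i, u i ∈ Algebra.adjoin K[X] (Set.range F)) (hui : AlgebraicIndependent K[X] u)
    (hInt : ∀ j, IsIntegral (Algebra.adjoin K (Set.range fun i => evalAt (algebraMap K ℂ α) (u i)))
      (evalAt (algebraMap K ℂ α) (F j))) :
    AlgebraicIndependent K fun i => evalAt (algebraMap K ℂ α) (u i) := by
  by_contra hdep
  set z := algebraMap K ℂ α with hz
  set M := Submodule.span K[X] (insert 1 (Set.range F)) with hM
  set V := Submodule.span K (insert 1 (Set.range fun j => evalAt z (F j))) with hV
  have hMfg : M.FG := Submodule.fg_span ((Set.finite_range F).insert 1)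
  have hVfg : V.FG := Submodule.fg_span ((Set.finite_range _).insert 1)
  have h1M : (1 : PowerSeries K) ∈ M := Submodule.subset_span (Set.mem_insert _ _)
  have h1V : (1 : ℂ) ∈ V := Submodule.subset_span (Set.mem_insert _ _)
  have hMV : ∀ x ∈ M, EType x ∧ evalAt z x ∈ V := by
    intro x hx
    refine evalAt_mem_span ?_ α ?_ hx
    · rintro x (rfl | ⟨j, rfl⟩)
      · exact (eTypeSubalgebra K).one_mem
      · exact hF j
    · rintro x (rfl | ⟨j, rfl⟩)
      · rw [← map_one PowerSeries.C, evalAt_C, map_one]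
        exact h1V
      · exact Submodule.subset_span (Set.mem_insert_of_mem _ ⟨j, rfl⟩)
  have hMT : ∀ x ∈ M, T • PowerSeries.derivative K x ∈ M := by
    refine smul_derivative_mem_span hM ?_
    rintro x (rfl | ⟨j, rfl⟩)
    · simp
    · exact hT j
  have hVint : ∀ x ∈ V, IsIntegral (Algebra.adjoin K (Set.range fun i => evalAt z (u i))) x := by
    intro x hx
    induction hx using Submodule.span_induction with
    | mem x hx =>
      obtain rfl | ⟨j, rfl⟩ := hx
      · exact isIntegral_one
      · exact hInt j
    | zero => exact isIntegral_zero
    | add x y _ _ hx hy => exact hx.add hy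
    | smul a x _ hx => exact hx.smul a
  obtain ⟨s, hst, C, hC⟩ :=
    exists_finrank_pow_le_of_not_algebraicIndependent _ hdep hVfg hVint
  choose e he using fun i =>
    exists_mem_pow_of_mem_adjoin h1M (fun x hx => Submodule.subset_span (Or.inr hx)) (hu i)
  obtain ⟨n, hn⟩ := exists_mul_pow_lt_pow hst (Module.finrank ℚ K * C) (Finset.univ.sup e)
  refine hn.not_ge ?_
  have h2 := hui.pow_le_finrank_pow hMfg h1M (e := Finset.univ.sup e)
    (fun i => Submodule.pow_mono_of_one_le h1M (Finset.le_sup (Finset.mem_univ i)) (he i)) n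
  refine h2.trans ?_
  set N := Finset.univ.sup e * n * t
  have : FiniteDimensional K (V ^ N : Submodule K ℂ) := Module.Finite.iff_fg.mpr (hVfg.pow _)
  refine (finrank_le_of_derivation_stable (M ^ N) (hMfg.pow _)
    (fun x hx => (evalAt_mem_pow hMV hx).1)
    (Submodule.pow_mono_of_one_le h1M (Nat.zero_le N) (by simp))
    (smul_derivative_mem_pow hMT) hα hTα (fun x hx => (evalAt_mem_pow hMV hx).2)).trans ?_
  rw [mul_assoc]
  exact Nat.mul_le_mul_left _ (hC N)

end ExceptionalPoint

section EntireTaylor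

theorem hasFPowerSeriesOnBall_of_hasSum {c : ℕ → ℂ} {f : ℂ → ℂ}
    (h : ∀ z, HasSum (fun n => c n * z ^ n) (f z)) :
    HasFPowerSeriesOnBall f (FormalMultilinearSeries.ofScalars ℂ c) 0 ⊤ := by
  refine ⟨?_, ENNReal.zero_lt_top, fun {y} _ => ?_⟩
  · refine (ENNReal.eq_top_of_forall_nnreal_le fun r => ?_).ge
    refine FormalMultilinearSeries.le_radius_of_tendsto _ (l := 0) ?_
    have := (h (r : ℂ)).summable.tendsto_atTop_zero.norm
    simpa [FormalMultilinearSeries.ofScalars_norm] using this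
  · simpa [FormalMultilinearSeries.ofScalars_apply_eq, mul_comm] using h y

theorem differentiable_of_hasSum {c : ℕ → ℂ} {f : ℂ → ℂ}
    (h : ∀ z, HasSum (fun n => c n * z ^ n) (f z)) : Differentiable ℂ f := by
  have := (hasFPowerSeriesOnBall_of_hasSum h).differentiableOn
  rwa [Metric.eball_top, differentiableOn_univ] at this

/-- The Taylor series at the origin. -/
def taylorSeries (f : ℂ → ℂ) : PowerSeries ℂ :=
  PowerSeries.mk fun n => iteratedDeriv n f 0 / n.factorial

theorem taylorSeries_eq_of_hasSum {c : ℕ → ℂ} {f : ℂ → ℂ}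
    (h : ∀ z, HasSum (fun n => c n * z ^ n) (f z)) : taylorSeries f = PowerSeries.mk c := by
  ext n
  have h1 := (hasFPowerSeriesOnBall_of_hasSum h).factorial_smul 1 n
  rw [← iteratedDeriv_eq_iteratedFDeriv, FormalMultilinearSeries.ofScalars_apply_eq] at h1
  rw [taylorSeries, PowerSeries.coeff_mk, PowerSeries.coeff_mk, ← h1,
    div_eq_iff (by exact_mod_cast n.factorial_ne_zero)]
  simp [mul_comm]

theorem taylorSeries_polynomial (p : ℂ[X]) :
    taylorSeries (fun z => p.eval z) = (p : PowerSeries ℂ) := by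
  rw [taylorSeries_eq_of_hasSum (c := p.coeff)]
  · ext n
    simp
  · intro z
    rw [eval_eq_sum_range]
    refine hasSum_sum_of_ne_finset_zero fun n hn => ?_
    rw [coeff_eq_zero_of_natDegree_lt (by simpa using hn), zero_mul]

theorem taylorSeries_deriv (f : ℂ → ℂ) :
    taylorSeries (deriv f) = PowerSeries.derivative ℂ (taylorSeries f) := by
  ext n
  rw [PowerSeries.coeff_derivative, taylorSeries, taylorSeries, PowerSeries.coeff_mk,
    PowerSeries.coeff_mk, iteratedDeriv_succ', Nat.factorial_succ]
  have : (n.factorial : ℂ) ≠ 0 := by exact_mod_cast n.factorial_ne_zero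
  have : (n : ℂ) + 1 ≠ 0 := by exact_mod_cast n.succ_ne_zero
  push_cast
  field_simp

theorem taylorSeries_iteratedDeriv (f : ℂ → ℂ) (j : ℕ) :
    taylorSeries (iteratedDeriv j f) = (PowerSeries.derivative ℂ)^[j] (taylorSeries f) := by
  induction j with
  | zero => simp
  | succ j ih => rw [iteratedDeriv_succ, taylorSeries_deriv, ih, Function.iterate_succ_apply']

theorem taylorSeries_mul {f g : ℂ → ℂ} (hf : Differentiable ℂ f) (hg : Differentiable ℂ g) :
    taylorSeries (f * g) = taylorSeries f * taylorSeries g := by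
  ext n
  rw [PowerSeries.coeff_mul, taylorSeries, PowerSeries.coeff_mk,
    iteratedDeriv_mul hf.contDiff.contDiffAt hg.contDiff.contDiffAt,
    Finset.Nat.sum_antidiagonal_eq_sum_range_succ_mk, Finset.sum_div]
  refine Finset.sum_congr rfl fun i hi => ?_
  have hin : i ≤ n := Nat.le_of_lt_succ (Finset.mem_range.mp hi)
  rw [taylorSeries, taylorSeries, PowerSeries.coeff_mk, PowerSeries.coeff_mk,
    ← Nat.choose_mul_factorial_mul_factorial hin]
  have : (i.factorial : ℂ) ≠ 0 := by exact_mod_cast i.factorial_ne_zero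
  have : ((n - i).factorial : ℂ) ≠ 0 := by exact_mod_cast (n - i).factorial_ne_zero
  have : (n.choose i : ℂ) ≠ 0 := by exact_mod_cast (Nat.choose_pos hin).ne'
  push_cast
  field_simp

theorem taylorSeries_sum {ι : Type*} (s : Finset ι) {f : ι → ℂ → ℂ}
    (hf : ∀ i ∈ s, Differentiable ℂ (f i)) :
    taylorSeries (∑ i ∈ s, f i) = ∑ i ∈ s, taylorSeries (f i) := by
  ext n
  rw [map_sum, taylorSeries, PowerSeries.coeff_mk,
    iteratedDeriv_sum fun i hi => (hf i hi).contDiff.contDiffAt, Finset.sum_div]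
  simp [taylorSeries]

theorem differentiable_iteratedDeriv {f : ℂ → ℂ} (hf : Differentiable ℂ f) (j : ℕ) :
    Differentiable ℂ (iteratedDeriv j f) :=
  hf.contDiff.differentiable_iteratedDeriv' j

/-- A linear differential equation satisfied by an entire function is satisfied by its Taylor
series. -/
theorem sum_polynomial_mul_iterate_derivative_taylorSeries {f : ℂ → ℂ} (hf : Differentiable ℂ f)
    {r : ℕ} {p : Fin r → ℂ[X]}
    (h : ∀ z, ∑ j, (p j).eval z * iteratedDeriv (j : ℕ) f z = 0) :
    ∑ j, (p j : PowerSeries ℂ) * (PowerSeries.derivative ℂ)^[(j : ℕ)] (taylorSeries f) = 0 := by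
  have h0 : ∑ j, (fun z => (p j).eval z) * iteratedDeriv (j : ℕ) f = 0 := by
    funext z
    simpa using h z
  have h1 := congrArg taylorSeries h0
  rw [taylorSeries_sum _ fun j _ => (p j).differentiable.mul (differentiable_iteratedDeriv hf j)]
    at h1
  have h2 : taylorSeries 0 = 0 := by
    ext n
    have : (0 : ℂ → ℂ) = fun _ => 0 := rfl
    simp [taylorSeries, this]
  rw [h2] at h1
  rw [← h1]
  refine Finset.sum_congr rfl fun j _ => ?_
  rw [taylorSeries_mul (p j).differentiable (differentiable_iteratedDeriv hf j),
    taylorSeries_polynomial, taylorSeries_iteratedDeriv]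

end EntireTaylor

section Recurrence

theorem finite_setOf_sum_mul_descFactorial_eq_zero {r : ℕ} {b : Fin r → ℂ} (hb : ∃ j, b j ≠ 0) :
    {n : ℕ | ∑ j, b j * (n.descFactorial j : ℂ) = 0}.Finite := by
  set Q : ℂ[X] := ∑ j, C (b j) * descPochhammer ℂ j with hQ
  have heval : ∀ n : ℕ, Q.eval (n : ℂ) = ∑ j, b j * (n.descFactorial j : ℂ) := by
    intro n
    simp [hQ, eval_finsetSum, descPochhammer_eval_eq_descFactorial]
  have hQ0 : Q ≠ 0 := by
    intro h0
    obtain ⟨j₀, hj₀⟩ := hb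
    obtain ⟨j, hj, hmin⟩ := Finset.exists_min_image (Finset.univ.filter fun j => b j ≠ 0) id
      ⟨j₀, by simpa using hj₀⟩
    have h1 := heval j
    rw [h0, eval_zero, Finset.sum_eq_single j] at h1
    · rw [Nat.descFactorial_self] at h1
      rcases mul_eq_zero.mp h1.symm with h | h
      · exact (Finset.mem_filter.mp hj).2 h
      · exact (j : ℕ).factorial_ne_zero (by exact_mod_cast h)
    · intro i _ hij
      by_cases hi : b i = 0
      · rw [hi, zero_mul]
      · have h2 : j ≤ i := hmin i (by simpa using hi)
        have h3 : (j : ℕ) < i := lt_of_le_of_ne h2 fun h => hij (Fin.ext h.symm)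
        rw [Nat.descFactorial_eq_zero_iff_lt.mpr h3]
        simp
    · simp
  refine ((Q.roots.toFinset.finite_toSet).preimage
    (Nat.cast_injective (R := ℂ)).injOn).subset fun n hn => ?_
  simp only [Set.mem_preimage, Finset.mem_coe, Multiset.mem_toFinset]
  rw [mem_roots hQ0, IsRoot.def, heval]
  exact hn

theorem coeff_X_pow_mul_iterate_derivative (G : PowerSeries ℂ) (j n : ℕ) :
    PowerSeries.coeff n (PowerSeries.X ^ j * (PowerSeries.derivative ℂ)^[j] G) =
      n.descFactorial j * PowerSeries.coeff n G := by
  rw [PowerSeries.coeff_X_pow_mul']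
  split_ifs with h
  · rw [PowerSeries.coeff_iterate_derivative, ← Nat.add_descFactorial_eq_ascFactorial,
      Nat.sub_add_cancel h]
  · rw [Nat.descFactorial_eq_zero_iff_lt.mpr (not_le.mp h)]
    simp

/-- The coefficients of a power series solution of a linear differential equation lie in any field
containing the coefficients of the equation and finitely many coefficients of the solution. -/
theorem exists_finset_forall_coeff_mem {G : PowerSeries ℂ} {r : ℕ} {p : Fin r → ℂ[X]}
    (hp : ∃ j, p j ≠ 0)
    (h : ∑ j, (p j : PowerSeries ℂ) * (PowerSeries.derivative ℂ)^[(j : ℕ)] G = 0) :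
    ∃ S : Finset ℕ, ∀ L : IntermediateField ℚ ℂ, (∀ j i, (p j).coeff i ∈ L) →
      (∀ n ∈ S, PowerSeries.coeff n G ∈ L) → ∀ n, PowerSeries.coeff n G ∈ L := by
  classical
  set q : Fin r → ℂ[X] := fun j => p j * X ^ (r - j) with hq
  set χ : ℕ → ℕ → ℂ := fun i m => ∑ j, (q j).coeff i * (m.descFactorial j : ℂ) with hχ
  have hrec : ∀ k, ∑ im ∈ Finset.HasAntidiagonal.antidiagonal k,
      χ im.1 im.2 * PowerSeries.coeff im.2 G = 0 := by
    intro k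
    have h1 : ∑ j, (q j : PowerSeries ℂ) *
        (PowerSeries.X ^ (j : ℕ) * (PowerSeries.derivative ℂ)^[(j : ℕ)] G) = 0 := by
      rw [← mul_zero (PowerSeries.X ^ r), ← h, Finset.mul_sum]
      refine Finset.sum_congr rfl fun j _ => ?_
      have : (PowerSeries.X : PowerSeries ℂ) ^ r =
          PowerSeries.X ^ (r - (j : ℕ)) * PowerSeries.X ^ (j : ℕ) := by
        rw [← pow_add, Nat.sub_add_cancel j.2.le]
      rw [this, hq]
      push_cast
      ring
    have h2 := congrArg (PowerSeries.coeff k) h1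
    rw [map_sum, map_zero] at h2
    simp only [PowerSeries.coeff_mul k, coeff_X_pow_mul_iterate_derivative] at h2
    rw [Finset.sum_comm] at h2
    rw [← h2]
    refine Finset.sum_congr rfl fun im _ => ?_
    rw [hχ, Finset.sum_mul]
    refine Finset.sum_congr rfl fun j _ => ?_
    rw [Polynomial.coeff_coe, mul_assoc]
  have hq0 : ∃ i, ∃ j, (q j).coeff i ≠ 0 := by
    obtain ⟨j, hj⟩ := hp
    have : q j ≠ 0 := mul_ne_zero hj (pow_ne_zero _ X_ne_zero)
    by_contra! hc
    exact this (Polynomial.ext fun i => by simpa using hc i j)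
  set i₀ := Nat.find hq0 with hi₀
  have hmin : ∀ i < i₀, ∀ m, χ i m = 0 := by
    intro i hi m
    refine Finset.sum_eq_zero fun j _ => ?_
    have := Nat.find_min hq0 hi
    push Not at this
    rw [this j, zero_mul]
  refine ⟨(finite_setOf_sum_mul_descFactorial_eq_zero (Nat.find_spec hq0)).toFinset,
    fun L hL hS n => ?_⟩
  have hχL : ∀ i m, χ i m ∈ L := by
    intro i m
    refine sum_mem fun j _ => mul_mem ?_ (natCast_mem L _)
    rw [hq]
    simp only [coeff_mul_X_pow']
    split_ifs
    · exact hL _ _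
    · exact zero_mem L
  induction n using Nat.strong_induction_on with
  | _ n ih =>
    by_cases hn : χ i₀ n = 0
    · exact hS n (by simpa using hn)
    have h1 := hrec (i₀ + n)
    rw [← Finset.add_sum_erase _ _ (a := (i₀, n)) (by simp)] at h1
    have h2 : PowerSeries.coeff n G = (χ i₀ n)⁻¹ * -∑ im ∈
        (Finset.HasAntidiagonal.antidiagonal (i₀ + n)).erase (i₀, n),
          χ im.1 im.2 * PowerSeries.coeff im.2 G := by
      rw [← eq_neg_of_add_eq_zero_left h1, inv_mul_cancel_left₀ hn]
    rw [h2]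
    refine mul_mem (inv_mem (hχL _ _)) (neg_mem (sum_mem fun im him => ?_))
    obtain ⟨hne, hin⟩ := Finset.mem_erase.mp him
    have hsum := Finset.HasAntidiagonal.mem_antidiagonal.mp hin
    by_cases hlt : im.1 < i₀
    · rw [hmin _ hlt, zero_mul]
      exact zero_mem L
    · refine mul_mem (hχL _ _) (ih _ ?_)
      by_contra hge
      exact hne (Prod.ext (by simp only; omega) (by simp only; omega))

end Recurrence

section NumberFieldModel

theorem house_le_of_forall_norm_le {K : Type*} [Field K] [NumberField K] {x : K} {B : ℝ}
    (h : ∀ σ : K →+* ℂ, ‖σ x‖ ≤ B) : house x ≤ B := by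
  have hB : 0 ≤ B := (norm_nonneg _).trans (h (Classical.arbitrary _))
  exact (pi_norm_le_iff_of_nonneg hB).mpr h

theorem exists_ringHom_qbar_extending {L : IntermediateField ℚ ℂ} (hL : L ≤ Qbar) (σ : L →+* ℂ) :
    ∃ τ : Qbar →+* ℂ, ∀ (x : L) (y : Qbar), (y : ℂ) = x → τ y = σ x := by
  let _ : Algebra L Qbar := (IntermediateField.inclusion hL).toRingHom.toAlgebra
  have : IsScalarTower ℚ L Qbar := IsScalarTower.of_algebraMap_eq fun _ => rfl
  have : Algebra.IsAlgebraic ℚ Qbar := algebraicClosure.isAlgebraic ℚ ℂ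
  have : Algebra.IsAlgebraic L Qbar := Algebra.IsAlgebraic.tower_top (K := ℚ) L
  obtain ⟨τ, hτ⟩ := IsAlgClosed.surjective_domRestrict_of_isAlgebraic (K := ℚ) (L := L) (E := Qbar)
    (M := ℂ) σ.toRatAlgHom
  refine ⟨τ.toRingHom, fun x y hxy => ?_⟩
  have h1 : y = algebraMap L Qbar x := Subtype.ext hxy
  rw [h1]
  exact DFunLike.congr_fun hτ x

theorem eType_of_bounds {L : IntermediateField ℚ ℂ} [NumberField L] (hL : L ≤ Qbar)
    {F : PowerSeries L} {a : ℕ → Qbar} (ha : ∀ n, (a n : ℂ) = expCoeff n F) {C : ℝ}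
    (hC : ∀ σ : Qbar →+* ℂ, ∀ n, ‖σ (a n)‖ ≤ C ^ (n + 1)) (hC0 : 0 < C) {D : ℝ} (hD0 : 0 < D)
    {d : ℕ → ℕ} (hd : ∀ n, d n ≠ 0 ∧ (d n : ℝ) ≤ D ^ (n + 1))
    (hInt : ∀ n, ∀ m ≤ n, IsIntegral ℤ ((d n : ℂ) * (a m : ℂ))) : EType F := by
  refine ⟨max 1 (max C D), le_max_left _ _, d, fun n => ⟨Nat.pos_of_ne_zero (hd n).1, ?_⟩,
    fun n => ?_, fun n m hm => ?_⟩
  · refine (hd n).2.trans ?_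
    gcongr
    exact (le_max_right _ _).trans (le_max_right _ _)
  · refine house_le_of_forall_norm_le fun σ => ?_
    obtain ⟨τ, hτ⟩ := exists_ringHom_qbar_extending hL σ
    rw [← hτ _ _ (ha n)]
    refine (hC τ n).trans ?_
    gcongr
    exact (le_max_left _ _).trans (le_max_right _ _)
  · have h1 := hInt n m hm
    rw [ha] at h1
    rw [← isIntegral_algebraMap_iff (FaithfulSMul.algebraMap_injective L ℂ)]
    simpa using h1

theorem exists_trimmed_relation {R M : Type*} [Semiring R] [AddCommMonoid M] [Module R M] {r : ℕ}
    {p : Fin r → R} {x : ℕ → M} (hp : ∃ j, p j ≠ 0) (h : ∑ j, p j • x j = 0) :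
    ∃ s, ∃ P : ℕ → R, P s ≠ 0 ∧ ∑ j ∈ Finset.range (s + 1), P j • x j = 0 := by
  classical
  let P : ℕ → R := fun j => if h : j < r then p ⟨j, h⟩ else 0
  obtain ⟨j₀, hj₀⟩ := hp
  obtain ⟨s, hs, hmax⟩ := Finset.exists_max_image ((Finset.range r).filter fun j => P j ≠ 0) id
    ⟨j₀, by simp [P, hj₀]⟩
  obtain ⟨hsr, hs0⟩ := Finset.mem_filter.mp hs
  refine ⟨s, P, hs0, ?_⟩
  rw [← h, Finset.sum_subset (s₂ := Finset.range r)]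
  · rw [Finset.sum_range]
    simp [P]
  · intro j hj
    simp only [Finset.mem_range] at *
    omega
  · intro j hjr hj
    by_cases h0 : P j = 0
    · rw [h0, zero_smul]
    · have := hmax j (Finset.mem_filter.mpr ⟨hjr, h0⟩)
      simp only [Finset.mem_range, id] at *
      omega

theorem exists_finiteDimensional_intermediateField {S : Set ℂ} (hS : S.Finite)
    (h : ∀ x ∈ S, IsAlgebraic ℚ x) :
    ∃ L : IntermediateField ℚ ℂ, FiniteDimensional ℚ L ∧ ∀ x ∈ S, x ∈ L := by
  refine ⟨IntermediateField.adjoin ℚ S, ?_, fun x hx => IntermediateField.subset_adjoin _ _ hx⟩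
  have := hS.to_subtype
  exact IntermediateField.finiteDimensional_adjoin fun x hx => (h x hx).isIntegral

theorem map_iterate_derivative {R S : Type*} [CommRing R] [CommRing S] (φ : R →+* S)
    (F : PowerSeries R) (j : ℕ) : PowerSeries.map φ ((PowerSeries.derivative R)^[j] F) =
      (PowerSeries.derivative S)^[j] (PowerSeries.map φ F) := by
  ext n
  rw [PowerSeries.coeff_map, PowerSeries.coeff_iterate_derivative,
    PowerSeries.coeff_iterate_derivative, map_mul, map_natCast, PowerSeries.coeff_map]

theorem exists_polynomial_map_eq {L : IntermediateField ℚ ℂ} {p : ℂ[X]} (h : ∀ i, p.coeff i ∈ L) :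
    ∃ q : L[X], q.map (algebraMap L ℂ) = p := by
  have : p ∈ Polynomial.lifts (algebraMap L ℂ) := by
    rw [Polynomial.lifts_iff_coeff_lifts]
    exact fun n => ⟨⟨_, h n⟩, rfl⟩
  exact (Polynomial.mem_lifts p).mp this

theorem exists_numberField_model {f : ℂ → ℂ} {a : ℕ → Qbar}
    (hsum : ∀ z, HasSum (fun n => (a n : ℂ) / n.factorial * z ^ n) (f z)) {r : ℕ}
    {p : Fin r → ℂ[X]} (hp : ∀ j i, IsAlgebraic ℚ ((p j).coeff i)) (hp0 : ∃ j, p j ≠ 0)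
    (hode : ∀ z, ∑ j, (p j).eval z * iteratedDeriv (j : ℕ) f z = 0) :
    ∃ L : IntermediateField ℚ ℂ, FiniteDimensional ℚ L ∧ ∃ F : PowerSeries L,
      (∀ n, (a n : ℂ) = expCoeff n F) ∧
      ∃ s, ∃ P : ℕ → L[X], P s ≠ 0 ∧
        ∑ j ∈ Finset.range (s + 1), P j • (PowerSeries.derivative L)^[j] F = 0 := by
  have hG := taylorSeries_eq_of_hasSum hsum
  have hodeG := sum_polynomial_mul_iterate_derivative_taylorSeries
    (differentiable_of_hasSum hsum) hode
  rw [hG] at hodeG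
  set G : PowerSeries ℂ := PowerSeries.mk fun n => (a n : ℂ) / n.factorial with hGdef
  obtain ⟨S, hS⟩ := exists_finset_forall_coeff_mem hp0 hodeG
  have halg : ∀ n, IsAlgebraic ℚ (PowerSeries.coeff n G) := by
    intro n
    rw [hGdef, PowerSeries.coeff_mk, div_eq_mul_inv]
    exact (mem_algebraicClosure_iff.mp (a n).2).mul (isAlgebraic_natCast _).inv
  obtain ⟨L, hLfin, hL⟩ := exists_finiteDimensional_intermediateField
    (S := ((fun n => PowerSeries.coeff n G) '' S) ∪ ⋃ j, (p j).coeff '' (p j).support)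
    ((S.finite_toSet.image _).union
      (Set.finite_iUnion fun j => (p j).support.finite_toSet.image _)) (by
      rintro x (⟨n, -, rfl⟩ | hx)
      · exact halg n
      · obtain ⟨j, i, -, rfl⟩ := Set.mem_iUnion.mp hx
        exact hp j i)
  have hpL : ∀ j i, (p j).coeff i ∈ L := by
    intro j i
    by_cases hi : (p j).coeff i = 0
    · rw [hi]
      exact zero_mem L
    · exact hL _ (Or.inr (Set.mem_iUnion.mpr ⟨j, i, by simpa using hi, rfl⟩))
  have hGL := hS L hpL fun n hn => hL _ (Or.inl ⟨n, hn, rfl⟩)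
  choose q hq using fun j => exists_polynomial_map_eq (hpL j)
  let F : PowerSeries L := PowerSeries.mk fun n => ⟨_, hGL n⟩
  have hFG : PowerSeries.map (algebraMap L ℂ) F = G := by
    ext n
    rw [PowerSeries.coeff_map, PowerSeries.coeff_mk]
    rfl
  refine ⟨L, hLfin, F, fun n => ?_, ?_⟩
  · have h1 : ((PowerSeries.coeff n F : L) : ℂ) = a n / n.factorial := by
      rw [PowerSeries.coeff_mk]
      change PowerSeries.coeff n G = _
      rw [hGdef, PowerSeries.coeff_mk]
    have h2 : (n.factorial : ℂ) ≠ 0 := by exact_mod_cast n.factorial_ne_zero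
    rw [expCoeff]
    push_cast
    rw [h1, mul_div_cancel₀ _ h2]
  · refine exists_trimmed_relation (p := q) (x := fun j => (PowerSeries.derivative L)^[j] F) ?_ ?_
    · obtain ⟨j, hj⟩ := hp0
      refine ⟨j, fun h => hj ?_⟩
      rw [← hq, h, Polynomial.map_zero]
    · apply PowerSeries.map_injective (algebraMap L ℂ) (FaithfulSMul.algebraMap_injective L ℂ)
      rw [map_sum, map_zero, ← hodeG]
      refine Finset.sum_congr rfl fun j _ => ?_
      rw [← hFG, ← map_iterate_derivative, Algebra.smul_def, map_mul, ← hq]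
      congr 1
      change PowerSeries.map _ (q j : PowerSeries L) = _
      ext n
      simp [Polynomial.coeff_coe]

end NumberFieldModel

section FinalArgument

variable (K : Type*) [Field K] [NumberField K]

/-- The `K[X]`-algebra of power series of E-type. -/
def eTypePolynomialSubalgebra : Subalgebra K[X] (PowerSeries K) where
  carrier := {F | EType F}
  mul_mem' := EType.mul
  add_mem' := EType.add
  algebraMap_mem' := EType.polynomial

/-- Evaluation at `z` as a ring homomorphism on the `K[X]`-algebra of power series of E-type. -/
def eTypeEvalHom [Algebra K ℂ] (z : ℂ) : eTypePolynomialSubalgebra K →+* ℂ where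
  toFun F := evalAt z F.1
  map_one' := (evalHom K z).map_one
  map_mul' F G := evalAt_mul F.2 G.2 z
  map_zero' := (evalHom K z).map_zero
  map_add' F G := evalAt_add F.2 G.2 z

theorem eTypeEvalHom_algebraMap [Algebra K ℂ] (z : ℂ) (p : K[X]) :
    eTypeEvalHom K z (algebraMap K[X] (eTypePolynomialSubalgebra K) p) = aeval z p :=
  evalAt_polynomial p z

variable {K}

section Extension

variable {k : Type*} [Field k] [NumberField k] [Algebra k K]

theorem EType.map {F : PowerSeries k} (hF : EType F) :
    EType (PowerSeries.map (algebraMap k K) F) := by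
  obtain ⟨C, hC, d, hd, h1, h2⟩ := hF
  have hcoeff : ∀ n, expCoeff n (PowerSeries.map (algebraMap k K) F) =
      algebraMap k K (expCoeff n F) := by
    intro n
    simp [expCoeff]
  refine ⟨C, hC, d, hd, fun n => ?_, fun n m hm => ?_⟩
  · rw [hcoeff]
    exact house_le_of_forall_norm_le fun σ =>
      (norm_embedding_le_house _ (σ.comp (algebraMap k K))).trans (h1 n)
  · rw [hcoeff]
    have := (h2 n m hm).map (algebraMap k K).toIntAlgHom
    simpa using this

omit [NumberField K] [NumberField k] in
theorem map_polynomial_smul (p : k[X]) (x : PowerSeries k) :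
    PowerSeries.map (algebraMap k K) (p • x) =
      p.map (algebraMap k K) • PowerSeries.map (algebraMap k K) x := by
  rw [Algebra.smul_def, Algebra.smul_def, map_mul]
  congr 1
  change PowerSeries.map _ (p : PowerSeries k) =
    ((p.map (algebraMap k K) : K[X]) : PowerSeries K)
  ext n
  simp [Polynomial.coeff_coe]

omit [NumberField K] [NumberField k] in
theorem map_mem_span {s : Set (PowerSeries k)} {x : PowerSeries k}
    (hx : x ∈ Submodule.span k[X] s) : PowerSeries.map (algebraMap k K) x ∈
      Submodule.span K[X] (PowerSeries.map (algebraMap k K) '' s) := by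
  induction hx using Submodule.span_induction with
  | mem x hx => exact Submodule.subset_span ⟨x, hx, rfl⟩
  | zero => simp
  | add x y _ _ hx hy =>
    rw [map_add]
    exact add_mem hx hy
  | smul p x _ hx =>
    rw [map_polynomial_smul]
    exact Submodule.smul_mem _ _ hx

omit [NumberField K] [NumberField k] in
theorem map_mem_adjoin {s : Set (PowerSeries k)} {x : PowerSeries k}
    (hx : x ∈ Algebra.adjoin k[X] s) : PowerSeries.map (algebraMap k K) x ∈
      Algebra.adjoin K[X] (PowerSeries.map (algebraMap k K) '' s) := by
  induction hx using Algebra.adjoin_induction with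
  | mem x hx => exact Algebra.subset_adjoin ⟨x, hx, rfl⟩
  | algebraMap p =>
    rw [Algebra.algebraMap_eq_smul_one, map_polynomial_smul, map_one]
    exact Subalgebra.smul_mem _ (one_mem _) _
  | add x y _ _ hx hy =>
    rw [map_add]
    exact add_mem hx hy
  | mul x y _ _ hx hy =>
    rw [map_mul]
    exact mul_mem hx hy

omit [NumberField K] [NumberField k] in
theorem evalAt_map [Algebra k ℂ] [Algebra K ℂ] [IsScalarTower k K ℂ] (z : ℂ) (F : PowerSeries k) :
    evalAt z (PowerSeries.map (algebraMap k K) F) = evalAt z F := by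
  simp only [evalAt, PowerSeries.coeff_map, ← IsScalarTower.algebraMap_apply]

end Extension

omit [NumberField K] in
theorem smul_iterate_derivative_mem_span {F : PowerSeries K} {s : ℕ} {P : ℕ → K[X]}
    (h : ∑ j ∈ Finset.range (s + 1), P j • (PowerSeries.derivative K)^[j] F = 0) (j : Fin s) :
    (X * P s) • PowerSeries.derivative K ((PowerSeries.derivative K)^[(j : ℕ)] F) ∈
      Submodule.span K[X] (insert 1
        (Set.range fun i : Fin s => (PowerSeries.derivative K)^[(i : ℕ)] F)) := by
  have hmem : ∀ i < s, (PowerSeries.derivative K)^[i] F ∈ Submodule.span K[X] (insert 1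
      (Set.range fun i : Fin s => (PowerSeries.derivative K)^[(i : ℕ)] F)) :=
    fun i hi => Submodule.subset_span (Or.inr ⟨⟨i, hi⟩, rfl⟩)
  rw [← Function.iterate_succ_apply' (PowerSeries.derivative K)]
  rcases Nat.lt_or_ge (j + 1) s with hj | hj
  · exact Submodule.smul_mem _ _ (hmem _ hj)
  · have hjs : j + 1 = s := le_antisymm j.2 hj
    rw [Nat.succ_eq_add_one, hjs, mul_smul]
    rw [Finset.sum_range_succ] at h
    rw [eq_neg_of_add_eq_zero_right h]
    refine Submodule.smul_mem _ _ (neg_mem (sum_mem fun i hi => ?_))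
    exact Submodule.smul_mem _ _ (hmem i (Finset.mem_range.mp hi))

theorem exists_numberField_containing {L : IntermediateField ℚ ℂ} [FiniteDimensional ℚ L]
    {S : Set ℂ} (hS : S.Finite) (h : ∀ x ∈ S, IsAlgebraic ℚ x) :
    ∃ M : IntermediateField ℚ ℂ, FiniteDimensional ℚ M ∧ L ≤ M ∧ ∀ x ∈ S, x ∈ M := by
  obtain ⟨M, hM, hSM⟩ := exists_finiteDimensional_intermediateField hS h
  exact ⟨L ⊔ M, inferInstance, le_sup_left, fun x hx => le_sup_right (a := L) (hSM x hx)⟩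

theorem finite_exceptional_points_of_transcendental {L : IntermediateField ℚ ℂ} [NumberField L]
    {F : PowerSeries L} (hF : EType F) {s : ℕ} {P : ℕ → L[X]} (hP : P s ≠ 0)
    (hrel : ∑ j ∈ Finset.range (s + 1), P j • (PowerSeries.derivative L)^[j] F = 0)
    (htr : Transcendental L[X] (⟨F, hF⟩ : eTypePolynomialSubalgebra L)) :
    {α : ℂ | IsAlgebraic ℚ α ∧ IsAlgebraic ℚ (evalAt α F)}.Finite := by
  have hs : 0 < s := by
    rcases Nat.eq_zero_or_pos s with rfl | hs
    · simp only [zero_add, Finset.sum_range_one, Function.iterate_zero, id] at hrel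
      have h0 : F = 0 := (smul_eq_zero.mp hrel).resolve_left hP
      subst h0
      exact absurd (isAlgebraic_zero (R := L[X])) htr
    · exact hs
  set R := eTypePolynomialSubalgebra L
  let D : Fin s → R := fun j => ⟨_, hF.iterate_derivative j⟩
  obtain ⟨t, u, hu, hui, δ, hδ, H⟩ := exists_generic_specialization (A := L[X]) D
    (f := ⟨F, hF⟩) ⟨⟨0, hs⟩, rfl⟩ htr
  set T : L[X] := X * P s with hT
  have hT0 : T * δ ≠ 0 := mul_ne_zero (mul_ne_zero X_ne_zero hP) hδ
  have hT0' : (T * δ).map (algebraMap L ℂ) ≠ 0 :=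
    (Polynomial.map_ne_zero_iff (algebraMap L ℂ).injective).mpr hT0
  refine ((T * δ).map (algebraMap L ℂ)).roots.toFinset.finite_toSet.subset ?_
  rintro z ⟨hz, hfz⟩
  rw [Finset.mem_coe, Multiset.mem_toFinset, mem_roots hT0', IsRoot.def, eval_map_algebraMap]
  by_contra hne
  rw [map_mul] at hne
  obtain ⟨M, hM, hLM, hSM⟩ := exists_numberField_containing (L := L) (S := {z, evalAt z F})
    (by simp) (by rintro x (rfl | rfl) <;> assumption)
  have : NumberField M := ⟨⟩
  let _ : Algebra L M := (IntermediateField.inclusion hLM).toRingHom.toAlgebra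
  have : IsScalarTower L M ℂ := IsScalarTower.of_algebraMap_eq fun _ => rfl
  obtain ⟨α, rfl⟩ : ∃ α : M, algebraMap M ℂ α = z := ⟨⟨z, hSM z (by simp)⟩, rfl⟩
  obtain ⟨β, hβ⟩ : ∃ β : M, algebraMap M ℂ β = evalAt (algebraMap M ℂ α) F :=
    ⟨⟨evalAt (algebraMap M ℂ α) F, hSM _ (Or.inr rfl)⟩, rfl⟩
  have hφ : ∀ p : L[X], algebraMap M ℂ (aeval α p) = aeval (algebraMap M ℂ α) p :=
    fun p => (aeval_algebraMap_apply ℂ α p).symm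
  obtain ⟨hdep, hInt⟩ := H M ℂ (aeval α : L[X] →ₐ[L] M).toRingHom
    (eTypeEvalHom L (algebraMap M ℂ α))
    (fun p => (eTypeEvalHom_algebraMap L _ p).trans (hφ p).symm)
    (fun h => right_ne_zero_of_mul hne ((hφ δ).symm.trans ((congrArg _ h).trans (map_zero _))))
    β hβ.symm
  have hTα : aeval α T ≠ 0 := fun h =>
    left_ne_zero_of_mul hne ((hφ T).symm.trans ((congrArg _ h).trans (map_zero _)))
  have hα : α ≠ 0 := fun h => hTα (by simp [hT, h])
  have hval : ∀ i, evalAt (algebraMap M ℂ α) (PowerSeries.map (algebraMap L M) (u i).1) =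
      eTypeEvalHom L (algebraMap M ℂ α) (u i) := fun i => evalAt_map _ _
  have hDval : (fun j => PowerSeries.map (algebraMap L M) (D j).1) =
    PowerSeries.map (algebraMap L M) ∘
      fun j : Fin s => (PowerSeries.derivative L)^[(j : ℕ)] F := rfl
  apply hdep
  have key := algebraicIndependent_evalAt
    (F := fun j => PowerSeries.map (algebraMap L M) (D j).1)
    (fun j => (D j).2.map) (T := T.map (algebraMap L M)) ?_ hα ?_
    (u := fun i => PowerSeries.map (algebraMap L M) (u i).1) ?_ ?_ ?_
  · simp only [hval] at key
    exact key
  · intro j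
    have h1 := map_mem_span (K := M) (smul_iterate_derivative_mem_span hrel j)
    rw [map_polynomial_smul, Set.image_insert_eq, map_one, ← Set.range_comp] at h1
    rw [hDval]
    convert h1 using 2
    exact (map_iterate_derivative (algebraMap L M)
      ((PowerSeries.derivative L)^[(j : ℕ)] F) 1).symm
  · rwa [eval_map_algebraMap]
  · intro i
    have h1 : (u i).1 ∈ Algebra.adjoin L[X] (Set.range fun j => (D j).1) := by
      have h2 : R.val (u i) ∈ (Algebra.adjoin L[X] (Set.range D)).map R.val := ⟨_, hu i, rfl⟩
      rw [AlgHom.map_adjoin, ← Set.range_comp] at h2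
      exact h2
    have h3 := map_mem_adjoin (K := M) h1
    rwa [← Set.range_comp] at h3
  · exact (hui.map' (f := R.val) Subtype.val_injective).map_powerSeries
  · intro j
    have h1 := hInt j
    simp only [evalAt_map]
    exact h1

theorem isAlgebraicFunc_of_isAlgebraic {L : IntermediateField ℚ ℂ} [NumberField L]
    {F : PowerSeries L} (hF : EType F)
    (h : IsAlgebraic L[X] (⟨F, hF⟩ : eTypePolynomialSubalgebra L)) :
    ∃ P : Polynomial (Polynomial ℂ), P ≠ 0 ∧
      ∀ z : ℂ, ((P.eval (Polynomial.C (evalAt z F))).eval z) = 0 := by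
  obtain ⟨Q, hQ, hQ0⟩ := h
  refine ⟨Q.map (mapRingHom (algebraMap L ℂ)), ?_, fun z => ?_⟩
  · exact (Polynomial.map_ne_zero_iff
      (Polynomial.map_injective _ (algebraMap L ℂ).injective)).mpr hQ
  · have h1 := congrArg (eTypeEvalHom L z) hQ0
    rw [aeval_def, hom_eval₂, map_zero] at h1
    rw [eval_map, ← coe_evalRingHom, hom_eval₂, ← h1]
    congr 1
    · refine RingHom.ext fun p => ?_
      simp [eTypeEvalHom_algebraMap]
    · exact eval_C

end FinalArgument

end ExceptionalPoints

/-- If `f` is an E-function transcendental over `ℂ(z)`, then the set of algebraic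
numbers `α` such that `f(α)` is algebraic is finite. -/
theorem finitely_many_exceptional_points (f : ℂ → ℂ)
    (hf : IsEFunction f) (htr : ¬ IsAlgebraicFunc f) :
    {α : ℂ | IsAlgebraic ℚ α ∧ IsAlgebraic ℚ (f α)}.Finite := by
  obtain ⟨a, hsum, ⟨C, hC0, hC⟩, ⟨D, hD0, d, hd, hInt⟩, r, p, hp, hp0, hode⟩ := hf
  obtain ⟨L, hL, F, ha, s, P, hP, hrel⟩ := exists_numberField_model hsum hp hp0 hode
  have : NumberField L := ⟨⟩
  have hF : EType F := eType_of_bounds (le_algebraicClosure ℚ ℂ L) ha hC hC0 hD0 hd hInt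
  have heval : ∀ z, evalAt z F = f z := by
    intro z
    rw [← (hsum z).tsum_eq, evalAt]
    congr 1
    funext n
    have hn : (n.factorial : ℂ) ≠ 0 := Nat.cast_ne_zero.mpr n.factorial_ne_zero
    rw [ha n, expCoeff]
    push_cast
    rw [mul_div_cancel_left₀ _ hn]
    rfl
  simp only [← heval]
  refine finite_exceptional_points_of_transcendental hF hP hrel fun h => htr ?_
  obtain ⟨Q, hQ, hQ0⟩ := isAlgebraicFunc_of_isAlgebraic hF h
  exact ⟨Q, hQ, fun z => by rw [← heval]; exact hQ0 z⟩
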